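/- arXiv:1810.00795 — 8 statements merged into one kernel-verified Lean document; each statement's English description precedes it below -/
import Mathlib

section
/- Let (X, d) be a metric space, let a ≤ b be real numbers, and let γ : [a,b] → X be a unit-speed minimizing geodesic, i.e. d(γ(s), γ(t)) = |s − t| for all s, t ∈ [a,b]. Then for every x ∈ X and every r > 0, the 1-dimensional Hausdorff measure (with respect to d) of the set γ([a,b]) ∩ B(x,r) is at most 2r, where B(x,r) denotes the open ball of radius r centered at x. In particular, sup over x ∈ X and r > 0 of r^{−1}·H¹(γ([a,b]) ∩ B(x,r)) is at most 2. -/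
open MeasureTheory

theorem hausdorffMeasure_one_image_le_ediam {X : Type*} [MetricSpace X] [MeasurableSpace X]
    [BorelSpace X] {γ : ℝ → X} {s : Set ℝ} (hγ : LipschitzOnWith 1 γ s) :
    μH[1] (γ '' s) ≤ Metric.ediam s := by
  have h := hγ.hausdorffMeasure_image_le zero_le_one
  rw [hausdorffMeasure_real] at h
  simpa using h.trans (by simpa using Real.volume_le_diam s)

theorem hausdorffMeasure_one_geodesic_inter_ball_le {X : Type*} [MetricSpace X]
    [MeasurableSpace X] [BorelSpace X] {γ : ℝ → X} {s : Set ℝ}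
    (hγ : ∀ u ∈ s, ∀ v ∈ s, dist (γ u) (γ v) = |u - v|) (x : X) (r : ℝ) :
    μH[1] (γ '' s ∩ Metric.ball x r) ≤ ENNReal.ofReal (2 * r) := by
  rw [← Set.image_inter_preimage]
  refine (hausdorffMeasure_one_image_le_ediam ?_).trans (Metric.ediam_le ?_)
  · refine LipschitzOnWith.of_dist_le_mul fun u hu v hv => ?_
    simp [hγ u hu.1 v hv.1, Real.dist_eq]
  · rintro u ⟨hu, hux⟩ v ⟨hv, hvx⟩
    rw [edist_dist, Real.dist_eq, ← hγ u hu v hv]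
    apply ENNReal.ofReal_le_ofReal
    have := dist_triangle_right (γ u) (γ v) x
    rw [Set.mem_preimage, Metric.mem_ball] at hux hvx
    linarith

theorem stmt4 {X : Type*} [MetricSpace X] [MeasurableSpace X] [BorelSpace X]
    (a b : ℝ) (hab : a ≤ b) (γ : ℝ → X)
    (hγ : ∀ s ∈ Set.Icc a b, ∀ t ∈ Set.Icc a b, dist (γ s) (γ t) = |s - t|) :
    (∀ (x : X) (r : ℝ), 0 < r →
      μH[1] (γ '' Set.Icc a b ∩ Metric.ball x r) ≤ ENNReal.ofReal (2 * r)) ∧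
    ⨆ (x : X) (r : ℝ) (_ : 0 < r),
        (ENNReal.ofReal r)⁻¹ * μH[1] (γ '' Set.Icc a b ∩ Metric.ball x r) ≤ 2 := by
  have h := hausdorffMeasure_one_geodesic_inter_ball_le hγ
  refine ⟨fun x r _ => h x r, iSup_le fun x => iSup_le fun r => iSup_le fun hr => ?_⟩
  rw [mul_comm, ← div_eq_mul_inv]
  refine ENNReal.div_le_of_le_mul ((h x r).trans_eq ?_)
  rw [ENNReal.ofReal_mul zero_le_two, ENNReal.ofReal_ofNat]
end

section
/- Let (X, d) be a metric space, let μ be a Borel measure on X, and let n and m be real numbers with n > m > 1. Suppose there is K ≥ 0 such that μ(closedBall(x,t)) ≤ K·t^{n−m} for every x ∈ X and every t > 0. Then there exists a constant C depending only on n and m such that for every x₀ ∈ X and every r > 0, ∫_{X \ B(x₀, 2r)} d(x₀, z)^{1−n} dμ(z) ≤ C·K·r^{1−m}, where B(x₀, 2r) denotes the open ball of radius 2r centered at x₀. -/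
open MeasureTheory Metric

theorem setLIntegral_edist_rpow_annulus_le {X : Type*} [PseudoMetricSpace X] [MeasurableSpace X]
    (μ : Measure X) (x : X) {a b s V : ℝ} (ha : 0 < a) (hs : s ≤ 0)
    (hV : μ (closedBall x b) ≤ ENNReal.ofReal V) :
    ∫⁻ z in {z | a ≤ dist x z ∧ dist x z ≤ b}, edist x z ^ s ∂μ ≤ ENNReal.ofReal (a ^ s * V) := by
  calc ∫⁻ z in {z | a ≤ dist x z ∧ dist x z ≤ b}, edist x z ^ s ∂μ
      ≤ ∫⁻ _ in {z | a ≤ dist x z ∧ dist x z ≤ b}, ENNReal.ofReal (a ^ s) ∂μ := by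
        refine setLIntegral_mono measurable_const fun z hz => ?_
        rw [edist_dist, ENNReal.ofReal_rpow_of_pos (ha.trans_le hz.1)]
        exact ENNReal.ofReal_le_ofReal (Real.rpow_le_rpow_of_nonpos ha hz.1 hs)
    _ = ENNReal.ofReal (a ^ s) * μ {z | a ≤ dist x z ∧ dist x z ≤ b} := setLIntegral_const _ _
    _ ≤ ENNReal.ofReal (a ^ s) * ENNReal.ofReal V := by
        gcongr
        refine (measure_mono fun z hz => ?_).trans hV
        rw [mem_closedBall']
        exact hz.2
    _ = ENNReal.ofReal (a ^ s * V) := (ENNReal.ofReal_mul (by positivity)).symm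

theorem compl_ball_subset_iUnion_annulus {X : Type*} [PseudoMetricSpace X] (x : X) {R : ℝ}
    (hR : 0 < R) :
    (ball x R)ᶜ ⊆ ⋃ k : ℕ, {z | 2 ^ k * R ≤ dist x z ∧ dist x z ≤ 2 * (2 ^ k * R)} := by
  intro z hz
  rw [Set.mem_compl_iff, mem_ball', not_lt] at hz
  obtain ⟨k, hk, hk'⟩ := exists_nat_pow_near ((one_le_div hR).2 hz) (one_lt_two (α := ℝ))
  rw [le_div_iff₀ hR] at hk
  rw [div_lt_iff₀ hR, pow_succ'] at hk'
  exact Set.mem_iUnion.2 ⟨k, hk, by linarith⟩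

theorem stmt5 (n m : ℝ) (hm : 1 < m) (hnm : m < n) :
    ∃ C : ℝ, 0 < C ∧
      ∀ (X : Type u) (_ : MetricSpace X) (_ : MeasurableSpace X) (_ : BorelSpace X)
        (μ : Measure X) (K : ℝ), 0 ≤ K →
        (∀ (x : X) (t : ℝ), 0 < t →
          μ (closedBall x t) ≤ ENNReal.ofReal (K * t ^ (n - m))) →
        ∀ (x₀ : X) (r : ℝ), 0 < r →
          ∫⁻ z in (ball x₀ (2 * r))ᶜ, edist x₀ z ^ (1 - n) ∂μ
            ≤ ENNReal.ofReal (C * K * r ^ (1 - m)) := by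
  set q : ℝ := 2 ^ (1 - m)
  have hq0 : 0 < q := by positivity
  have hq1 : q < 1 := Real.rpow_lt_one_of_one_lt_of_neg one_lt_two (by linarith)
  have hq1' : 0 < 1 - q := sub_pos.2 hq1
  refine ⟨2 ^ (n - m) * q * (1 - q)⁻¹, by positivity, ?_⟩
  intro X _ _ _ μ K hK hμ x₀ r hr
  have hterm (k : ℕ) : (2 ^ k * (2 * r)) ^ (1 - n) * (K * (2 * (2 ^ k * (2 * r))) ^ (n - m)) =
      2 ^ (n - m) * q * K * r ^ (1 - m) * q ^ k := by
    have hsplit : (2 ^ k * (2 * r)) ^ (1 - n) * (2 ^ k * (2 * r)) ^ (n - m) =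
        q ^ k * (q * r ^ (1 - m)) := by
      rw [← Real.rpow_add (by positivity), show 1 - n + (n - m) = 1 - m by ring,
        Real.mul_rpow (by positivity) (by positivity), Real.mul_rpow zero_le_two hr.le,
        ← Real.rpow_pow_comm zero_le_two]
    rw [Real.mul_rpow zero_le_two (by positivity)]
    linear_combination K * 2 ^ (n - m) * hsplit
  have hsum := (hasSum_geometric_of_lt_one hq0.le hq1).mul_left
    (2 ^ (n - m) * q * K * r ^ (1 - m))
  calc ∫⁻ z in (ball x₀ (2 * r))ᶜ, edist x₀ z ^ (1 - n) ∂μ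
      ≤ ∫⁻ z in ⋃ k : ℕ, {z | 2 ^ k * (2 * r) ≤ dist x₀ z ∧ dist x₀ z ≤ 2 * (2 ^ k * (2 * r))},
          edist x₀ z ^ (1 - n) ∂μ :=
        lintegral_mono_set (compl_ball_subset_iUnion_annulus x₀ (by positivity))
    _ ≤ ∑' k : ℕ, ∫⁻ z in {z | 2 ^ k * (2 * r) ≤ dist x₀ z ∧
          dist x₀ z ≤ 2 * (2 ^ k * (2 * r))}, edist x₀ z ^ (1 - n) ∂μ :=
        lintegral_iUnion_le _ _
    _ ≤ ∑' k : ℕ, ENNReal.ofReal (2 ^ (n - m) * q * K * r ^ (1 - m) * q ^ k) := by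
        refine ENNReal.tsum_le_tsum fun k => ?_
        rw [← hterm k]
        exact setLIntegral_edist_rpow_annulus_le μ x₀ (by positivity) (by linarith)
          (hμ x₀ _ (by positivity))
    _ = ENNReal.ofReal (2 ^ (n - m) * q * (1 - q)⁻¹ * K * r ^ (1 - m)) := by
        rw [← ENNReal.ofReal_tsum_of_nonneg (fun k => by positivity) hsum.summable, hsum.tsum_eq]
        congr 1
        ring
end

section
/- Let (X, d) be a metric space, let μ be a Borel measure on X, and let n > 1 be a real number. Suppose there is K ≥ 0 such that μ(closedBall(x,t)) ≤ K·t^n for every x ∈ X and every t > 0. Then there exists a constant C depending only on n such that for every y ∈ X and every R > 0, ∫_{B(y,R)} d(y, z)^{1−n} dμ(z) ≤ C·K·R, where B(y,R) denotes the open ball of radius R centered at y. -/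
open MeasureTheory Metric

/-- Riesz-type potential bound on a dyadic annulus. -/
lemma setLIntegral_annulus_le {X : Type*} [MetricSpace X] [MeasurableSpace X] [BorelSpace X]
    {μ : Measure X} {n K : ℝ} (hn : 1 < n)
    (h : ∀ (x : X) (t : ℝ), 0 < t → μ (closedBall x t) ≤ ENNReal.ofReal (K * t ^ n))
    (y : X) {s : ℝ} (hs : 0 < s) :
    ∫⁻ z in ball y (2 * s) \ ball y s, edist y z ^ (1 - n) ∂μ
      ≤ ENNReal.ofReal (2 ^ n * K * s) := by
  have hpt : ∀ z ∈ ball y (2 * s) \ ball y s,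
      edist y z ^ (1 - n) ≤ ENNReal.ofReal (s ^ (1 - n)) := by
    intro z hz
    have hsz : s ≤ dist y z := by simpa [dist_comm] using hz.2
    rw [edist_dist, ENNReal.ofReal_rpow_of_pos (hs.trans_le hsz)]
    exact ENNReal.ofReal_le_ofReal (Real.rpow_le_rpow_of_nonpos hs hsz (by linarith))
  have hball : μ (ball y (2 * s) \ ball y s) ≤ ENNReal.ofReal (K * (2 * s) ^ n) :=
    (measure_mono (Set.sdiff_subset.trans ball_subset_closedBall)).trans
      (h y (2 * s) (by positivity))
  calc ∫⁻ z in ball y (2 * s) \ ball y s, edist y z ^ (1 - n) ∂μ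
      ≤ ∫⁻ _ in ball y (2 * s) \ ball y s, ENNReal.ofReal (s ^ (1 - n)) ∂μ :=
        setLIntegral_mono measurable_const hpt
    _ = ENNReal.ofReal (s ^ (1 - n)) * μ (ball y (2 * s) \ ball y s) := setLIntegral_const _ _
    _ ≤ ENNReal.ofReal (s ^ (1 - n)) * ENNReal.ofReal (K * (2 * s) ^ n) := by gcongr
    _ = ENNReal.ofReal (2 ^ n * K * s) := by
        rw [← ENNReal.ofReal_mul (by positivity), Real.mul_rpow (by norm_num) hs.le]
        congr 1
        have hpow : s ^ (1 - n) * s ^ n = s := by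
          rw [← Real.rpow_add hs, sub_add_cancel, Real.rpow_one]
        linear_combination (2 ^ n * K) * hpow

/-- A measure with polynomial growth of positive degree has no atoms. -/
lemma measure_singleton_eq_zero_of_growth {X : Type*} [MetricSpace X] [MeasurableSpace X]
    {μ : Measure X} {n K : ℝ} (hn : 0 < n)
    (h : ∀ (x : X) (t : ℝ), 0 < t → μ (closedBall x t) ≤ ENNReal.ofReal (K * t ^ n)) (y : X) :
    μ {y} = 0 := by
  have hlim : Filter.Tendsto (fun t : ℝ => ENNReal.ofReal (K * t ^ n))
      (nhdsWithin 0 (Set.Ioi 0)) (nhds 0) := by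
    have hcont : Continuous fun t : ℝ => ENNReal.ofReal (K * t ^ n) :=
      ENNReal.continuous_ofReal.comp
        (continuous_const.mul (Real.continuous_rpow_const hn.le))
    simpa [Real.zero_rpow hn.ne'] using (hcont.tendsto 0).mono_left nhdsWithin_le_nhds
  refine le_antisymm (ge_of_tendsto hlim ?_) zero_le
  filter_upwards [self_mem_nhdsWithin] with t ht
  exact (measure_mono (Set.singleton_subset_iff.2 (mem_closedBall_self (le_of_lt ht)))).trans
    (h y t ht)

/-- A ball is covered by its centre and dyadic annuli. -/
lemma ball_subset_singleton_union_annuli {X : Type*} [MetricSpace X] (y : X) (R : ℝ) :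
    ball y R ⊆ {y} ∪ ⋃ k : ℕ,
      ball y (2 * (R / 2 / 2 ^ k)) \ ball y (R / 2 / 2 ^ k) := by
  intro z hz
  rcases eq_or_ne z y with rfl | hzy
  · simp
  right
  have hd : 0 < dist z y := dist_pos.2 hzy
  have hR : 0 < R := hd.trans hz
  have hex : ∃ k : ℕ, R / 2 / 2 ^ k ≤ dist z y := by
    obtain ⟨k, hk⟩ := pow_unbounded_of_one_lt (R / 2 / dist z y) (one_lt_two : (1 : ℝ) < 2)
    refine ⟨k, ?_⟩
    rw [div_lt_iff₀ hd] at hk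
    rw [div_le_iff₀ (by positivity)]
    linarith
  classical
  refine Set.mem_iUnion.2 ⟨Nat.find hex, ?_, ?_⟩
  · rw [mem_ball]
    rcases hk : Nat.find hex with _ | m
    · simpa [mul_div_cancel₀] using hz
    · have hm := Nat.find_min hex (m := m) (by omega)
      rw [not_le] at hm
      have hscale : 2 * (R / 2 / 2 ^ (m + 1)) = R / 2 / 2 ^ m := by
        rw [pow_succ]
        field_simp
      rwa [hscale]
  · rw [mem_ball, not_lt]
    exact Nat.find_spec hex

theorem stmt6 (n : ℝ) (hn : 1 < n) :
    ∃ C : ℝ, 0 < C ∧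
      ∀ (X : Type u) (_ : MetricSpace X) (_ : MeasurableSpace X) (_ : BorelSpace X)
        (μ : Measure X) (K : ℝ), 0 ≤ K →
        (∀ (x : X) (t : ℝ), 0 < t →
          μ (closedBall x t) ≤ ENNReal.ofReal (K * t ^ n)) →
        ∀ (y : X) (R : ℝ), 0 < R →
          ∫⁻ z in ball y R, edist y z ^ (1 - n) ∂μ
            ≤ ENNReal.ofReal (C * K * R) := by
  refine ⟨2 ^ n, by positivity, ?_⟩
  intro X _ _ _ μ K hK h y R hR
  have hy := measure_singleton_eq_zero_of_growth (by linarith) h y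
  have hsum : HasSum (fun k : ℕ => 2 ^ n * K * (R / 2 / 2 ^ k)) (2 ^ n * K * R) :=
    (hasSum_geometric_two' R).mul_left _
  calc ∫⁻ z in ball y R, edist y z ^ (1 - n) ∂μ
      ≤ ∫⁻ z in {y} ∪ ⋃ k : ℕ, ball y (2 * (R / 2 / 2 ^ k)) \ ball y (R / 2 / 2 ^ k),
          edist y z ^ (1 - n) ∂μ :=
        lintegral_mono_set (ball_subset_singleton_union_annuli y R)
    _ ≤ ∫⁻ z in {y}, edist y z ^ (1 - n) ∂μ +
          ∫⁻ z in ⋃ k : ℕ, ball y (2 * (R / 2 / 2 ^ k)) \ ball y (R / 2 / 2 ^ k),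
            edist y z ^ (1 - n) ∂μ := lintegral_union_le _ _ _
    _ = ∫⁻ z in ⋃ k : ℕ, ball y (2 * (R / 2 / 2 ^ k)) \ ball y (R / 2 / 2 ^ k),
          edist y z ^ (1 - n) ∂μ := by
        rw [setLIntegral_measure_zero _ _ hy, zero_add]
    _ ≤ ∑' k : ℕ, ∫⁻ z in ball y (2 * (R / 2 / 2 ^ k)) \ ball y (R / 2 / 2 ^ k),
          edist y z ^ (1 - n) ∂μ := lintegral_iUnion_le _ _
    _ ≤ ∑' k : ℕ, ENNReal.ofReal (2 ^ n * K * (R / 2 / 2 ^ k)) :=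
        ENNReal.tsum_le_tsum fun k => setLIntegral_annulus_le hn h y (by positivity)
    _ = ENNReal.ofReal (2 ^ n * K * R) := by
        rw [← ENNReal.ofReal_tsum_of_nonneg (fun k => by positivity) hsum.summable, hsum.tsum_eq]
end

section
/- Let n ≥ 2 and p ≥ 1. There exists a constant C depending only on n and p such that for every Borel measure μ on ℝⁿ and every smooth compactly supported function φ : ℝⁿ → ℝ, ∫_{ℝⁿ} |φ|^p dμ ≤ C · (sup_{x ∈ ℝⁿ, r > 0} r^{1−n}·μ(B(x,r))) · ∫_{ℝⁿ} (|φ(x)|^p + ‖∇φ(x)‖^p) dx, where B(x,r) is the open Euclidean ball of radius r centered at x, ∇φ denotes the gradient of φ, and the integral on the right is taken with respect to Lebesgue measure. (When the supremum is infinite the inequality holds trivially.) -/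
open MeasureTheory Metric
open Set Filter Topology Module
open scoped ENNReal

theorem enorm_sub_le_lintegral_fderiv_segment {E : Type*} [NormedAddCommGroup E]
    [NormedSpace ℝ E] {u : E → ℝ} (hu : ContDiff ℝ 1 u) (x y : E) :
    ‖u y - u x‖ₑ ≤ ∫⁻ t in Icc (0 : ℝ) 1, ‖fderiv ℝ u ((1 - t) • x + t • y)‖ₑ * ‖y - x‖ₑ := by
  let γ : ℝ → E := fun t => (1 - t) • x + t • y
  have hγ : ∀ t, HasDerivAt γ (y - x) t := by
    intro t
    have h1 : HasDerivAt (fun t : ℝ => (1 - t) • x) ((-1 : ℝ) • x) t :=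
      ((hasDerivAt_id t).const_sub 1).smul_const x
    have h2 : HasDerivAt (fun t : ℝ => t • y) ((1 : ℝ) • y) t :=
      (hasDerivAt_id t).smul_const y
    refine (h1.add h2).congr_deriv ?_
    rw [neg_one_smul, one_smul, neg_add_eq_sub]
  have hγ' : ContDiff ℝ 1 γ := by fun_prop
  have := enorm_sub_le_lintegral_deriv_of_contDiffOn_Icc (f := u ∘ γ)
    (hu.comp hγ').contDiffOn zero_le_one
  simp only [Function.comp_apply, γ, sub_self, zero_smul, one_smul, zero_add, sub_zero,
    add_zero] at this
  refine this.trans (lintegral_mono fun t => ?_)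
  have h3 : HasDerivAt (u ∘ γ) (fderiv ℝ u (γ t) (y - x)) t :=
    ((hu.differentiable one_ne_zero).differentiableAt.hasFDerivAt).comp_hasDerivAt t (hγ t)
  change ‖deriv (u ∘ γ) t‖ₑ ≤ _
  rw [h3.deriv]
  exact ContinuousLinearMap.le_opENorm _ _

theorem lintegral_lintegral_lintegral_segment_swap {E : Type*} [NormedAddCommGroup E]
    [NormedSpace ℝ E] [FiniteDimensional ℝ E] [MeasurableSpace E] [BorelSpace E]
    (ν : Measure E) [SFinite ν] (τ : Measure ℝ) [SFinite τ] {g : E → ℝ≥0∞} (hg : Measurable g) :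
    ∫⁻ x, ∫⁻ y, (∫⁻ t, g ((1 - t) • x + t • y) ∂τ) ∂ν ∂ν
      = ∫⁻ t, ∫⁻ x, ∫⁻ y, g ((1 - t) • x + t • y) ∂ν ∂ν ∂τ := by
  have h1 : Measurable fun q : (E × ℝ) × E => g ((1 - q.1.2) • q.1.1 + q.1.2 • q.2) := by
    fun_prop
  have h2 : Measurable fun q : E × ℝ => ∫⁻ y, g ((1 - q.2) • q.1 + q.2 • y) ∂ν :=
    h1.lintegral_prod_right'
  have h3 : ∀ x, ∫⁻ y, ∫⁻ t, g ((1 - t) • x + t • y) ∂τ ∂ν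
      = ∫⁻ t, ∫⁻ y, g ((1 - t) • x + t • y) ∂ν ∂τ := by
    intro x
    have : Measurable fun q : E × ℝ => g ((1 - q.2) • x + q.2 • q.1) := by fun_prop
    exact lintegral_lintegral_swap this.aemeasurable
  simp_rw [h3]
  exact lintegral_lintegral_swap h2.aemeasurable

theorem enorm_fderiv_smoothTransition_comp {E : Type*} [NormedAddCommGroup E] [NormedSpace ℝ E]
    {f : E → ℝ} (hf : ContDiff ℝ 1 f) (c s : ℝ) (y : E) :
    ‖fderiv ℝ (fun z => Real.smoothTransition (c * (f z - s))) y‖ₑ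
      = ‖deriv Real.smoothTransition (c * (f y - s))‖ₑ * ‖c‖ₑ * ‖fderiv ℝ f y‖ₑ := by
  have h1 : HasFDerivAt (fun z => c * (f z - s)) (c • fderiv ℝ f y) y :=
    (((hf.differentiable one_ne_zero) y).hasFDerivAt.sub_const s).const_mul c
  have h2 : HasDerivAt Real.smoothTransition (deriv Real.smoothTransition (c * (f y - s)))
      (c * (f y - s)) :=
    ((Real.smoothTransition.contDiff (n := 1)).differentiable one_ne_zero _).hasDerivAt
  have h3 := h2.comp_hasFDerivAt y h1
  rw [show (fun z => Real.smoothTransition (c * (f z - s)))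
    = Real.smoothTransition ∘ fun z => c * (f z - s) from rfl, h3.fderiv, enorm_smul, enorm_smul,
    mul_assoc]

theorem lintegral_enorm_deriv_smoothTransition_ne_top :
    ∫⁻ t, ‖deriv Real.smoothTransition t‖ₑ ≠ ∞ := by
  have hc : Continuous (deriv Real.smoothTransition) :=
    (Real.smoothTransition.contDiff (n := 1)).continuous_deriv le_rfl
  have hs : HasCompactSupport (deriv Real.smoothTransition) := by
    refine HasCompactSupport.intro (isCompact_Icc (a := (0 : ℝ)) (b := 1)) fun t ht => ?_
    rw [mem_Icc, not_and_or, not_le, not_le] at ht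
    rcases ht with ht | ht
    · have : Real.smoothTransition =ᶠ[𝓝 t] fun _ => 0 := by
        filter_upwards [Iio_mem_nhds ht] with z hz
        exact Real.smoothTransition.zero_of_nonpos (le_of_lt hz)
      rw [this.deriv_eq, deriv_const]
    · have : Real.smoothTransition =ᶠ[𝓝 t] fun _ => 1 := by
        filter_upwards [Ioi_mem_nhds ht] with z hz
        exact Real.smoothTransition.one_of_one_le (le_of_lt hz)
      rw [this.deriv_eq, deriv_const]
  exact (hc.integrable_of_hasCompactSupport (μ := volume) hs).2.ne

theorem measurable_enorm_fderiv_smoothTransition_comp {E : Type*} [NormedAddCommGroup E]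
    [NormedSpace ℝ E] [FiniteDimensional ℝ E] [MeasurableSpace E] [BorelSpace E]
    {f : E → ℝ} (hf : ContDiff ℝ 1 f) (c : ℝ) :
    Measurable fun q : ℝ × E =>
      ‖fderiv ℝ (fun z => Real.smoothTransition (c * (f z - q.1))) q.2‖ₑ := by
  have hc : Continuous (deriv Real.smoothTransition) :=
    (Real.smoothTransition.contDiff (n := 1)).continuous_deriv le_rfl
  have hf' : Continuous (fderiv ℝ f) := hf.continuous_fderiv one_ne_zero
  have hfc := hf.continuous
  simp only [enorm_fderiv_smoothTransition_comp hf]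
  have h1 : Continuous fun q : ℝ × E => ‖deriv Real.smoothTransition (c * (f q.2 - q.1))‖ₑ := by
    fun_prop
  have h2 : Continuous fun q : ℝ × E => ‖fderiv ℝ f q.2‖ₑ := by fun_prop
  exact (h1.measurable.mul_const _).mul h2.measurable

section Haar

variable {E : Type*} [NormedAddCommGroup E] [NormedSpace ℝ E] [FiniteDimensional ℝ E]
  [MeasurableSpace E] [BorelSpace E] (ν : Measure E) [ν.IsAddHaarMeasure]

theorem lintegral_comp_add_smul {h : E → ℝ≥0∞} (hh : Measurable h) (w : E) {c : ℝ}
    (hc : c ≠ 0) :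
    ∫⁻ y, h (w + c • y) ∂ν = ENNReal.ofReal |(c ^ finrank ℝ E)⁻¹| * ∫⁻ y, h y ∂ν := by
  have h1 : ∫⁻ y, h (w + c • y) ∂ν = ∫⁻ z, h (w + z) ∂(Measure.map (c • ·) ν) :=
    (lintegral_map (f := fun z => h (w + z)) (by fun_prop) (by fun_prop)).symm
  rw [h1, Measure.map_addHaar_smul ν hc, lintegral_smul_measure, lintegral_add_left_eq_self,
    smul_eq_mul]

theorem setLIntegral_comp_add_smul_le {s : Set E} (hs : MeasurableSet s) {g : E → ℝ≥0∞}
    (hg : Measurable g) {w : E} {c : ℝ} (hc : 1 / 2 ≤ c) (hw : ∀ y ∈ s, w + c • y ∈ s) :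
    ∫⁻ y in s, g (w + c • y) ∂ν ≤ 2 ^ finrank ℝ E * ∫⁻ y in s, g y ∂ν := by
  have hc0 : 0 < c := by linarith
  calc ∫⁻ y in s, g (w + c • y) ∂ν
      ≤ ∫⁻ y, s.indicator g (w + c • y) ∂ν := by
        rw [← lintegral_indicator hs]
        refine lintegral_mono fun y => ?_
        by_cases hy : y ∈ s
        · simp [hy, hw y hy]
        · simp [hy]
    _ = ENNReal.ofReal |(c ^ finrank ℝ E)⁻¹| * ∫⁻ y in s, g y ∂ν := by
        rw [lintegral_comp_add_smul ν (hg.indicator hs) w hc0.ne', lintegral_indicator hs]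
    _ ≤ _ := by
        gcongr
        rw [abs_of_pos (by positivity), ← inv_pow]
        calc ENNReal.ofReal (c⁻¹ ^ finrank ℝ E) ≤ ENNReal.ofReal (2 ^ finrank ℝ E) := by
              apply ENNReal.ofReal_le_ofReal
              gcongr
              rw [inv_le_comm₀ hc0 two_pos]; linarith
          _ = 2 ^ finrank ℝ E := by
              rw [ENNReal.ofReal_pow two_pos.le]; simp

theorem lintegral_lintegral_segment_le {s : Set E} (hs : MeasurableSet s) (hconv : Convex ℝ s)
    (hfin : ν s ≠ ∞) {g : E → ℝ≥0∞} (hg : Measurable g) {t : ℝ} (ht : t ∈ Icc (0 : ℝ) 1) :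
    ∫⁻ x in s, ∫⁻ y in s, g ((1 - t) • x + t • y) ∂ν ∂ν
      ≤ 2 ^ finrank ℝ E * (∫⁻ y in s, g y ∂ν) * ν s := by
  have key : ∀ {t : ℝ}, t ≤ 1 → 1 / 2 ≤ t →
      ∫⁻ x in s, ∫⁻ y in s, g ((1 - t) • x + t • y) ∂ν ∂ν
      ≤ 2 ^ finrank ℝ E * (∫⁻ y in s, g y ∂ν) * ν s := by
    intro t ht1 ht2
    rw [← setLIntegral_const]
    refine setLIntegral_mono' hs fun x hx => ?_
    exact setLIntegral_comp_add_smul_le ν hs hg ht2 fun y hy =>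
      hconv hx hy (by linarith) (by linarith) (by ring)
  rcases le_total (1 / 2) t with h | h
  · exact key ht.2 h
  · have : IsFiniteMeasure (ν.restrict s) := ⟨by simpa using hfin.lt_top⟩
    rw [lintegral_lintegral_swap (by fun_prop)]
    have := key (t := 1 - t) (by linarith [ht.1]) (by linarith)
    simpa [add_comm] using this

theorem lintegral_lintegral_enorm_sub_le {s : Set E} (hs : MeasurableSet s)
    (hconv : Convex ℝ s) (hfin : ν s ≠ ∞) {u : E → ℝ} (hu : ContDiff ℝ 1 u) {ρ : ℝ≥0∞}
    (hρ : ∀ x ∈ s, ∀ y ∈ s, ‖y - x‖ₑ ≤ ρ) :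
    ∫⁻ x in s, ∫⁻ y in s, ‖u y - u x‖ₑ ∂ν ∂ν
      ≤ 2 ^ finrank ℝ E * (∫⁻ y in s, ‖fderiv ℝ u y‖ₑ ∂ν) * ν s * ρ := by
  have : IsFiniteMeasure (ν.restrict s) := ⟨by simpa using hfin.lt_top⟩
  have hc : Continuous (fderiv ℝ u) := hu.continuous_fderiv one_ne_zero
  have hg : Measurable fun z => ‖fderiv ℝ u z‖ₑ * ρ := hc.enorm.measurable.mul_const ρ
  calc ∫⁻ x in s, ∫⁻ y in s, ‖u y - u x‖ₑ ∂ν ∂ν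
      ≤ ∫⁻ x in s, ∫⁻ y in s,
          (∫⁻ t in Icc (0 : ℝ) 1, ‖fderiv ℝ u ((1 - t) • x + t • y)‖ₑ * ρ) ∂ν ∂ν := by
        refine setLIntegral_mono' hs fun x hx => setLIntegral_mono' hs fun y hy => ?_
        refine (enorm_sub_le_lintegral_fderiv_segment hu x y).trans ?_
        gcongr
        exact hρ x hx y hy
    _ = ∫⁻ t in Icc (0 : ℝ) 1, ∫⁻ x in s, ∫⁻ y in s,
          ‖fderiv ℝ u ((1 - t) • x + t • y)‖ₑ * ρ ∂ν ∂ν :=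
        lintegral_lintegral_lintegral_segment_swap _ _ hg
    _ ≤ ∫⁻ t in Icc (0 : ℝ) 1,
          2 ^ finrank ℝ E * (∫⁻ y in s, ‖fderiv ℝ u y‖ₑ * ρ ∂ν) * ν s :=
        setLIntegral_mono' measurableSet_Icc fun t ht =>
          lintegral_lintegral_segment_le ν hs hconv hfin hg ht
    _ = _ := by
        rw [setLIntegral_const, lintegral_mul_const _ hc.enorm.measurable, Real.volume_Icc]
        simp only [sub_zero, ENNReal.ofReal_one]
        ring

theorem measure_mul_measure_le_lintegral_fderiv {s A D : Set E} (hs : MeasurableSet s)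
    (hconv : Convex ℝ s) (hfin : ν s ≠ ∞) {u : E → ℝ} (hu : ContDiff ℝ 1 u) {ρ : ℝ≥0∞}
    (hρ : ∀ x ∈ s, ∀ y ∈ s, ‖y - x‖ₑ ≤ ρ) (hA : MeasurableSet A) (hD : MeasurableSet D)
    (hAs : A ⊆ s) (hDs : D ⊆ s) (huA : ∀ x ∈ A, u x = 1) (huD : ∀ x ∈ D, u x = 0) :
    ν A * ν D ≤ 2 ^ finrank ℝ E * (∫⁻ y in s, ‖fderiv ℝ u y‖ₑ ∂ν) * ν s * ρ := by
  refine le_trans ?_ (lintegral_lintegral_enorm_sub_le ν hs hconv hfin hu hρ)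
  calc ν A * ν D = ∫⁻ x in D, ∫⁻ y in A, 1 ∂ν ∂ν := by simp
    _ ≤ ∫⁻ x in D, ∫⁻ y in A, ‖u y - u x‖ₑ ∂ν ∂ν := by
        refine setLIntegral_mono' hD fun x hx => setLIntegral_mono' hA fun y hy => ?_
        simp [huA y hy, huD x hx]
    _ ≤ ∫⁻ x in s, ∫⁻ y in s, ‖u y - u x‖ₑ ∂ν ∂ν :=
        (lintegral_mono fun x => lintegral_mono_set hAs).trans (lintegral_mono_set hDs)

theorem exists_closedBall_intermediate_density [Nontrivial E] {G : Set E} (hG : IsOpen G)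
    (hfin : ν G ≠ ∞) {x : E} (hx : x ∈ G) :
    ∃ r : ℝ, 0 < r ∧ ν (closedBall x r) ≤ 2 ^ (finrank ℝ E + 1) * ν (closedBall x r ∩ G) ∧
      ν (closedBall x r) ≤ 2 * ν (closedBall x r \ G) := by
  obtain ⟨r₀, hr₀, hsub⟩ := nhds_basis_closedBall.mem_iff.1 (hG.mem_nhds hx)
  set d := finrank ℝ E
  have hd0 : d ≠ 0 := (finrank_pos (R := ℝ) (M := E)).ne'
  have hr : ∀ j : ℕ, 0 < 2 ^ j * r₀ := fun j => by positivity
  have hpos : ∀ r : ℝ, 0 < r → ν (closedBall x r) ≠ 0 := fun r h =>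
    (measure_closedBall_pos ν x h).ne'
  have htop : ∀ r : ℝ, ν (closedBall x r) ≠ ∞ := fun r => measure_closedBall_lt_top.ne
  have hvol : ∀ j : ℕ, ν (closedBall x (2 ^ (j + 1) * r₀))
      = 2 ^ d * ν (closedBall x (2 ^ j * r₀)) := by
    intro j
    rw [Measure.addHaar_closedBall ν x (hr _).le, Measure.addHaar_closedBall ν x (hr _).le,
      ← mul_assoc, pow_succ', mul_assoc, mul_pow, ENNReal.ofReal_mul (by positivity),
      ENNReal.ofReal_pow two_pos.le, ENNReal.ofReal_ofNat]
  have hgrow : ∀ j : ℕ, 2 ^ j * ν (closedBall x r₀) ≤ ν (closedBall x (2 ^ j * r₀)) := by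
    intro j
    induction j with
    | zero => simp
    | succ j ih =>
      rw [hvol, pow_succ', mul_assoc]
      gcongr
      exact le_self_pow₀ one_le_two hd0
  have hex : ∃ j : ℕ, 2 * ν (closedBall x (2 ^ j * r₀) ∩ G) ≤ ν (closedBall x (2 ^ j * r₀)) := by
    obtain ⟨j, hj⟩ := ENNReal.exists_nat_gt (r := 2 * ν G / ν (closedBall x r₀))
      (ENNReal.div_ne_top (ENNReal.mul_ne_top (by simp) hfin) (hpos r₀ hr₀))
    refine ⟨j, ?_⟩
    calc 2 * ν (closedBall x (2 ^ j * r₀) ∩ G) ≤ 2 * ν G := by gcongr; exact inter_subset_right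
      _ ≤ j * ν (closedBall x r₀) :=
        (ENNReal.div_le_iff (hpos r₀ hr₀) (htop _)).1 hj.le
      _ ≤ 2 ^ j * ν (closedBall x r₀) := by
        gcongr
        exact_mod_cast Nat.lt_two_pow_self.le
      _ ≤ _ := hgrow j
  classical
  have hj := Nat.find_spec hex
  have hmin := fun i => Nat.find_min hex (m := i)
  set j := Nat.find hex
  refine ⟨2 ^ j * r₀, hr j, ?_, ?_⟩
  · rcases Nat.eq_zero_or_pos j with h0 | h0
    · rw [h0, pow_zero, one_mul, inter_eq_left.2 hsub]
      exact le_mul_of_one_le_left' (one_le_pow₀ one_le_two)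
    · obtain ⟨i, hi⟩ : ∃ i, j = i + 1 := ⟨j - 1, by omega⟩
      have := hmin i (by omega)
      rw [not_le] at this
      rw [hi, hvol, pow_succ, mul_assoc]
      gcongr
      refine this.le.trans ?_
      gcongr
      · exact one_le_two
      · omega
  · have h1 := measure_inter_add_sdiff (μ := ν) (closedBall x (2 ^ j * r₀)) hG.measurableSet
    set B := closedBall x (2 ^ j * r₀)
    have h2 : ν B + ν B ≤ ν B + 2 * ν (B \ G) := by
      calc ν B + ν B = 2 * ν (B ∩ G) + 2 * ν (B \ G) := by rw [← mul_add, h1, two_mul]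
        _ ≤ _ := by gcongr
    exact (ENNReal.add_le_add_iff_left (htop _)).1 h2

theorem ofReal_pow_mul_measure_unitBall_le [Nontrivial E] {x : E} {r : ℝ} (hr : 0 < r)
    {A D : Set E} {u : E → ℝ} (hu : ContDiff ℝ 1 u) (hA : MeasurableSet A) (hD : MeasurableSet D)
    (hAs : A ⊆ closedBall x r) (hDs : D ⊆ closedBall x r)
    (huA : ∀ x ∈ A, u x = 1) (huD : ∀ x ∈ D, u x = 0)
    (hνA : ν (closedBall x r) ≤ 2 ^ (finrank ℝ E + 2) * ν A)
    (hνD : ν (closedBall x r) ≤ 2 * ν D) :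
    ENNReal.ofReal (r ^ (finrank ℝ E - 1)) * ν (ball 0 1)
      ≤ 2 ^ (2 * finrank ℝ E + 4) * ∫⁻ y in closedBall x r, ‖fderiv ℝ u y‖ₑ ∂ν := by
  set I := ∫⁻ y in closedBall x r, ‖fderiv ℝ u y‖ₑ ∂ν
  set d := finrank ℝ E
  have hd0 : d ≠ 0 := (finrank_pos (R := ℝ) (M := E)).ne'
  have hpos : ν (closedBall x r) ≠ 0 := (measure_closedBall_pos ν x hr).ne'
  have htop : ν (closedBall x r) ≠ ∞ := measure_closedBall_lt_top.ne
  have hmain := measure_mul_measure_le_lintegral_fderiv ν (measurableSet_closedBall)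
    (convex_closedBall x r) htop hu (ρ := 2 * ENNReal.ofReal r) (by
      intro y hy z hz
      rw [← ENNReal.ofReal_ofNat, ← ENNReal.ofReal_mul two_pos.le, ← ofReal_norm,
        ← dist_eq_norm]
      apply ENNReal.ofReal_le_ofReal
      calc dist z y ≤ dist z x + dist y x := dist_triangle_right _ _ _
        _ ≤ 2 * r := by rw [mem_closedBall] at hy hz; linarith) hA hD hAs hDs huA huD
  have h1 : ν (closedBall x r) * ν (closedBall x r)
      ≤ ν (closedBall x r) * (2 ^ (2 * d + 4) * I * ENNReal.ofReal r) := by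
    calc ν (closedBall x r) * ν (closedBall x r)
        ≤ (2 ^ (d + 2) * ν A) * (2 * ν D) := by gcongr
      _ = 2 ^ (d + 3) * (ν A * ν D) := by ring
      _ ≤ 2 ^ (d + 3) * (2 ^ d * I * ν (closedBall x r) * (2 * ENNReal.ofReal r)) := by gcongr
      _ = _ := by ring
  have h2 := (ENNReal.mul_le_mul_iff_right hpos htop).1 h1
  rw [Measure.addHaar_closedBall ν x hr.le] at h2
  have hr0 : ENNReal.ofReal r ≠ 0 := by simpa using hr
  rw [← ENNReal.mul_le_mul_iff_left hr0 ENNReal.ofReal_ne_top]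
  refine le_trans (le_of_eq ?_) h2
  rw [mul_right_comm, ← ENNReal.ofReal_mul (by positivity), ← pow_succ,
    Nat.sub_add_cancel (by omega)]

theorem smoothTransition_levelSet_fderiv_eventually_ge [Nontrivial E] {f : E → ℝ}
    (hf : ContDiff ℝ 1 f) (s : ℝ) {x : E} {r : ℝ} (hr : 0 < r)
    (h1 : ν (closedBall x r) ≤ 2 ^ (finrank ℝ E + 1) * ν (closedBall x r ∩ {y | s < f y}))
    (h2 : ν (closedBall x r) ≤ 2 * ν (closedBall x r \ {y | s < f y})) :
    ∀ᶠ k : ℕ in atTop, ENNReal.ofReal (r ^ (finrank ℝ E - 1)) * ν (ball 0 1)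
      ≤ 2 ^ (2 * finrank ℝ E + 4) * ∫⁻ y in closedBall x r,
        ‖fderiv ℝ (fun z => Real.smoothTransition ((k + 1) * (f z - s))) y‖ₑ ∂ν := by
  set B := closedBall x r
  have hfc := hf.continuous
  let A : ℕ → Set E := fun k => B ∩ {y | 1 ≤ ((k : ℝ) + 1) * (f y - s)}
  have hA : ∀ k, MeasurableSet (A k) := fun k => measurableSet_closedBall.inter
    (isClosed_le continuous_const (by fun_prop)).measurableSet
  have hmono : Monotone A := by
    rintro k l hkl y ⟨hyB, hy⟩
    refine ⟨hyB, ?_⟩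
    simp only [mem_ofPred_eq] at hy ⊢
    have hpos : 0 < f y - s := by
      by_contra! h
      have : ((k : ℝ) + 1) * (f y - s) ≤ 0 := mul_nonpos_of_nonneg_of_nonpos (by positivity) h
      linarith
    refine hy.trans ?_
    gcongr
  have hUnion : ⋃ k, A k = B ∩ {y | s < f y} := by
    rw [← inter_iUnion]
    congr 1
    ext y
    simp only [mem_iUnion, mem_ofPred_eq]
    constructor
    · rintro ⟨k, hk⟩
      by_contra! h
      have : ((k : ℝ) + 1) * (f y - s) ≤ 0 :=
        mul_nonpos_of_nonneg_of_nonpos (by positivity) (by linarith)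
      linarith
    · intro h
      have hpos : 0 < f y - s := by linarith
      obtain ⟨k, hk⟩ := exists_nat_gt (1 / (f y - s))
      refine ⟨k, ?_⟩
      rw [div_lt_iff₀ hpos] at hk
      nlinarith
  have hB0 : ν B ≠ 0 := (measure_closedBall_pos ν x hr).ne'
  have hBtop : ν B ≠ ∞ := measure_closedBall_lt_top.ne
  have htend : Tendsto (fun k => 2 ^ (finrank ℝ E + 2) * ν (A k)) atTop
      (𝓝 (2 ^ (finrank ℝ E + 2) * ν (B ∩ {y | s < f y}))) := by
    refine ENNReal.Tendsto.const_mul ?_ (Or.inr (by simp))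
    rw [← hUnion]
    exact tendsto_measure_iUnion_atTop hmono
  have hlt : ν B < 2 ^ (finrank ℝ E + 2) * ν (B ∩ {y | s < f y}) := by
    calc ν B < 2 * ν B := by
          rw [two_mul]; exact ENNReal.lt_add_right hBtop hB0
      _ ≤ 2 * (2 ^ (finrank ℝ E + 1) * ν (B ∩ {y | s < f y})) := by gcongr
      _ = _ := by ring
  filter_upwards [htend.eventually (lt_mem_nhds hlt)] with k hk
  refine ofReal_pow_mul_measure_unitBall_le ν hr (A := A k) (D := B \ {y | s < f y})
    ?_ (hA k) ?_ inter_subset_left sdiff_subset ?_ ?_ hk.le h2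
  · exact Real.smoothTransition.contDiff.comp (by fun_prop)
  · exact measurableSet_closedBall.diff (isOpen_lt continuous_const hfc).measurableSet
  · exact fun y hy => Real.smoothTransition.one_of_one_le hy.2
  · intro y hy
    apply Real.smoothTransition.zero_of_nonpos
    have : f y ≤ s := by simpa using hy.2
    exact mul_nonpos_of_nonneg_of_nonpos (by positivity) (by linarith)

theorem measure_superlevel_mul_le_liminf [Nontrivial E] {f : E → ℝ} (hf : ContDiff ℝ 1 f)
    {s : ℝ} (hfin : ν {y | s < f y} ≠ ∞) {μ : Measure E} {M : ℝ≥0∞}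
    (hM : ∀ x : E, ∀ r : ℝ, 0 < r → μ (ball x r) ≤ M * ENNReal.ofReal (r ^ (finrank ℝ E - 1))) :
    μ {y | s < f y} * ν (ball 0 1) ≤ M * 6 ^ (finrank ℝ E - 1) * 2 ^ (2 * finrank ℝ E + 4) *
      liminf (fun k : ℕ => ∫⁻ y,
        ‖fderiv ℝ (fun z => Real.smoothTransition ((k + 1) * (f z - s))) y‖ₑ ∂ν) atTop := by
  set G := {y | s < f y}
  set d := finrank ℝ E
  have hd0 : d ≠ 0 := (finrank_pos (R := ℝ) (M := E)).ne'
  have hG : IsOpen G := isOpen_lt continuous_const hf.continuous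
  have hv0 : ν (ball (0 : E) 1) ≠ 0 := (measure_ball_pos ν 0 one_pos).ne'
  have hvtop : ν (ball (0 : E) 1) ≠ ∞ := measure_ball_lt_top.ne
  choose! r hr0 hr1 hr2 using fun x (hx : x ∈ G) =>
    exists_closedBall_intermediate_density ν hG hfin hx
  have hbdd : ∀ x ∈ G, r x ≤ 1 + (2 ^ (d + 1) * ν G / ν (ball 0 1)).toReal := by
    intro x hx
    have h1 : ENNReal.ofReal (r x ^ d) ≤ 2 ^ (d + 1) * ν G / ν (ball 0 1) := by
      rw [ENNReal.le_div_iff_mul_le (Or.inl hv0) (Or.inl hvtop),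
        ← Measure.addHaar_closedBall ν x (hr0 x hx).le]
      refine (hr1 x hx).trans ?_
      gcongr
      exact inter_subset_right
    have h2 : r x ^ d ≤ (2 ^ (d + 1) * ν G / ν (ball 0 1)).toReal :=
      (ENNReal.ofReal_le_iff_le_toReal
        (ENNReal.div_ne_top (ENNReal.mul_ne_top (by simp) hfin) hv0)).1 h1
    rcases le_total (r x) 1 with h | h
    · have : 0 ≤ (2 ^ (d + 1) * ν G / ν (ball 0 1)).toReal := ENNReal.toReal_nonneg
      linarith
    · have := le_self_pow₀ h hd0
      linarith
  obtain ⟨t, htG, htdisj, htcov⟩ := Vitali.exists_disjoint_subfamily_covering_enlargement_closedBall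
    G id r _ hbdd 5 (by norm_num)
  simp only [id] at htdisj htcov
  have htc : t.Countable := htdisj.countable_of_nonempty_interior fun b hb =>
    ⟨b, ball_subset_interior_closedBall (mem_ball_self (hr0 b (htG hb)))⟩
  have hcover : G ⊆ ⋃ b ∈ t, ball b (6 * r b) := by
    intro x hx
    obtain ⟨b, hb, hxb⟩ := htcov x hx
    refine mem_biUnion hb (closedBall_subset_ball ?_ (hxb (mem_closedBall_self (hr0 x hx).le)))
    linarith [hr0 b (htG hb)]
  set L : ℕ → ℝ≥0∞ := fun k : ℕ => ∫⁻ y,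
        ‖fderiv ℝ (fun z => Real.smoothTransition ((k + 1) * (f z - s))) y‖ₑ ∂ν
  have hsum : ∑' b : t, ENNReal.ofReal (r b ^ (d - 1)) * ν (ball 0 1)
      ≤ 2 ^ (2 * d + 4) * liminf L atTop := by
    rw [← ENNReal.liminf_const_mul_of_ne_top (by simp), ENNReal.tsum_eq_iSup_sum]
    refine iSup_le fun F => le_liminf_of_le (by isBoundedDefault) ?_
    have hev := (Finset.eventually_all F).2 fun b _ =>
      smoothTransition_levelSet_fderiv_eventually_ge ν hf s (hr0 b (htG b.2))
        (hr1 b (htG b.2)) (hr2 b (htG b.2))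
    filter_upwards [hev] with k hk
    refine (Finset.sum_le_sum hk).trans ?_
    rw [← Finset.mul_sum, ← lintegral_biUnion_finset]
    · gcongr
      exact setLIntegral_le_lintegral _ _
    · intro a _ b _ hab
      exact htdisj a.2 b.2 fun h => hab (Subtype.ext h)
    · exact fun b _ => measurableSet_closedBall
  calc μ G * ν (ball 0 1)
      ≤ (∑' b : t, μ (ball (b : E) (6 * r b))) * ν (ball 0 1) := by
        gcongr
        exact (measure_mono hcover).trans (measure_biUnion_le μ htc _)
    _ ≤ (∑' b : t, M * 6 ^ (d - 1) * ENNReal.ofReal (r b ^ (d - 1))) * ν (ball 0 1) := by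
        gcongr with b
        have hb := hr0 b (htG b.2)
        refine (hM b (6 * r b) (by positivity)).trans (le_of_eq ?_)
        rw [mul_pow, ENNReal.ofReal_mul (by positivity), ENNReal.ofReal_pow (by norm_num),
          ENNReal.ofReal_ofNat, mul_assoc]
    _ = M * 6 ^ (d - 1) * ∑' b : t, ENNReal.ofReal (r b ^ (d - 1)) * ν (ball 0 1) := by
        rw [ENNReal.tsum_mul_left, ENNReal.tsum_mul_right, mul_assoc]
    _ ≤ M * 6 ^ (d - 1) * (2 ^ (2 * d + 4) * liminf L atTop) := by gcongr
    _ = _ := by ring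

theorem lintegral_liminf_smoothTransition_le {f : E → ℝ} (hf : ContDiff ℝ 1 f) :
    ∫⁻ s : ℝ, liminf (fun k : ℕ => ∫⁻ y,
        ‖fderiv ℝ (fun z => Real.smoothTransition ((k + 1) * (f z - s))) y‖ₑ ∂ν) atTop
      ≤ (∫⁻ t, ‖deriv Real.smoothTransition t‖ₑ) * ∫⁻ y, ‖fderiv ℝ f y‖ₑ ∂ν := by
  have hc : Continuous (deriv Real.smoothTransition) :=
    (Real.smoothTransition.contDiff (n := 1)).continuous_deriv le_rfl
  have hf' : Continuous (fderiv ℝ f) := hf.continuous_fderiv one_ne_zero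
  have hfc := hf.continuous
  have hmeas := fun k : ℕ => measurable_enorm_fderiv_smoothTransition_comp hf ((k : ℝ) + 1)
  refine (lintegral_liminf_le fun k => (hmeas k).lintegral_prod_right').trans ?_
  refine liminf_le_of_frequently_le' (Eventually.frequently (Eventually.of_forall fun k => ?_))
  rw [lintegral_lintegral_swap (hmeas k).aemeasurable, ← lintegral_const_mul _
    (Continuous.measurable (by fun_prop))]
  refine lintegral_mono fun y => ?_
  simp only [enorm_fderiv_smoothTransition_comp hf]
  have hk : (0 : ℝ) < k + 1 := by positivity
  have h1 : ∫⁻ s : ℝ, ‖deriv Real.smoothTransition (((k : ℝ) + 1) * (f y - s))‖ₑ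
      = ENNReal.ofReal ((k : ℝ) + 1)⁻¹ * ∫⁻ t, ‖deriv Real.smoothTransition t‖ₑ := by
    have := lintegral_comp_add_smul volume (h := fun t => ‖deriv Real.smoothTransition t‖ₑ)
      (by fun_prop) (((k : ℝ) + 1) * f y) (c := -((k : ℝ) + 1)) (by linarith)
    rw [finrank_self, pow_one, inv_neg, abs_neg, abs_of_pos (by positivity)] at this
    rw [← this]
    refine lintegral_congr fun s => ?_
    congr 2
    simp only [smul_eq_mul]
    ring
  have hmy : Measurable fun s : ℝ => ‖deriv Real.smoothTransition (((k : ℝ) + 1) * (f y - s))‖ₑ :=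
    Continuous.measurable (by fun_prop)
  rw [lintegral_mul_const _ (hmy.mul_const _), lintegral_mul_const _ hmy, h1,
    mul_right_comm (ENNReal.ofReal _), Real.enorm_of_nonneg hk.le,
    ← ENNReal.ofReal_mul (by positivity), inv_mul_cancel₀ hk.ne', ENNReal.ofReal_one, one_mul]

theorem lintegral_ofReal_mul_measure_unitBall_le [Nontrivial E] {f : E → ℝ}
    (hf : ContDiff ℝ 1 f) (hsupp : HasCompactSupport f) {μ : Measure E} {M : ℝ≥0∞}
    (hM : ∀ x : E, ∀ r : ℝ, 0 < r → μ (ball x r) ≤ M * ENNReal.ofReal (r ^ (finrank ℝ E - 1))) :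
    (∫⁻ y, ENNReal.ofReal (f y) ∂μ) * ν (ball 0 1)
      ≤ M * 6 ^ (finrank ℝ E - 1) * 2 ^ (2 * finrank ℝ E + 4) *
        ((∫⁻ t, ‖deriv Real.smoothTransition t‖ₑ) * ∫⁻ y, ‖fderiv ℝ f y‖ₑ ∂ν) := by
  have hf' : Continuous (fderiv ℝ f) := hf.continuous_fderiv one_ne_zero
  have hfc := hf.continuous
  have hlayer : ∫⁻ y, ENNReal.ofReal (f y) ∂μ = ∫⁻ s in Ioi (0 : ℝ), μ {y | s < f y} := by
    have h1 : ∀ y, ENNReal.ofReal (f y) = ENNReal.ofReal (max (f y) 0) := fun y => by simp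
    simp_rw [h1]
    rw [lintegral_eq_lintegral_meas_lt μ (f := fun y => max (f y) 0)
      (Eventually.of_forall fun y => le_max_right _ _)
      (Continuous.measurable (by fun_prop)).aemeasurable]
    refine setLIntegral_congr_fun measurableSet_Ioi fun s hs => ?_
    have : (0 : ℝ) < s := hs
    simp [this.not_gt]
  have hmono : Antitone fun s : ℝ => μ {y | s < f y} := fun a b hab =>
    measure_mono fun y hy => lt_of_le_of_lt hab hy
  rw [hlayer, ← lintegral_mul_const _ hmono.measurable]
  have hmeas : ∀ k : ℕ, Measurable fun s : ℝ => ∫⁻ y,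
      ‖fderiv ℝ (fun z => Real.smoothTransition (((k : ℝ) + 1) * (f z - s))) y‖ₑ ∂ν :=
    fun k => (measurable_enorm_fderiv_smoothTransition_comp hf _).lintegral_prod_right'
  calc ∫⁻ s in Ioi (0 : ℝ), μ {y | s < f y} * ν (ball 0 1)
      ≤ ∫⁻ s in Ioi (0 : ℝ), M * 6 ^ (finrank ℝ E - 1) * 2 ^ (2 * finrank ℝ E + 4) *
          liminf (fun k : ℕ => ∫⁻ y,
          ‖fderiv ℝ (fun z => Real.smoothTransition ((k + 1) * (f z - s))) y‖ₑ ∂ν) atTop := by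
        refine setLIntegral_mono' measurableSet_Ioi fun s hs => ?_
        refine measure_superlevel_mul_le_liminf ν hf (ne_of_lt ?_) hM
        refine (measure_mono fun y hy => ?_).trans_lt hsupp.isCompact.measure_lt_top
        exact subset_tsupport f (ne_of_gt (lt_trans hs hy))
    _ ≤ _ := by
        rw [lintegral_const_mul _ (Measurable.liminf hmeas)]
        gcongr
        exact (setLIntegral_le_lintegral _ _).trans (lintegral_liminf_smoothTransition_le ν hf)

theorem exists_lintegral_abs_le_lintegral_fderiv [Nontrivial E] :
    ∃ K : ℝ≥0∞, K ≠ ∞ ∧ ∀ (μ : Measure E) (M : ℝ≥0∞),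
      (∀ x : E, ∀ r : ℝ, 0 < r → μ (ball x r) ≤ M * ENNReal.ofReal (r ^ (finrank ℝ E - 1))) →
      ∀ f : E → ℝ, ContDiff ℝ 1 f → HasCompactSupport f →
        ∫⁻ y, ENNReal.ofReal |f y| ∂μ ≤ K * M * ∫⁻ y, ‖fderiv ℝ f y‖ₑ ∂ν := by
  have hv0 : ν (ball (0 : E) 1) ≠ 0 := (measure_ball_pos ν 0 one_pos).ne'
  have hvtop : ν (ball (0 : E) 1) ≠ ∞ := measure_ball_lt_top.ne
  refine ⟨(2 * (6 ^ (finrank ℝ E - 1) * 2 ^ (2 * finrank ℝ E + 4) *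
    (∫⁻ t, ‖deriv Real.smoothTransition t‖ₑ))) / ν (ball 0 1), ?_, fun μ M hM f hf hsupp => ?_⟩
  · refine ENNReal.div_ne_top (ENNReal.mul_ne_top (by simp) (ENNReal.mul_ne_top
      (ENNReal.mul_ne_top (by simp) (by simp)) lintegral_enorm_deriv_smoothTransition_ne_top)) hv0
  · have hfc := hf.continuous
    have h1 := lintegral_ofReal_mul_measure_unitBall_le ν hf hsupp hM
    have h2 := lintegral_ofReal_mul_measure_unitBall_le ν hf.neg hsupp.neg hM
    simp only [fderiv_fun_neg, enorm_neg] at h2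
    have h3 : ∫⁻ y, ENNReal.ofReal |f y| ∂μ
        = (∫⁻ y, ENNReal.ofReal (f y) ∂μ) + ∫⁻ y, ENNReal.ofReal (-f y) ∂μ := by
      rw [← lintegral_add_left hfc.measurable.ennreal_ofReal]
      refine lintegral_congr fun y => ?_
      rcases le_total 0 (f y) with h | h
      · rw [abs_of_nonneg h, ENNReal.ofReal_of_nonpos (neg_nonpos.2 h), add_zero]
      · rw [abs_of_nonpos h, ENNReal.ofReal_of_nonpos h, zero_add]
    rw [mul_assoc, ENNReal.mul_comm_div, ← mul_div_assoc,
      ENNReal.le_div_iff_mul_le (Or.inl hv0) (Or.inl hvtop), h3, add_mul]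
    refine (add_le_add h1 h2).trans (le_of_eq ?_)
    ring

end Haar

theorem rpow_sub_one_mul_le_rpow_add_rpow {a b p : ℝ} (ha : 0 ≤ a) (hb : 0 ≤ b) (hp : 1 ≤ p) :
    a ^ (p - 1) * b ≤ a ^ p + b ^ p := by
  have hsplit : ∀ c : ℝ, 0 ≤ c → c ^ p = c ^ (p - 1) * c := fun c hc => by
    conv_lhs => rw [← sub_add_cancel p 1, Real.rpow_add_of_nonneg hc (by linarith) zero_le_one,
      Real.rpow_one]
  rcases le_total a b with h | h
  · have : a ^ (p - 1) * b ≤ b ^ (p - 1) * b := by gcongr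
    rw [← hsplit b hb] at this
    linarith [Real.rpow_nonneg ha p]
  · have : a ^ (p - 1) * b ≤ a ^ (p - 1) * a := by gcongr
    rw [← hsplit a ha] at this
    linarith [Real.rpow_nonneg hb p]

theorem exists_contDiff_abs_eq_abs_rpow {E : Type*} [NormedAddCommGroup E] [NormedSpace ℝ E]
    {φ : E → ℝ} (hφ : ContDiff ℝ 1 φ) (hsupp : HasCompactSupport φ) {p : ℝ} (hp : 1 ≤ p) :
    ∃ f : E → ℝ, ContDiff ℝ 1 f ∧ HasCompactSupport f ∧ (∀ x, |f x| = |φ x| ^ p) ∧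
      ∀ x, ‖fderiv ℝ f x‖ ≤ p * (|φ x| ^ (p - 1) * ‖fderiv ℝ φ x‖) := by
  rcases hp.eq_or_lt with rfl | hp1
  · exact ⟨φ, hφ, hsupp, fun x => by simp, fun x => by simp⟩
  · refine ⟨fun x => ‖φ x‖ ^ p, hφ.norm_rpow hp1, ?_, fun x => ?_, fun x => ?_⟩
    · exact hsupp.comp_left (g := fun t : ℝ => ‖t‖ ^ p) (by simp [show p ≠ 0 by linarith])
    · exact abs_of_nonneg (by positivity)
    · rw [← mul_assoc]
      exact norm_fderiv_norm_rpow_le (hφ.differentiable one_ne_zero) hp1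

theorem stmt7 (n : ℕ) (hn : 2 ≤ n) (p : ℝ) (hp : 1 ≤ p) :
    ∃ C : ℝ, 0 < C ∧
      ∀ (μ : Measure (EuclideanSpace ℝ (Fin n)))
        (φ : EuclideanSpace ℝ (Fin n) → ℝ),
        ContDiff ℝ (⊤ : ℕ∞) φ → HasCompactSupport φ →
        ∫⁻ x, ENNReal.ofReal (|φ x| ^ p) ∂μ
          ≤ ENNReal.ofReal C
            * (⨆ (x : EuclideanSpace ℝ (Fin n)) (r : ℝ) (_ : 0 < r),
                ENNReal.ofReal (r ^ (1 - (n : ℝ))) * μ (ball x r))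
            * ∫⁻ x, ENNReal.ofReal (|φ x| ^ p + ‖gradient φ x‖ ^ p) := by
  have hfin : finrank ℝ (EuclideanSpace ℝ (Fin n)) = n := by simp
  have : Nontrivial (EuclideanSpace ℝ (Fin n)) := nontrivial_of_finrank_pos (R := ℝ) (by omega)
  obtain ⟨K, hK, hmain⟩ := exists_lintegral_abs_le_lintegral_fderiv
    (volume : Measure (EuclideanSpace ℝ (Fin n)))
  have hp0 : 0 ≤ p := by linarith
  refine ⟨K.toReal * p + 1, by positivity, fun μ φ hφ hsupp => ?_⟩
  set M := ⨆ (x : EuclideanSpace ℝ (Fin n)) (r : ℝ) (_ : 0 < r),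
    ENNReal.ofReal (r ^ (1 - (n : ℝ))) * μ (ball x r)
  have hM : ∀ x : EuclideanSpace ℝ (Fin n), ∀ r : ℝ, 0 < r → μ (ball x r)
      ≤ M * ENNReal.ofReal (r ^ (finrank ℝ (EuclideanSpace ℝ (Fin n)) - 1)) := by
    intro x r hr
    have h1 : ENNReal.ofReal (r ^ (1 - (n : ℝ))) * μ (ball x r) ≤ M :=
      le_iSup_of_le x (le_iSup₂_of_le r hr le_rfl)
    have h2 : r ^ (1 - (n : ℝ)) * r ^ (n - 1) = 1 := by
      rw [← Real.rpow_natCast, ← Real.rpow_add hr, Nat.cast_sub (by omega)]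
      simp
    rw [hfin]
    calc μ (ball x r) = ENNReal.ofReal (r ^ (1 - (n : ℝ))) * μ (ball x r)
          * ENNReal.ofReal (r ^ (n - 1)) := by
          rw [mul_right_comm, ← ENNReal.ofReal_mul (by positivity), h2, ENNReal.ofReal_one,
            one_mul]
      _ ≤ _ := by gcongr
  obtain ⟨f, hf, hfsupp, hfabs, hfderiv⟩ := exists_contDiff_abs_eq_abs_rpow
    (hφ.of_le (by exact_mod_cast le_top)) hsupp hp
  have hgrad : ∀ x, ‖fderiv ℝ f x‖ₑ
      ≤ ENNReal.ofReal p * ENNReal.ofReal (|φ x| ^ p + ‖gradient φ x‖ ^ p) := by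
    intro x
    have hnorm : ‖gradient φ x‖ = ‖fderiv ℝ φ x‖ := by simp [gradient]
    rw [← ofReal_norm, ← ENNReal.ofReal_mul hp0, hnorm]
    refine ENNReal.ofReal_le_ofReal ((hfderiv x).trans ?_)
    gcongr
    exact rpow_sub_one_mul_le_rpow_add_rpow (abs_nonneg _) (norm_nonneg _) hp
  calc ∫⁻ x, ENNReal.ofReal (|φ x| ^ p) ∂μ = ∫⁻ x, ENNReal.ofReal |f x| ∂μ := by simp_rw [hfabs]
    _ ≤ K * M * ∫⁻ x, ‖fderiv ℝ f x‖ₑ := hmain μ M hM f hf hfsupp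
    _ ≤ K * M * (ENNReal.ofReal p * ∫⁻ x, ENNReal.ofReal (|φ x| ^ p + ‖gradient φ x‖ ^ p)) := by
        rw [← lintegral_const_mul' _ _ ENNReal.ofReal_ne_top]
        gcongr with x
        exact hgrad x
    _ = ENNReal.ofReal (K.toReal * p) * M
          * ∫⁻ x, ENNReal.ofReal (|φ x| ^ p + ‖gradient φ x‖ ^ p) := by
        rw [ENNReal.ofReal_mul ENNReal.toReal_nonneg, ENNReal.ofReal_toReal hK]
        ring
    _ ≤ _ := by
        gcongr
        linarith
end

section
/- Let n ≥ 2 and p ≥ 1. There exists a constant C depending only on n and p such that for every Borel measure μ on ℝⁿ and every smooth compactly supported function φ : ℝⁿ → ℝ, ∫_{ℝⁿ} |φ|^p dμ ≤ C · (sup_{x ∈ ℝⁿ, r > 0} r^{−1}·μ(B(x,r))) · ∑_{i=0}^{n−1} ∫_{ℝⁿ} ‖D^i φ(x)‖^p dx, where B(x,r) is the open Euclidean ball of radius r centered at x, D^i φ denotes the i-th iterated Fréchet derivative of φ, and the integrals on the right are taken with respect to Lebesgue measure. (When the supremum is infinite the inequality holds trivially.) -/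
open MeasureTheory Metric

namespace MeasureTheory.SobolevTrace

open MeasureTheory Metric Set Filter Topology

/-- A path version of the fundamental theorem of calculus inequality. -/
theorem enorm_sub_le_lintegral_Ioc {F : Type*} [NormedAddCommGroup F] [NormedSpace ℝ F]
    [CompleteSpace F] {w w' : ℝ → F} (hw : ∀ s, HasDerivAt w (w' s) s) (hc : Continuous w')
    {a b : ℝ} (hab : a ≤ b) : ‖w b - w a‖ₑ ≤ ∫⁻ s in Ioc a b, ‖w' s‖ₑ := by
  rw [← intervalIntegral.integral_eq_sub_of_hasDerivAt (fun s _ => hw s)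
    (hc.intervalIntegrable a b), intervalIntegral.integral_of_le hab]
  exact enorm_integral_le_lintegral_enorm _

/-- A path whose norm descends from above `t + δ` to below `t` has length at least `δ` while its
norm is in `(t, t + δ]`. -/
theorem le_lintegral_indicator_of_norm_descends {F : Type*} [NormedAddCommGroup F]
    [NormedSpace ℝ F] [CompleteSpace F] {w w' : ℝ → F} (hw : ∀ s, HasDerivAt w (w' s) s)
    (hc : Continuous w') {t δ : ℝ} (h0 : t + δ < ‖w 0‖) (h1 : ‖w 1‖ ≤ t) :
    ENNReal.ofReal δ ≤
      ∫⁻ s in Icc (0 : ℝ) 1,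
        {s | t < ‖w s‖ ∧ ‖w s‖ ≤ t + δ}.indicator (fun s => ‖w' s‖ₑ) s := by
  have hwc : Continuous fun s => ‖w s‖ :=
    (continuous_iff_continuousAt.2 fun s => (hw s).continuousAt).norm
  obtain ⟨a, ⟨ha, hta⟩, hamax⟩ :=
    (isCompact_Icc.inter_right (isClosed_le continuous_const hwc) :
      IsCompact (Icc (0 : ℝ) 1 ∩ {s | t + δ ≤ ‖w s‖})).exists_isGreatest
      ⟨0, ⟨le_rfl, zero_le_one⟩, h0.le⟩
  obtain ⟨b, ⟨hb, htb⟩, hbmin⟩ :=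
    (isCompact_Icc.inter_right (isClosed_le hwc continuous_const) :
      IsCompact (Icc a 1 ∩ {s | ‖w s‖ ≤ t})).exists_isLeast ⟨1, ⟨ha.2, le_rfl⟩, h1⟩
  change t + δ ≤ ‖w a‖ at hta
  change ‖w b‖ ≤ t at htb
  have hδ' : ENNReal.ofReal δ ≤ ‖w b - w a‖ₑ := by
    rw [← ofReal_norm]
    apply ENNReal.ofReal_le_ofReal
    have := norm_sub_norm_le (w a) (w b)
    rw [norm_sub_rev] at this
    linarith
  refine (hδ'.trans (enorm_sub_le_lintegral_Ioc hw hc hb.1)).trans ?_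
  rw [← restrict_Ioo_eq_restrict_Ioc]
  refine (setLIntegral_mono_ae' measurableSet_Ioo (Filter.Eventually.of_forall ?_)).trans
    (lintegral_mono_set (Ioo_subset_Icc_self.trans (Icc_subset_Icc ha.1 hb.2)))
  intro s hs
  rw [indicator_of_mem]
  constructor
  · by_contra! h
    exact absurd (hbmin ⟨⟨hs.1.le, hs.2.le.trans hb.2⟩, h⟩) (not_le.2 hs.2)
  · by_contra! h
    exact absurd (hamax ⟨⟨ha.1.trans hs.1.le, hs.2.le.trans hb.2⟩, h.le⟩) (not_le.2 hs.1)

section Haar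

set_option linter.unusedSectionVars false

variable {E : Type*} [NormedAddCommGroup E] [NormedSpace ℝ E] [FiniteDimensional ℝ E]
  [MeasurableSpace E] [BorelSpace E]

theorem lintegral_comp_smul_add (μ : Measure E) [μ.IsAddHaarMeasure] {H : E → ENNReal}
    (hH : Measurable H) {c : ℝ} (hc : c ≠ 0) (v : E) :
    ∫⁻ y, H (c • y + v) ∂μ
      = ENNReal.ofReal |(c ^ Module.finrank ℝ E)⁻¹| * ∫⁻ y, H y ∂μ := by
  have h1 : ∫⁻ y, H (c • y + v) ∂μ
      = ∫⁻ y, H (y + v) ∂(Measure.map (fun y : E => c • y) μ) := by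
    rw [lintegral_map (by fun_prop) (by fun_prop)]
  rw [h1, Measure.map_addHaar_smul μ hc, lintegral_smul_measure,
    lintegral_add_right_eq_self, smul_eq_mul]

theorem lintegral_comp_smul_add_le (μ : Measure E) [μ.IsAddHaarMeasure] {H : E → ENNReal}
    (hH : Measurable H) {c : ℝ} (hc : 1 / 2 ≤ c) (v : E) :
    ∫⁻ y, H (c • y + v) ∂μ ≤ 2 ^ Module.finrank ℝ E * ∫⁻ y, H y ∂μ := by
  rw [lintegral_comp_smul_add μ hH (by linarith) v]
  gcongr
  rw [← ENNReal.ofReal_ofNat 2, ← ENNReal.ofReal_pow (by norm_num)]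
  apply ENNReal.ofReal_le_ofReal
  rw [← inv_pow, abs_of_nonneg (by positivity)]
  gcongr
  rw [inv_le_comm₀ (by linarith) (by norm_num)]
  linarith

/-- If the integral of `h` over every segment from `A` to `A'` is bounded below, then so is the
integral of `h` over a ball containing both sets. -/
theorem mul_measure_mul_measure_le_of_segment (μ : Measure E) [μ.IsAddHaarMeasure]
    {h : E → ENNReal} (hh : Measurable h) {x : E} {r : ℝ} {A A' : Set E}
    (hA : MeasurableSet A) (hA' : MeasurableSet A')
    (hAB : A ⊆ ball x r) (hAB' : A' ⊆ ball x r) {c : ENNReal}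
    (hseg : ∀ y ∈ A, ∀ z ∈ A', c ≤ ∫⁻ s in Icc (0 : ℝ) 1, h (y + s • (z - y))) :
    c * μ A * μ A' ≤
      2 ^ Module.finrank ℝ E * μ (ball x r) * ∫⁻ y in ball x r, h y ∂μ := by
  set B := ball x r
  set H : E → ENNReal := B.indicator h
  have hH : Measurable H := hh.indicator measurableSet_ball
  have hHint : ∫⁻ y, H y ∂μ = ∫⁻ y in B, h y ∂μ := lintegral_indicator measurableSet_ball _
  have hslice : ∀ s ∈ Icc (0 : ℝ) 1,
      ∫⁻ y in B, ∫⁻ z in B, H (y + s • (z - y)) ∂μ ∂μ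
        ≤ 2 ^ Module.finrank ℝ E * μ B * ∫⁻ y, H y ∂μ := by
    intro s hs
    have hconst : ∀ G : E → ENNReal, (∀ y, G y ≤ 2 ^ Module.finrank ℝ E * ∫⁻ y, H y ∂μ) →
        ∫⁻ y in B, G y ∂μ ≤ 2 ^ Module.finrank ℝ E * μ B * ∫⁻ y, H y ∂μ := by
      intro G hG
      refine (lintegral_mono hG).trans (le_of_eq ?_)
      rw [setLIntegral_const]; ring
    rcases le_total (1 / 2) s with h2 | h2
    · refine hconst _ fun y => (setLIntegral_le_lintegral _ _).trans ?_
      refine le_of_eq_of_le (lintegral_congr fun z => congrArg H ?_)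
        (lintegral_comp_smul_add_le μ hH h2 (y - s • y))
      module
    · rw [lintegral_lintegral_swap (by fun_prop)]
      refine hconst _ fun z => (setLIntegral_le_lintegral _ _).trans ?_
      refine le_of_eq_of_le (lintegral_congr fun y => congrArg H ?_)
        (lintegral_comp_smul_add_le μ hH (show 1 / 2 ≤ 1 - s by linarith) (s • z))
      module
  calc c * μ A * μ A' = ∫⁻ y in A, ∫⁻ z in A', c ∂μ ∂μ := by
        simp only [setLIntegral_const]; ring
    _ ≤ ∫⁻ y in A, ∫⁻ z in A', (∫⁻ s in Icc (0 : ℝ) 1, H (y + s • (z - y))) ∂μ ∂μ := by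
        refine setLIntegral_mono' hA fun y hy => setLIntegral_mono' hA' fun z hz => ?_
        refine (hseg y hy z hz).trans (setLIntegral_mono' measurableSet_Icc fun s hs => ?_)
        rw [show H = B.indicator h from rfl, indicator_of_mem]
        exact (convex_ball x r).add_smul_sub_mem (hAB hy) (hAB' hz) hs
    _ ≤ ∫⁻ y in B, ∫⁻ z in B, (∫⁻ s in Icc (0 : ℝ) 1, H (y + s • (z - y))) ∂μ ∂μ :=
        (lintegral_mono_set hAB).trans (lintegral_mono fun y => lintegral_mono_set hAB')
    _ = ∫⁻ s in Icc (0 : ℝ) 1, ∫⁻ y in B, ∫⁻ z in B, H (y + s • (z - y)) ∂μ ∂μ := by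
        have h1 : ∀ y, ∫⁻ z in B, (∫⁻ s in Icc (0 : ℝ) 1, H (y + s • (z - y))) ∂μ
            = ∫⁻ s in Icc (0 : ℝ) 1, ∫⁻ z in B, H (y + s • (z - y)) ∂μ := fun y =>
          lintegral_lintegral_swap (by fun_prop)
        simp_rw [h1]
        refine lintegral_lintegral_swap (Measurable.aemeasurable ?_)
        refine Measurable.lintegral_prod_right'
          (f := fun q : (E × ℝ) × E => H (q.1.1 + q.1.2 • (q.2 - q.1.1))) ?_
        fun_prop
    _ ≤ ∫⁻ s in Icc (0 : ℝ) 1, 2 ^ Module.finrank ℝ E * μ B * ∫⁻ y, H y ∂μ :=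
        setLIntegral_mono' measurableSet_Icc hslice
    _ = _ := by rw [setLIntegral_const, Real.volume_Icc, hHint]; simp

/-- Among the dilates by powers of `2` of a ball contained in a set `S` of finite measure, some
ball of bounded radius is neither mostly in `S` nor mostly outside `S`. -/
theorem exists_dyadic_balanced_ball [Nontrivial E] (μ : Measure E) [μ.IsAddHaarMeasure]
    {S : Set E} (hS : μ S ≠ ⊤) {r₀ : ℝ} (hr₀ : 0 < r₀) :
    ∃ R : ℝ, ∀ x, ball x r₀ ⊆ S → ∃ r, r₀ ≤ r ∧ r ≤ R ∧
      2 * μ (S ∩ ball x r) ≤ μ (ball x r) ∧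
      μ (ball x r) ≤ 2 ^ (Module.finrank ℝ E + 1) * μ (S ∩ ball x r) := by
  set D := Module.finrank ℝ E
  have hD : D ≠ 0 := (Module.finrank_pos (R := ℝ) (M := E)).ne'
  have hdouble : ∀ (x : E) (k : ℕ),
      μ (ball x (2 ^ (k + 1) * r₀)) = 2 ^ D * μ (ball x (2 ^ k * r₀)) := by
    intro x k
    rw [Measure.addHaar_ball μ x (by positivity), Measure.addHaar_ball μ x (by positivity),
      pow_succ', mul_assoc, mul_pow, ENNReal.ofReal_mul (by positivity),
      ENNReal.ofReal_pow (by norm_num), ENNReal.ofReal_ofNat, mul_assoc]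
  have hpow : ∀ (x : E) (k : ℕ),
      μ (ball x (2 ^ k * r₀)) = (2 ^ D) ^ k * μ (ball 0 r₀) := by
    intro x k
    induction k with
    | zero => simp [Measure.addHaar_ball_center]
    | succ k ih => rw [hdouble, ih, pow_succ']; ring
  obtain ⟨K, hK⟩ : ∃ K : ℕ, 2 * μ S ≤ (2 ^ D) ^ K * μ (ball 0 r₀) := by
    have hb : μ (ball (0 : E) r₀) ≠ 0 := (measure_ball_pos μ 0 hr₀).ne'
    have hq : 2 * μ S / μ (ball (0 : E) r₀) ≠ ⊤ :=
      ENNReal.div_ne_top (ENNReal.mul_ne_top (by simp) hS) hb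
    obtain ⟨K, hK⟩ := ENNReal.exists_nat_gt hq
    refine ⟨K, ?_⟩
    rw [ENNReal.div_lt_iff (Or.inl hb) (Or.inl measure_ball_lt_top.ne)] at hK
    refine hK.le.trans ?_
    gcongr
    rw [← pow_mul]
    calc (K : ENNReal) ≤ ((2 ^ K : ℕ) : ENNReal) := by exact_mod_cast K.lt_two_pow_self.le
      _ = 2 ^ K := by push_cast; rfl
      _ ≤ 2 ^ (D * K) := by
        gcongr
        · norm_num
        · exact Nat.le_mul_of_pos_left K (Nat.pos_of_ne_zero hD)
  refine ⟨2 ^ K * r₀, fun x hx => ?_⟩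
  classical
  have hex : ∃ k : ℕ, 2 * μ (S ∩ ball x (2 ^ k * r₀)) ≤ μ (ball x (2 ^ k * r₀)) := by
    refine ⟨K, ?_⟩
    rw [hpow]
    refine le_trans ?_ hK
    gcongr
    exact inter_subset_left
  obtain ⟨k, hk⟩ : ∃ k, Nat.find hex = k := ⟨_, rfl⟩
  have hfind : 2 * μ (S ∩ ball x (2 ^ k * r₀)) ≤ μ (ball x (2 ^ k * r₀)) :=
    hk ▸ Nat.find_spec hex
  have hkK : k ≤ K := by
    rw [← hk]
    refine Nat.find_min' hex ?_
    rw [hpow]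
    refine le_trans ?_ hK
    gcongr
    exact inter_subset_left
  refine ⟨2 ^ k * r₀, ?_, ?_, hfind, ?_⟩
  · exact le_mul_of_one_le_left hr₀.le (one_le_pow₀ (by norm_num))
  · gcongr
    norm_num
  · rcases k with _ | k
    · simp only [pow_zero, one_mul, inter_eq_self_of_subset_right hx]
      exact le_mul_of_one_le_left (zero_le) (one_le_pow₀ (by norm_num))
    · have hmin := Nat.find_min hex (m := k) (by omega)
      rw [not_le] at hmin
      rw [hdouble, pow_succ, mul_assoc]
      gcongr
      refine hmin.le.trans ?_
      gcongr
      · norm_num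
      · omega

variable {F : Type*} [NormedAddCommGroup F] [NormedSpace ℝ F] [CompleteSpace F]

/-- The norm of the derivative of `u`, restricted to the points where the norm of `u` is in
`(t, t + δ]`. -/
noncomputable def levelGrad (u : E → F) (t δ : ℝ) : E → ENNReal :=
  {x | t < ‖u x‖ ∧ ‖u x‖ ≤ t + δ}.indicator fun x => ‖fderiv ℝ u x‖ₑ

theorem measurable_levelGrad {u : E → F} (hu : ContDiff ℝ 1 u) (t δ : ℝ) :
    Measurable (levelGrad u t δ) := by
  have h1 : Continuous fun x => ‖u x‖ := hu.continuous.norm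
  have h2 : Continuous fun x => ‖fderiv ℝ u x‖ₑ := (hu.continuous_fderiv one_ne_zero).enorm
  refine h2.measurable.indicator ?_
  exact (measurableSet_lt measurable_const h1.measurable).inter
    (measurableSet_le h1.measurable measurable_const)

theorem le_lintegral_levelGrad_segment {u : E → F} (hu : ContDiff ℝ 1 u) {t δ : ℝ} {y z : E}
    (hy : t + δ < ‖u y‖) (hz : ‖u z‖ ≤ t) {ρ : ℝ} (hρ : ‖z - y‖ ≤ ρ) :
    ENNReal.ofReal δ ≤
      ∫⁻ s in Icc (0 : ℝ) 1, ENNReal.ofReal ρ * levelGrad u t δ (y + s • (z - y)) := by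
  have hline : ∀ s : ℝ, HasDerivAt (fun s : ℝ => y + s • (z - y)) (z - y) s := fun s => by
    simpa using ((hasDerivAt_id s).smul_const (z - y)).const_add y
  have hw : ∀ s : ℝ, HasDerivAt (fun s : ℝ => u (y + s • (z - y)))
      (fderiv ℝ u (y + s • (z - y)) (z - y)) s := fun s =>
    ((hu.differentiable one_ne_zero _).hasFDerivAt).comp_hasDerivAt s (hline s)
  have hc : Continuous fun s : ℝ => fderiv ℝ u (y + s • (z - y)) (z - y) :=
    ((hu.continuous_fderiv one_ne_zero).comp (by fun_prop)).clm_apply continuous_const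
  refine (le_lintegral_indicator_of_norm_descends hw hc (t := t) (δ := δ)
    (by simpa using hy) (by simpa using hz)).trans (lintegral_mono fun s => ?_)
  by_cases hs : t < ‖u (y + s • (z - y))‖ ∧ ‖u (y + s • (z - y))‖ ≤ t + δ
  · rw [indicator_of_mem (by exact hs), levelGrad, indicator_of_mem (by exact hs), mul_comm]
    refine (ContinuousLinearMap.le_opENorm _ _).trans ?_
    gcongr
    rw [← ofReal_norm]
    exact ENNReal.ofReal_le_ofReal hρ
  · rw [indicator_of_notMem (by exact hs)]
    exact zero_le

/-- A lower bound for the gradient on a ball which is neither mostly inside nor mostly outside the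
superlevel set `{x | t < ‖u x‖}`. -/
theorem mul_rpow_le_setLIntegral_levelGrad (μ : Measure E) [μ.IsAddHaarMeasure] {d : ℕ}
    (hd : Module.finrank ℝ E = d + 1) {u : E → F} (hu : ContDiff ℝ 1 u) {t δ r : ℝ} {x : E}
    (hr : 0 < r)
    (h1 : 2 * μ ({x | t < ‖u x‖} ∩ ball x r) ≤ μ (ball x r))
    (h2 : μ (ball x r) ≤ 2 ^ (d + 2) * μ ({x | t < ‖u x‖} ∩ ball x r))
    (h3 : 2 ^ (d + 3) * μ {x | t < ‖u x‖ ∧ ‖u x‖ ≤ t + δ} ≤ μ (ball x r)) :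
    ENNReal.ofReal δ * ENNReal.ofReal (r ^ d) * μ (ball 0 1) ≤
      2 ^ (2 * d + 6) * ∫⁻ y in ball x r, levelGrad u t δ y ∂μ := by
  have : Nontrivial E := Module.nontrivial_of_finrank_pos (R := ℝ) (by omega)
  have hN : Continuous fun x => ‖u x‖ := hu.continuous.norm
  set B := ball x r
  set S := {x | t < ‖u x‖}
  set L := {x | t < ‖u x‖ ∧ ‖u x‖ ≤ t + δ}
  set A := {x | t + δ < ‖u x‖} ∩ B
  set A' := {x | ‖u x‖ ≤ t} ∩ B
  have hA : MeasurableSet A :=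
    (measurableSet_lt measurable_const hN.measurable).inter measurableSet_ball
  have hA' : MeasurableSet A' :=
    (measurableSet_le hN.measurable measurable_const).inter measurableSet_ball
  have hBtop : μ B ≠ ⊤ := measure_ball_lt_top.ne
  have hB0 : μ B ≠ 0 := (measure_ball_pos μ x hr).ne'
  have hAB : μ B ≤ 2 ^ (d + 3) * μ A := by
    have hsub : μ (S ∩ B) ≤ μ A + μ L := by
      refine (measure_mono ?_).trans (measure_union_le _ _)
      rintro y ⟨hy, hyB⟩
      rcases lt_or_ge (t + δ) ‖u y‖ with h | h
      · exact Or.inl ⟨h, hyB⟩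
      · exact Or.inr ⟨hy, h⟩
    have h4 : 2 * μ B ≤ 2 ^ (d + 3) * μ A + μ B :=
      calc 2 * μ B ≤ 2 * (2 ^ (d + 2) * (μ A + μ L)) := by
            gcongr
            exact h2.trans (by gcongr)
        _ = 2 ^ (d + 3) * μ A + 2 ^ (d + 3) * μ L := by ring
        _ ≤ _ := by gcongr
    rw [two_mul] at h4
    exact (ENNReal.add_le_add_iff_right hBtop).1 h4
  have hAB' : μ B ≤ 2 * μ A' := by
    have hsub : μ B ≤ μ (S ∩ B) + μ A' := by
      refine (measure_mono ?_).trans (measure_union_le _ _)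
      intro y hyB
      rcases lt_or_ge t ‖u y‖ with h | h
      · exact Or.inl ⟨h, hyB⟩
      · exact Or.inr ⟨h, hyB⟩
    have h4 : μ B + μ B ≤ μ B + 2 * μ A' :=
      calc μ B + μ B = 2 * μ B := (two_mul _).symm
        _ ≤ 2 * (μ (S ∩ B) + μ A') := by gcongr
        _ = 2 * μ (S ∩ B) + 2 * μ A' := mul_add _ _ _
        _ ≤ _ := by gcongr
    exact (ENNReal.add_le_add_iff_left hBtop).1 h4
  have hP := mul_measure_mul_measure_le_of_segment μ (h := fun y =>
      ENNReal.ofReal (2 * r) * levelGrad u t δ y)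
    ((measurable_levelGrad hu t δ).const_mul _) hA hA' inter_subset_right inter_subset_right
    (c := ENNReal.ofReal δ) (fun y hy z hz => le_lintegral_levelGrad_segment hu hy.1 hz.1 (by
      have := dist_triangle_right z y x
      have h5 := mem_ball.1 hy.2
      have h6 := mem_ball.1 hz.2
      rw [← dist_eq_norm]
      linarith))
  rw [lintegral_const_mul _ (measurable_levelGrad hu t δ), hd] at hP
  set I := ∫⁻ y in B, levelGrad u t δ y ∂μ
  have hmul : μ B * (ENNReal.ofReal δ * μ B) ≤
      μ B * (2 ^ (2 * d + 5) * (ENNReal.ofReal (2 * r) * I)) :=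
    calc μ B * (ENNReal.ofReal δ * μ B)
        ≤ (2 ^ (d + 3) * μ A) * (ENNReal.ofReal δ * (2 * μ A')) := by gcongr
      _ = 2 ^ (d + 4) * (ENNReal.ofReal δ * μ A * μ A') := by ring
      _ ≤ 2 ^ (d + 4) * (2 ^ (d + 1) * μ B * (ENNReal.ofReal (2 * r) * I)) := by gcongr
      _ = _ := by ring
  have hcancel := (ENNReal.mul_le_mul_iff_right hB0 hBtop).1 hmul
  rw [show μ B = _ from Measure.addHaar_ball μ x hr.le, hd, pow_succ,
    ENNReal.ofReal_mul (by positivity), ENNReal.ofReal_mul (by norm_num),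
    ENNReal.ofReal_ofNat] at hcancel
  refine (ENNReal.mul_le_mul_iff_right (a := ENNReal.ofReal r) (by simpa using hr) (by simp)).1 ?_
  calc _ = ENNReal.ofReal δ * (ENNReal.ofReal (r ^ d) * ENNReal.ofReal r * μ (ball 0 1)) := by
        ring
    _ ≤ _ := hcancel
    _ = _ := by ring

/-- A weak type estimate with the gradient on a thin level strip. -/
theorem eventually_mul_measure_lt_le_lintegral_levelGrad (μ : Measure E) [μ.IsAddHaarMeasure]
    {d : ℕ} (hd : Module.finrank ℝ E = d + 1) {u : E → F} (hu : ContDiff ℝ 1 u)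
    (hc : HasCompactSupport u) {ν : Measure E} {M : ENNReal}
    (hν : ∀ x r, 0 < r → ν (ball x r) ≤ M * ENNReal.ofReal (r ^ d)) {t η : ℝ} (ht : 0 ≤ t)
    (hη : 0 < η) :
    ∀ᶠ δ in 𝓝[>] (0 : ℝ), ENNReal.ofReal δ * ν {x | t + η < ‖u x‖} ≤
      2 ^ (2 * d + 6) * 6 ^ d / μ (ball 0 1) * M * ∫⁻ x, levelGrad u t δ x ∂μ := by
  have : Nontrivial E := Module.nontrivial_of_finrank_pos (R := ℝ) (by omega)
  have hN : Continuous fun x => ‖u x‖ := hu.continuous.norm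
  set S := {x | t < ‖u x‖}
  have hS : μ S ≠ ⊤ := by
    refine ((measure_mono ?_).trans_lt hc.isCompact.measure_lt_top).ne
    intro x hx
    refine subset_tsupport u fun h0 => ?_
    have h0 : u x = 0 := h0
    have : t < ‖u x‖ := hx
    rw [h0, norm_zero] at this
    linarith
  obtain ⟨r₀, hr₀, hr₀S⟩ : ∃ r₀ > 0, ∀ x, t + η < ‖u x‖ → ball x r₀ ⊆ S := by
    have huc : UniformContinuous u := hu.continuous.uniformContinuous_of_tendsto_cocompact
      hc.is_zero_at_infty
    obtain ⟨r₀, hr₀, h⟩ := Metric.uniformContinuous_iff.1 huc η hη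
    refine ⟨r₀, hr₀, fun x hx y hy => ?_⟩
    have h1 := h (mem_ball.1 hy)
    rw [dist_eq_norm, norm_sub_rev] at h1
    have h2 := norm_sub_norm_le (u x) (u y)
    change t < ‖u y‖
    linarith
  obtain ⟨R, hR⟩ := exists_dyadic_balanced_ball μ hS hr₀
  have hsmall : ∀ᶠ δ in 𝓝[>] (0 : ℝ),
      2 ^ (d + 3) * μ {x | t < ‖u x‖ ∧ ‖u x‖ ≤ t + δ} ≤ μ (ball 0 r₀) := by
    have hlim : Tendsto (μ ∘ fun δ : ℝ => {x | t < ‖u x‖ ∧ ‖u x‖ ≤ t + δ}) (𝓝[>] 0)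
        (𝓝 (μ (⋂ δ > (0 : ℝ), {x | t < ‖u x‖ ∧ ‖u x‖ ≤ t + δ}))) := by
      refine tendsto_measure_biInter_gt (fun δ _ => ?_) (fun i j _ hij x hx => ?_)
        ⟨1, one_pos, ?_⟩
      · exact ((measurableSet_lt measurable_const hN.measurable).inter
          (measurableSet_le hN.measurable measurable_const)).nullMeasurableSet
      · exact ⟨hx.1, hx.2.trans (by linarith)⟩
      · exact ((measure_mono fun x hx => hx.1).trans_lt hS.lt_top).ne
    have hempty : ⋂ δ > (0 : ℝ), {x | t < ‖u x‖ ∧ ‖u x‖ ≤ t + δ} = ∅ := by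
      refine eq_empty_of_forall_notMem fun x hx => ?_
      rw [mem_iInter₂] at hx
      have h1 : t < ‖u x‖ := (hx 1 one_pos).1
      have h2 : ‖u x‖ ≤ t + (‖u x‖ - t) / 2 := (hx ((‖u x‖ - t) / 2) (by simp; linarith)).2
      linarith
    rw [hempty, measure_empty] at hlim
    have hlim2 := ENNReal.Tendsto.const_mul (a := 2 ^ (d + 3)) hlim (Or.inr (by simp))
    rw [mul_zero] at hlim2
    exact hlim2.eventually (Iic_mem_nhds (measure_ball_pos μ 0 hr₀))
  filter_upwards [hsmall] with δ hδ
  have hchoice : ∀ x, ∃ r, t + η < ‖u x‖ → r₀ ≤ r ∧ r ≤ R ∧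
      2 * μ (S ∩ ball x r) ≤ μ (ball x r) ∧
      μ (ball x r) ≤ 2 ^ (Module.finrank ℝ E + 1) * μ (S ∩ ball x r) := fun x => by
    by_cases hx : t + η < ‖u x‖
    · obtain ⟨r, hr⟩ := hR x (hr₀S x hx)
      exact ⟨r, fun _ => hr⟩
    · exact ⟨0, fun h => absurd h hx⟩
  choose r hr using hchoice
  obtain ⟨T, hTsub, hTdisj, hTcov⟩ :=
    Vitali.exists_disjoint_subfamily_covering_enlargement_closedBall
      {x | t + η < ‖u x‖} id r R (fun x hx => (hr x hx).2.1) 5 (by norm_num)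
  have hTdisj' : T.PairwiseDisjoint fun x => ball x (r x) :=
    hTdisj.mono fun x => ball_subset_closedBall
  have hrpos : ∀ x ∈ T, 0 < r x := fun x hx => hr₀.trans_le (hr x (hTsub hx)).1
  have hTcount : T.Countable := hTdisj'.countable_of_isOpen (fun _ _ => isOpen_ball)
    fun x hx => nonempty_ball.2 (hrpos x hx)
  have hcover : {x | t + η < ‖u x‖} ⊆ ⋃ x ∈ T, ball x (6 * r x) := by
    intro x hx
    obtain ⟨b, hb, hsub⟩ := hTcov x hx
    refine mem_iUnion₂.2 ⟨b, hb, ?_⟩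
    have h1 := hsub (mem_closedBall_self (hr₀.le.trans (hr x hx).1))
    have h2 := hrpos b hb
    have h3 : dist x b ≤ 5 * r b := h1
    exact mem_ball.2 (by linarith)
  have hb0 : μ (ball (0 : E) 1) ≠ 0 := (measure_ball_pos μ 0 one_pos).ne'
  have hbt : μ (ball (0 : E) 1) ≠ ⊤ := measure_ball_lt_top.ne
  have hterm : ∀ x ∈ T, ENNReal.ofReal δ * ν (ball x (6 * r x)) ≤
      2 ^ (2 * d + 6) * 6 ^ d / μ (ball 0 1) * M * ∫⁻ y in ball x (r x), levelGrad u t δ y ∂μ := by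
    intro x hx
    have hrx := hrpos x hx
    obtain ⟨hr1, -, hr3, hr4⟩ := hr x (hTsub hx)
    rw [hd] at hr4
    have hlow := mul_rpow_le_setLIntegral_levelGrad μ hd hu (δ := δ) hrx hr3 hr4 (hδ.trans (by
      rw [← Measure.addHaar_ball_center μ x]
      exact measure_mono (ball_subset_ball hr1)))
    rw [← ENNReal.le_div_iff_mul_le (Or.inl hb0) (Or.inl hbt)] at hlow
    calc ENNReal.ofReal δ * ν (ball x (6 * r x))
        ≤ ENNReal.ofReal δ * (M * ENNReal.ofReal ((6 * r x) ^ d)) := by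
          gcongr
          exact hν x _ (by positivity)
      _ = 6 ^ d * M * (ENNReal.ofReal δ * ENNReal.ofReal (r x ^ d)) := by
          rw [mul_pow, ENNReal.ofReal_mul (by positivity), ENNReal.ofReal_pow (by norm_num) d,
            ENNReal.ofReal_ofNat]
          ring
      _ ≤ 6 ^ d * M * (2 ^ (2 * d + 6) * (∫⁻ y in ball x (r x), levelGrad u t δ y ∂μ)
            / μ (ball 0 1)) := by gcongr
      _ = _ := by simp only [div_eq_mul_inv]; ring
  calc ENNReal.ofReal δ * ν {x | t + η < ‖u x‖}
      ≤ ENNReal.ofReal δ * ∑' x : T, ν (ball (x : E) (6 * r x)) := by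
        gcongr
        exact (measure_mono hcover).trans (measure_biUnion_le ν hTcount _)
    _ = ∑' x : T, ENNReal.ofReal δ * ν (ball (x : E) (6 * r x)) := ENNReal.tsum_mul_left.symm
    _ ≤ ∑' x : T, 2 ^ (2 * d + 6) * 6 ^ d / μ (ball 0 1) * M *
          ∫⁻ y in ball (x : E) (r x), levelGrad u t δ y ∂μ :=
        ENNReal.tsum_le_tsum fun x => hterm x x.2
    _ = 2 ^ (2 * d + 6) * 6 ^ d / μ (ball 0 1) * M *
          ∫⁻ y in ⋃ x ∈ T, ball x (r x), levelGrad u t δ y ∂μ := by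
        rw [ENNReal.tsum_mul_left, lintegral_biUnion hTcount (fun _ _ => measurableSet_ball) hTdisj']
    _ ≤ _ := by
        gcongr
        exact Measure.restrict_le_self

theorem measure_lt_le_liminf_levelGrad (μ : Measure E) [μ.IsAddHaarMeasure]
    {d : ℕ} (hd : Module.finrank ℝ E = d + 1) {u : E → F} (hu : ContDiff ℝ 1 u)
    (hc : HasCompactSupport u) {ν : Measure E} {M : ENNReal}
    (hν : ∀ x r, 0 < r → ν (ball x r) ≤ M * ENNReal.ofReal (r ^ d)) {t : ℝ} (ht : 0 ≤ t) :
    ν {x | t < ‖u x‖} ≤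
      liminf (fun k : ℕ => 2 ^ (2 * d + 6) * 6 ^ d / μ (ball 0 1) * M *
        ((k + 1) * ∫⁻ x, levelGrad u t (1 / (k + 1)) x ∂μ)) atTop := by
  have hunion : {x | t < ‖u x‖} = ⋃ j : ℕ, {x | t + 1 / ((j : ℝ) + 1) < ‖u x‖} := by
    ext x
    simp only [mem_iUnion]
    refine ⟨fun hx => ?_, fun ⟨j, hj⟩ => ?_⟩
    · have hx : t < ‖u x‖ := hx
      obtain ⟨j, hj⟩ := exists_nat_one_div_lt (sub_pos.2 hx)
      exact ⟨j, show t + 1 / ((j : ℝ) + 1) < ‖u x‖ by linarith⟩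
    · have hj : t + 1 / ((j : ℝ) + 1) < ‖u x‖ := hj
      have : (0 : ℝ) < 1 / ((j : ℝ) + 1) := by positivity
      exact (show t < ‖u x‖ by linarith)
  have hmono : Monotone fun j : ℕ => {x | t + 1 / ((j : ℝ) + 1) < ‖u x‖} := by
    intro i j hij x hx
    have hx : t + 1 / ((i : ℝ) + 1) < ‖u x‖ := hx
    have := Nat.one_div_le_one_div (α := ℝ) hij
    exact (show t + 1 / ((j : ℝ) + 1) < ‖u x‖ by linarith)
  rw [hunion, hmono.measure_iUnion]
  refine iSup_le fun j => le_liminf_of_le (by isBoundedDefault) ?_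
  have htend : Tendsto (fun k : ℕ => (1 : ℝ) / (k + 1)) atTop (𝓝[>] 0) :=
    tendsto_nhdsWithin_iff.2 ⟨tendsto_one_div_add_atTop_nhds_zero_nat,
      Eventually.of_forall fun k => by simp; positivity⟩
  filter_upwards [htend.eventually (eventually_mul_measure_lt_le_lintegral_levelGrad μ hd hu hc hν
    ht (η := 1 / ((j : ℝ) + 1)) (by positivity))] with k hk
  have hone : ((k : ENNReal) + 1) * ENNReal.ofReal (1 / ((k : ℝ) + 1)) = 1 := by
    rw [show ((k : ENNReal) + 1) = ENNReal.ofReal ((k : ℝ) + 1) by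
      rw [ENNReal.ofReal_add (by positivity) zero_le_one]; simp, ← ENNReal.ofReal_mul (by positivity),
      mul_one_div_cancel (by positivity), ENNReal.ofReal_one]
  calc ν {x | t + 1 / ((j : ℝ) + 1) < ‖u x‖}
      = ((k : ENNReal) + 1) * (ENNReal.ofReal (1 / ((k : ℝ) + 1)) *
          ν {x | t + 1 / ((j : ℝ) + 1) < ‖u x‖}) := by rw [← mul_assoc, hone, one_mul]
    _ ≤ ((k : ENNReal) + 1) * (2 ^ (2 * d + 6) * 6 ^ d / μ (ball 0 1) * M *
          ∫⁻ x, levelGrad u t (1 / ((k : ℝ) + 1)) x ∂μ) := by gcongr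
    _ = _ := by ring

/-- The weight `t ^ (p - 1)` has average at most `N ^ (p - 1)` over the levels `t` such that
`N ∈ (t, t + δ]`. -/
theorem setLIntegral_indicator_rpow_le {p : ℝ} (hp : 1 ≤ p) {N δ : ℝ} :
    ∫⁻ t in Ioi (0 : ℝ), {t | t < N ∧ N ≤ t + δ}.indicator
        (fun t => ENNReal.ofReal (t ^ (p - 1))) t
      ≤ ENNReal.ofReal δ * ENNReal.ofReal (N ^ (p - 1)) := by
  calc ∫⁻ t in Ioi (0 : ℝ), {t | t < N ∧ N ≤ t + δ}.indicator
        (fun t => ENNReal.ofReal (t ^ (p - 1))) t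
      ≤ ∫⁻ t in Ioi (0 : ℝ), (Ico (N - δ) N).indicator
        (fun _ => ENNReal.ofReal (N ^ (p - 1))) t := by
        refine setLIntegral_mono' measurableSet_Ioi fun t ht => ?_
        have ht : 0 < t := ht
        by_cases h : t < N ∧ N ≤ t + δ
        · rw [indicator_of_mem (by exact h), indicator_of_mem (by constructor <;> linarith [h.1, h.2])]
          exact ENNReal.ofReal_le_ofReal
            (Real.rpow_le_rpow ht.le h.1.le (by linarith))
        · rw [indicator_of_notMem (by exact h)]
          exact zero_le
    _ ≤ ∫⁻ t, (Ico (N - δ) N).indicator (fun _ => ENNReal.ofReal (N ^ (p - 1))) t :=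
        setLIntegral_le_lintegral _ _
    _ = _ := by
        rw [lintegral_indicator_const measurableSet_Ico, Real.volume_Ico, sub_sub_cancel, mul_comm]

/-- The trace inequality for measures of codimension one. -/
theorem lintegral_norm_rpow_le_of_measure_ball_le (μ : Measure E) [μ.IsAddHaarMeasure]
    {d : ℕ} (hd : Module.finrank ℝ E = d + 1) {p : ℝ} (hp : 1 ≤ p) {u : E → F}
    (hu : ContDiff ℝ 1 u) (hc : HasCompactSupport u) {ν : Measure E} {M : ENNReal}
    (hν : ∀ x r, 0 < r → ν (ball x r) ≤ M * ENNReal.ofReal (r ^ d)) :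
    ∫⁻ x, ENNReal.ofReal (‖u x‖ ^ p) ∂ν ≤
      ENNReal.ofReal p * (2 ^ (2 * d + 6) * 6 ^ d / μ (ball 0 1)) * M *
        (∫⁻ x, ENNReal.ofReal (‖u x‖ ^ p) ∂μ + ∫⁻ x, ENNReal.ofReal (‖fderiv ℝ u x‖ ^ p) ∂μ) := by
  have hN : Continuous fun x => ‖u x‖ := hu.continuous.norm
  have hG : Continuous fun x => ‖fderiv ℝ u x‖ := (hu.continuous_fderiv one_ne_zero).norm
  set K : ENNReal := 2 ^ (2 * d + 6) * 6 ^ d / μ (ball 0 1) * M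
  rw [lintegral_rpow_eq_lintegral_meas_lt_mul ν (Eventually.of_forall fun x => norm_nonneg (u x))
    hN.aemeasurable (by linarith)]
  have hjoint : ∀ δ : ℝ, Measurable fun q : ℝ × E => levelGrad u q.1 δ q.2 := fun δ => by
    refine Measurable.indicator (f := fun q : ℝ × E => ‖fderiv ℝ u q.2‖ₑ)
      (s := {q : ℝ × E | q.1 < ‖u q.2‖ ∧ ‖u q.2‖ ≤ q.1 + δ}) ?_ ?_
    · exact ((hu.continuous_fderiv one_ne_zero).enorm.comp continuous_snd).measurable
    · exact (measurableSet_lt measurable_fst (hN.measurable.comp measurable_snd)).inter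
        (measurableSet_le (hN.measurable.comp measurable_snd) (measurable_fst.add_const δ))
  have hlevel : ∀ δ : ℝ, Measurable fun t => ∫⁻ x, levelGrad u t δ x ∂μ := fun δ =>
    (hjoint δ).lintegral_prod_right'
  have hpm : Measurable fun t : ℝ => ENNReal.ofReal (t ^ (p - 1)) := by fun_prop
  have hswap : ∀ k : ℕ, ∫⁻ t in Ioi (0 : ℝ), K *
        ((k + 1) * ∫⁻ x, levelGrad u t (1 / (k + 1)) x ∂μ) * ENNReal.ofReal (t ^ (p - 1))
      ≤ K * (∫⁻ x, ENNReal.ofReal (‖u x‖ ^ p) ∂μ +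
          ∫⁻ x, ENNReal.ofReal (‖fderiv ℝ u x‖ ^ p) ∂μ) := by
    intro k
    have hone : ((k : ENNReal) + 1) * ENNReal.ofReal (1 / ((k : ℝ) + 1)) = 1 := by
      rw [show ((k : ENNReal) + 1) = ENNReal.ofReal ((k : ℝ) + 1) by
        rw [ENNReal.ofReal_add (by positivity) zero_le_one]; simp,
        ← ENNReal.ofReal_mul (by positivity),
        mul_one_div_cancel (by positivity), ENNReal.ofReal_one]
    set δ : ℝ := 1 / ((k : ℝ) + 1)
    calc ∫⁻ t in Ioi (0 : ℝ), K *
          ((k + 1) * ∫⁻ x, levelGrad u t δ x ∂μ) * ENNReal.ofReal (t ^ (p - 1))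
        = ∫⁻ t in Ioi (0 : ℝ), K * (k + 1) *
            ∫⁻ x, ENNReal.ofReal (t ^ (p - 1)) * levelGrad u t δ x ∂μ := by
          refine lintegral_congr fun t => ?_
          rw [lintegral_const_mul _ (measurable_levelGrad hu t δ)]
          ring
      _ = K * (k + 1) * ∫⁻ t in Ioi (0 : ℝ),
            ∫⁻ x, ENNReal.ofReal (t ^ (p - 1)) * levelGrad u t δ x ∂μ := by
          refine lintegral_const_mul _ ?_
          exact ((hpm.comp measurable_fst).mul (hjoint δ)).lintegral_prod_right'
      _ = K * (k + 1) * ∫⁻ x, (∫⁻ t in Ioi (0 : ℝ),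
            ENNReal.ofReal (t ^ (p - 1)) * levelGrad u t δ x) ∂μ := by
          rw [lintegral_lintegral_swap]
          exact ((hpm.comp measurable_fst).mul (hjoint δ)).aemeasurable
      _ ≤ K * (k + 1) * ∫⁻ x, ENNReal.ofReal δ *
            (ENNReal.ofReal (‖u x‖ ^ p) + ENNReal.ofReal (‖fderiv ℝ u x‖ ^ p)) ∂μ := by
          gcongr with x
          calc ∫⁻ t in Ioi (0 : ℝ), ENNReal.ofReal (t ^ (p - 1)) * levelGrad u t δ x
              = ∫⁻ t in Ioi (0 : ℝ), {t | t < ‖u x‖ ∧ ‖u x‖ ≤ t + δ}.indicator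
                  (fun t => ENNReal.ofReal (t ^ (p - 1))) t * ‖fderiv ℝ u x‖ₑ := by
                refine lintegral_congr fun t => ?_
                by_cases h : t < ‖u x‖ ∧ ‖u x‖ ≤ t + δ
                · rw [levelGrad, indicator_of_mem (by exact h), indicator_of_mem (by exact h)]
                · rw [levelGrad, indicator_of_notMem (by exact h),
                    indicator_of_notMem (by exact h), mul_zero, zero_mul]
            _ ≤ ENNReal.ofReal δ * ENNReal.ofReal (‖u x‖ ^ (p - 1)) * ‖fderiv ℝ u x‖ₑ := by
                rw [lintegral_mul_const' _ _ (by simp)]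
                gcongr
                exact setLIntegral_indicator_rpow_le hp
            _ ≤ _ := by
                rw [mul_assoc]
                gcongr
                rw [← ofReal_norm, ← ENNReal.ofReal_mul (by positivity),
                  ← ENNReal.ofReal_add (by positivity) (by positivity)]
                apply ENNReal.ofReal_le_ofReal
                have key : ∀ a : ℝ, 0 ≤ a → a ^ (p - 1) * a = a ^ p := fun a ha => by
                  rw [← Real.rpow_add_one' ha (by linarith)]; simp
                rcases le_total ‖u x‖ ‖fderiv ℝ u x‖ with h | h
                · calc ‖u x‖ ^ (p - 1) * ‖fderiv ℝ u x‖
                      ≤ ‖fderiv ℝ u x‖ ^ (p - 1) * ‖fderiv ℝ u x‖ := by gcongr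
                    _ = ‖fderiv ℝ u x‖ ^ p := key _ (norm_nonneg _)
                    _ ≤ _ := le_add_of_nonneg_left (by positivity)
                · calc ‖u x‖ ^ (p - 1) * ‖fderiv ℝ u x‖
                      ≤ ‖u x‖ ^ (p - 1) * ‖u x‖ := by gcongr
                    _ = ‖u x‖ ^ p := key _ (norm_nonneg _)
                    _ ≤ _ := le_add_of_nonneg_right (by positivity)
      _ = K * (((k : ENNReal) + 1) * ENNReal.ofReal δ) * (∫⁻ x, ENNReal.ofReal (‖u x‖ ^ p) ∂μ +
            ∫⁻ x, ENNReal.ofReal (‖fderiv ℝ u x‖ ^ p) ∂μ) := by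
          rw [lintegral_const_mul' _ _ (by simp), lintegral_add_left (hN.measurable.pow_const p).ennreal_ofReal]
          ring
      _ = _ := by rw [hone, mul_one]
  calc ENNReal.ofReal p * ∫⁻ t in Ioi (0 : ℝ), ν {x | t < ‖u x‖} * ENNReal.ofReal (t ^ (p - 1))
      ≤ ENNReal.ofReal p * ∫⁻ t in Ioi (0 : ℝ), liminf (fun k : ℕ => K *
          ((k + 1) * ∫⁻ x, levelGrad u t (1 / (k + 1)) x ∂μ) * ENNReal.ofReal (t ^ (p - 1)))
            atTop := by
        gcongr ENNReal.ofReal p * ?_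
        refine setLIntegral_mono' measurableSet_Ioi fun t ht => ?_
        refine (mul_le_mul_left (measure_lt_le_liminf_levelGrad μ hd hu hc hν
          (le_of_lt ht)) _).trans (le_of_eq ?_)
        rw [mul_comm]
        exact (ENNReal.liminf_mul_const_of_ne_top ENNReal.ofReal_ne_top).symm
    _ ≤ ENNReal.ofReal p * liminf (fun k : ℕ => ∫⁻ t in Ioi (0 : ℝ), K *
          ((k + 1) * ∫⁻ x, levelGrad u t (1 / (k + 1)) x ∂μ) * ENNReal.ofReal (t ^ (p - 1)))
            atTop := by
        gcongr
        refine lintegral_liminf_le fun k => ?_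
        exact (((hlevel _).const_mul _).const_mul _).mul hpm
    _ ≤ ENNReal.ofReal p * (K * (∫⁻ x, ENNReal.ofReal (‖u x‖ ^ p) ∂μ +
          ∫⁻ x, ENNReal.ofReal (‖fderiv ℝ u x‖ ^ p) ∂μ)) := by
        gcongr
        exact liminf_le_of_le (by isBoundedDefault) fun b hb => by
          obtain ⟨k, hk⟩ := hb.exists
          exact hk.trans (hswap k)
    _ = _ := by ring

section Ray

theorem le_average_add_lintegral {g g' : ℝ → ENNReal} (hg : Measurable g)
    (h : ∀ a b, a ≤ b → g a ≤ g b + ∫⁻ t in Ioc a b, g' t)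
    (h' : ∀ a b, a ≤ b → g b ≤ g a + ∫⁻ t in Ioc a b, g' t) {s : ℝ} (hs : s ≤ 2) :
    g s ≤ (∫⁻ t in Ioc 1 2, g t) + ((∫⁻ t in Ioc 1 2, g' t) + ∫⁻ t in Ioc s 2, g' t) := by
  have hpt : ∀ τ ∈ Ioc (1 : ℝ) 2,
      g s ≤ g τ + ((∫⁻ t in Ioc 1 2, g' t) + ∫⁻ t in Ioc s 2, g' t) := by
    intro τ hτ
    rcases le_total s τ with hle | hle
    · refine (h s τ hle).trans ?_
      gcongr
      exact (lintegral_mono_set (Ioc_subset_Ioc_right hτ.2)).trans le_add_self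
    · refine (h' τ s hle).trans ?_
      gcongr
      exact (lintegral_mono_set (Ioc_subset_Ioc hτ.1.le hs)).trans le_self_add
  calc g s = ∫⁻ _ in Ioc (1 : ℝ) 2, g s := by
        rw [setLIntegral_const, Real.volume_Ioc]; norm_num
    _ ≤ ∫⁻ τ in Ioc (1 : ℝ) 2,
          (g τ + ((∫⁻ t in Ioc 1 2, g' t) + ∫⁻ t in Ioc s 2, g' t)) :=
        setLIntegral_mono' measurableSet_Ioc hpt
    _ = _ := by
        rw [lintegral_add_left hg, setLIntegral_const, Real.volume_Ioc]; norm_num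

theorem setLIntegral_Ioc_one_two_le (g : ℝ → ENNReal) (k : ℕ) :
    ∫⁻ t in Ioc 1 2, g t ≤ ∫⁻ t in Ioc 0 2, ENNReal.ofReal (t ^ k) * g t := by
  refine (setLIntegral_mono' measurableSet_Ioc fun t ht => ?_).trans
    (lintegral_mono_set (Ioc_subset_Ioc_left zero_le_one))
  refine le_mul_of_one_le_left zero_le ?_
  rw [ENNReal.one_le_ofReal]
  exact one_le_pow₀ ht.1.le

theorem setLIntegral_pow_mul_tail_le {g' : ℝ → ENNReal} (hg' : Measurable g') (k : ℕ) :
    ∫⁻ s in Ioc (0 : ℝ) 2, ENNReal.ofReal (s ^ k) * ∫⁻ t in Ioc s 2, g' t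
      ≤ ∫⁻ t in Ioc (0 : ℝ) 2, ENNReal.ofReal (t ^ (k + 1)) * g' t := by
  have hmeas : Measurable fun q : ℝ × ℝ =>
      ENNReal.ofReal (q.1 ^ k) * {q : ℝ × ℝ | q.1 < q.2}.indicator (fun q => g' q.2) q :=
    (by fun_prop : Measurable fun q : ℝ × ℝ => ENNReal.ofReal (q.1 ^ k)).mul
      ((hg'.comp measurable_snd).indicator (measurableSet_lt measurable_fst measurable_snd))
  calc ∫⁻ s in Ioc (0 : ℝ) 2, ENNReal.ofReal (s ^ k) * ∫⁻ t in Ioc s 2, g' t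
      ≤ ∫⁻ s in Ioc (0 : ℝ) 2, ∫⁻ t in Ioc (0 : ℝ) 2, ENNReal.ofReal (s ^ k) *
          {q : ℝ × ℝ | q.1 < q.2}.indicator (fun q => g' q.2) (s, t) := by
        refine setLIntegral_mono' measurableSet_Ioc fun s hs => ?_
        rw [lintegral_const_mul' _ _ (by simp)]
        gcongr ENNReal.ofReal (s ^ k) * ?_
        refine (setLIntegral_mono' measurableSet_Ioc fun t ht => ?_).trans
          (lintegral_mono_set (Ioc_subset_Ioc_left hs.1.le))
        rw [indicator_of_mem (by exact ht.1)]
    _ = ∫⁻ t in Ioc (0 : ℝ) 2, ∫⁻ s in Ioc (0 : ℝ) 2, ENNReal.ofReal (s ^ k) *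
          {q : ℝ × ℝ | q.1 < q.2}.indicator (fun q => g' q.2) (s, t) :=
        lintegral_lintegral_swap hmeas.aemeasurable
    _ ≤ _ := by
        refine setLIntegral_mono' measurableSet_Ioc fun t ht => ?_
        calc ∫⁻ s in Ioc (0 : ℝ) 2, ENNReal.ofReal (s ^ k) *
              {q : ℝ × ℝ | q.1 < q.2}.indicator (fun q => g' q.2) (s, t)
            ≤ ∫⁻ s in Ioc (0 : ℝ) 2, (Ioc 0 t).indicator
                (fun _ => ENNReal.ofReal (t ^ k) * g' t) s := by
              refine setLIntegral_mono' measurableSet_Ioc fun s hs => ?_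
              by_cases hst : s < t
              · rw [indicator_of_mem (by exact hst), indicator_of_mem (show s ∈ Ioc 0 t from ⟨hs.1, hst.le⟩)]
                gcongr
                exact hs.1.le
              · rw [indicator_of_notMem (by exact hst), mul_zero]
                exact zero_le
          _ ≤ ∫⁻ s, (Ioc 0 t).indicator (fun _ => ENNReal.ofReal (t ^ k) * g' t) s :=
              setLIntegral_le_lintegral _ _
          _ = _ := by
              rw [lintegral_indicator_const measurableSet_Ioc, Real.volume_Ioc, sub_zero, pow_succ,
                ENNReal.ofReal_mul (pow_nonneg ht.1.le _)]
              ring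

theorem setLIntegral_pow_mul_le {g g' : ℝ → ENNReal} (hg : Measurable g) (hg' : Measurable g')
    (h : ∀ a b, a ≤ b → g a ≤ g b + ∫⁻ t in Ioc a b, g' t)
    (h' : ∀ a b, a ≤ b → g b ≤ g a + ∫⁻ t in Ioc a b, g' t) (k : ℕ) :
    ∫⁻ s in Ioc (0 : ℝ) 2, ENNReal.ofReal (s ^ k) * g s ≤
      (2 ^ (k + 1) + 1) * ((∫⁻ s in Ioc (0 : ℝ) 2, ENNReal.ofReal (s ^ (k + 1)) * g s) +
        ∫⁻ s in Ioc (0 : ℝ) 2, ENNReal.ofReal (s ^ (k + 1)) * g' s) := by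
  set A := ∫⁻ s in Ioc (0 : ℝ) 2, ENNReal.ofReal (s ^ (k + 1)) * g s
  set A' := ∫⁻ s in Ioc (0 : ℝ) 2, ENNReal.ofReal (s ^ (k + 1)) * g' s
  calc ∫⁻ s in Ioc (0 : ℝ) 2, ENNReal.ofReal (s ^ k) * g s
      ≤ ∫⁻ s in Ioc (0 : ℝ) 2,
          (2 ^ k * (A + A') + ENNReal.ofReal (s ^ k) * ∫⁻ t in Ioc s 2, g' t) := by
        refine setLIntegral_mono' measurableSet_Ioc fun s hs => ?_
        calc ENNReal.ofReal (s ^ k) * g s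
            ≤ ENNReal.ofReal (s ^ k) * (A + (A' + ∫⁻ t in Ioc s 2, g' t)) := by
              gcongr
              refine (le_average_add_lintegral hg h h' hs.2).trans ?_
              gcongr
              · exact setLIntegral_Ioc_one_two_le g (k + 1)
              · exact setLIntegral_Ioc_one_two_le g' (k + 1)
          _ = ENNReal.ofReal (s ^ k) * (A + A') +
                ENNReal.ofReal (s ^ k) * ∫⁻ t in Ioc s 2, g' t := by ring
          _ ≤ _ := by
              gcongr
              rw [← ENNReal.ofReal_ofNat 2, ← ENNReal.ofReal_pow (by norm_num)]
              apply ENNReal.ofReal_le_ofReal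
              have := hs.1.le
              have := hs.2
              gcongr
    _ = 2 ^ (k + 1) * (A + A') +
          ∫⁻ s in Ioc (0 : ℝ) 2, ENNReal.ofReal (s ^ k) * ∫⁻ t in Ioc s 2, g' t := by
        rw [lintegral_add_left measurable_const, setLIntegral_const, Real.volume_Ioc, sub_zero,
          ENNReal.ofReal_ofNat]
        ring
    _ ≤ 2 ^ (k + 1) * (A + A') + (A + A') := by
        gcongr
        exact (setLIntegral_pow_mul_tail_le hg' k).trans le_add_self
    _ = _ := by ring

theorem exists_le_sum_setLIntegral_pow_mul (m : ℕ) : ∃ C : ENNReal, C ≠ ⊤ ∧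
    ∀ G : ℕ → ℝ → ENNReal, (∀ j, Measurable (G j)) →
      (∀ j a b, a ≤ b → G j a ≤ G j b + ∫⁻ t in Ioc a b, G (j + 1) t) →
      (∀ j a b, a ≤ b → G j b ≤ G j a + ∫⁻ t in Ioc a b, G (j + 1) t) →
      G 0 0 ≤ C * ∑ j ∈ Finset.range (m + 2),
        ∫⁻ s in Ioc (0 : ℝ) 2, ENNReal.ofReal (s ^ m) * G j s := by
  induction m with
  | zero =>
    refine ⟨2, by simp, fun G hG h h' => ?_⟩
    have h1 := setLIntegral_Ioc_one_two_le (G 0) 0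
    have h2 := setLIntegral_Ioc_one_two_le (G 1) 0
    refine (le_average_add_lintegral (hG 0) (h 0) (h' 0) zero_le_two).trans ?_
    simp only [pow_zero, ENNReal.ofReal_one, one_mul, zero_add, Finset.sum_range_succ,
      Finset.sum_range_zero] at h1 h2 ⊢
    rw [mul_add, two_mul, two_mul]
    gcongr
    exact h1.trans le_self_add
  | succ m ih =>
    obtain ⟨C, hC, hCG⟩ := ih
    refine ⟨C * ((2 ^ (m + 1) + 1) * 2), by finiteness, fun G hG h h' => ?_⟩
    set A : ℕ → ENNReal := fun j => ∫⁻ s in Ioc (0 : ℝ) 2, ENNReal.ofReal (s ^ (m + 1)) * G j s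
    calc G 0 0 ≤ C * ∑ j ∈ Finset.range (m + 2), (2 ^ (m + 1) + 1) * (A j + A (j + 1)) := by
          refine (hCG G hG h h').trans ?_
          gcongr with j
          exact setLIntegral_pow_mul_le (hG j) (hG (j + 1)) (h j) (h' j) m
      _ = C * ((2 ^ (m + 1) + 1) * (∑ j ∈ Finset.range (m + 2), A j +
            ∑ j ∈ Finset.range (m + 2), A (j + 1))) := by
          rw [← Finset.mul_sum, Finset.sum_add_distrib]
      _ ≤ C * ((2 ^ (m + 1) + 1) * (∑ j ∈ Finset.range (m + 3), A j +
            ∑ j ∈ Finset.range (m + 3), A j)) := by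
          have h1 : ∑ j ∈ Finset.range (m + 2), A j ≤ ∑ j ∈ Finset.range (m + 3), A j := by
            rw [Finset.sum_range_succ _ (m + 2)]
            exact le_self_add
          have h2 : ∑ j ∈ Finset.range (m + 2), A (j + 1) ≤ ∑ j ∈ Finset.range (m + 3), A j := by
            rw [Finset.sum_range_succ' _ (m + 2)]
            exact le_self_add
          exact mul_le_mul_right (mul_le_mul_right (add_le_add h1 h2) _) _
      _ = _ := by ring

end Ray

theorem lintegral_rpow_le_measure_univ_mul {α : Type*} [MeasurableSpace α] (κ : Measure α)
    {f : α → ENNReal} (hf : Measurable f) {p : ℝ} (hp : 1 ≤ p) :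
    (∫⁻ a, f a ∂κ) ^ p ≤ κ univ ^ (p - 1) * ∫⁻ a, f a ^ p ∂κ := by
  have h := eLpNorm'_le_eLpNorm'_mul_rpow_measure_univ (μ := κ) one_pos hp
    hf.aestronglyMeasurable
  simp only [eLpNorm', enorm_eq_self, ENNReal.rpow_one, div_one] at h
  have hp0 : p ≠ 0 := by linarith
  calc (∫⁻ a, f a ∂κ) ^ p
      ≤ ((∫⁻ a, f a ^ p ∂κ) ^ (1 / p) * κ univ ^ (1 - 1 / p)) ^ p := by gcongr
    _ = _ := by
      rw [ENNReal.mul_rpow_of_nonneg _ _ (by linarith), ← ENNReal.rpow_mul, ← ENNReal.rpow_mul,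
        one_div_mul_cancel hp0, ENNReal.rpow_one, mul_comm]
      congr 2
      field_simp

/-- The measure `s ^ m ds dz` on `(0, 2] × ball 0 1`. -/
noncomputable def rayMeasure (vol : Measure E) (m : ℕ) : Measure (ℝ × E) :=
  ((volume.restrict (Ioc (0 : ℝ) 2)).withDensity fun s => ENNReal.ofReal (s ^ m)).prod
    (vol.restrict (ball 0 1))

theorem lintegral_rayMeasure (vol : Measure E) [vol.IsAddHaarMeasure] (m : ℕ)
    {f : ℝ × E → ENNReal} (hf : Measurable f) :
    ∫⁻ q, f q ∂rayMeasure vol m = ∫⁻ s in Ioc (0 : ℝ) 2, ENNReal.ofReal (s ^ m) *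
      ∫⁻ z in ball (0 : E) 1, f (s, z) ∂vol := by
  rw [rayMeasure, lintegral_prod _ hf.aemeasurable,
    lintegral_withDensity_eq_lintegral_mul _ (by fun_prop) hf.lintegral_prod_right']
  rfl

theorem rayMeasure_univ_lt_top (vol : Measure E) [vol.IsAddHaarMeasure] (m : ℕ) :
    rayMeasure vol m univ < ⊤ := by
  rw [← lintegral_one, lintegral_rayMeasure vol m measurable_const]
  calc ∫⁻ s in Ioc (0 : ℝ) 2, ENNReal.ofReal (s ^ m) * ∫⁻ _ in ball (0 : E) 1, 1 ∂vol
      ≤ ∫⁻ _ in Ioc (0 : ℝ) 2, ENNReal.ofReal (2 ^ m) * vol (ball 0 1) := by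
        refine setLIntegral_mono' measurableSet_Ioc fun s hs => ?_
        have := hs.1.le
        have := hs.2
        rw [lintegral_one, Measure.restrict_apply_univ]
        gcongr
    _ < ⊤ := by
        rw [setLIntegral_const, Real.volume_Ioc]
        have : vol (ball (0 : E) 1) < ⊤ := measure_ball_lt_top
        finiteness

instance (vol : Measure E) [vol.IsAddHaarMeasure] (m : ℕ) : IsFiniteMeasure (rayMeasure vol m) :=
  ⟨rayMeasure_univ_lt_top vol m⟩

theorem enorm_le_add_enorm_sub {G : Type*} [SeminormedAddCommGroup G] (a b : G) :
    ‖a‖ₑ ≤ ‖b‖ₑ + ‖a - b‖ₑ := by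
  rw [← ofReal_norm, ← ofReal_norm, ← ofReal_norm,
    ← ENNReal.ofReal_add (norm_nonneg _) (norm_nonneg _)]
  exact ENNReal.ofReal_le_ofReal (by simpa using norm_add_le b (a - b))

/-- A smooth function is controlled at a point by the weighted averages of its derivatives over
any segment of bounded length starting at that point. -/
theorem exists_enorm_le_sum_setLIntegral_ray (E F : Type*) [NormedAddCommGroup E]
    [NormedSpace ℝ E] [NormedAddCommGroup F] [NormedSpace ℝ F] [CompleteSpace F] (m : ℕ) :
    ∃ C : ENNReal, C ≠ ⊤ ∧ ∀ φ : E → F, ContDiff ℝ (⊤ : ℕ∞) φ → ∀ x z, ‖z‖ ≤ 1 →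
      ‖φ x‖ₑ ≤ C * ∑ j ∈ Finset.range (m + 2),
        ∫⁻ s in Ioc (0 : ℝ) 2, ENNReal.ofReal (s ^ m) * ‖iteratedFDeriv ℝ j φ (x + s • z)‖ₑ := by
  obtain ⟨C, hC, hCG⟩ := exists_le_sum_setLIntegral_pow_mul m
  refine ⟨C, hC, fun φ hφ x z hz => ?_⟩
  have hcont : ∀ j, Continuous fun s : ℝ => iteratedFDeriv ℝ j φ (x + s • z) := fun j =>
    (hφ.continuous_iteratedFDeriv (by exact_mod_cast le_top)).comp (by fun_prop)
  have hdiff : ∀ j, Differentiable ℝ (iteratedFDeriv ℝ j φ) := fun j =>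
    hφ.differentiable_iteratedFDeriv (by exact_mod_cast WithTop.coe_lt_top j)
  have hcd : ∀ j, Continuous (fderiv ℝ (iteratedFDeriv ℝ j φ)) := fun j =>
    (hφ.iteratedFDeriv_right (m := 1) (i := j) (by exact_mod_cast le_top)).continuous_fderiv
      one_ne_zero
  have hftc : ∀ (j : ℕ) (a b : ℝ), a ≤ b →
      ‖iteratedFDeriv ℝ j φ (x + b • z) - iteratedFDeriv ℝ j φ (x + a • z)‖ₑ ≤
        ∫⁻ t in Ioc a b, ‖iteratedFDeriv ℝ (j + 1) φ (x + t • z)‖ₑ := by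
    intro j a b hab
    have hline : ∀ s : ℝ, HasDerivAt (fun s : ℝ => x + s • z) z s := fun s => by
      simpa using ((hasDerivAt_id s).smul_const z).const_add x
    refine (enorm_sub_le_lintegral_Ioc (w := fun s : ℝ => iteratedFDeriv ℝ j φ (x + s • z))
      (fun s => (hdiff j _).hasFDerivAt.comp_hasDerivAt s (hline s))
      (((hcd j).comp (by fun_prop)).clm_apply continuous_const) hab).trans
      (lintegral_mono fun t => ?_)
    rw [enorm_le_iff_norm_le]
    calc _ ≤ ‖fderiv ℝ (iteratedFDeriv ℝ j φ) (x + t • z)‖ * ‖z‖ :=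
          ContinuousLinearMap.le_opNorm _ _
      _ ≤ ‖fderiv ℝ (iteratedFDeriv ℝ j φ) (x + t • z)‖ * 1 := by gcongr
      _ = _ := by rw [mul_one, norm_fderiv_iteratedFDeriv]
  have h0 := hCG (fun j s => ‖iteratedFDeriv ℝ j φ (x + s • z)‖ₑ)
    (fun j => (hcont j).enorm.measurable)
    (fun j a b hab => (enorm_le_add_enorm_sub _ _).trans (add_le_add_right (by
      rw [enorm_sub_rev]
      exact hftc j a b hab) _))
    (fun j a b hab => (enorm_le_add_enorm_sub _ _).trans (add_le_add_right (hftc j a b hab) _))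
  refine le_of_eq_of_le ?_ h0
  simp only [zero_smul, add_zero]
  rw [← ofReal_norm, ← ofReal_norm, norm_iteratedFDeriv_zero]

theorem enorm_mul_measure_ball_le (vol : Measure E) [vol.IsAddHaarMeasure] {m N : ℕ}
    {C c : ENNReal} (hC : C ≠ ⊤) {H : ℕ → E → ENNReal} (hH : ∀ j, Measurable (H j)) {x : E}
    (h : ∀ z, ‖z‖ ≤ 1 → c ≤ C * ∑ j ∈ Finset.range N,
      ∫⁻ s in Ioc (0 : ℝ) 2, ENNReal.ofReal (s ^ m) * H j (x + s • z)) :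
    c * vol (ball 0 1) ≤
      C * ∫⁻ q, ∑ j ∈ Finset.range N, H j (x + q.1 • q.2) ∂rayMeasure vol m := by
  have hjm : ∀ j, Measurable fun q : ℝ × E => H j (x + q.1 • q.2) := fun j =>
    (hH j).comp (by fun_prop)
  have hjw : ∀ j, Measurable fun q : E × ℝ => ENNReal.ofReal (q.2 ^ m) * H j (x + q.2 • q.1) :=
    fun j => (by fun_prop : Measurable fun q : E × ℝ => ENNReal.ofReal (q.2 ^ m)).mul
      ((hjm j).comp measurable_swap)
  calc c * vol (ball 0 1) = ∫⁻ _ in ball (0 : E) 1, c ∂vol :=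
        (setLIntegral_const _ _).symm
    _ ≤ ∫⁻ z in ball (0 : E) 1, (C * ∑ j ∈ Finset.range N,
          ∫⁻ s in Ioc (0 : ℝ) 2, ENNReal.ofReal (s ^ m) * H j (x + s • z)) ∂vol :=
        setLIntegral_mono' measurableSet_ball fun z hz => h z (mem_ball_zero_iff.1 hz).le
    _ = C * ∑ j ∈ Finset.range N, ∫⁻ z in ball (0 : E) 1,
          (∫⁻ s in Ioc (0 : ℝ) 2, ENNReal.ofReal (s ^ m) * H j (x + s • z)) ∂vol := by
        rw [lintegral_const_mul' _ _ hC, lintegral_finsetSum]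
        exact fun j _ => (hjw j).lintegral_prod_right'
    _ = C * ∑ j ∈ Finset.range N, ∫⁻ q, H j (x + q.1 • q.2) ∂rayMeasure vol m := by
        congr 1
        refine Finset.sum_congr rfl fun j _ => ?_
        rw [lintegral_rayMeasure vol m (hjm j), lintegral_lintegral_swap (hjw j).aemeasurable]
        refine lintegral_congr fun s => ?_
        rw [lintegral_const_mul' _ _ ENNReal.ofReal_ne_top]
    _ = _ := by rw [lintegral_finsetSum _ fun j _ => hjm j]

theorem lintegral_Ioi_ofReal_rpow_neg_two {R : ℝ} (hR : 0 < R) :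
    ∫⁻ s in Ioi R, ENNReal.ofReal (s ^ (-2 : ℝ)) = ENNReal.ofReal R⁻¹ := by
  rw [← ofReal_integral_eq_lintegral_ofReal (integrableOn_Ioi_rpow_of_lt (by norm_num) hR)
    ((ae_restrict_mem measurableSet_Ioi).mono fun s hs =>
      Real.rpow_nonneg (hR.trans hs).le _), integral_Ioi_rpow_of_lt (by norm_num) hR]
  norm_num [Real.rpow_neg_one]

theorem measure_add_smul_preimage_ball (vol : Measure E) [vol.IsAddHaarMeasure] (x y : E)
    {s R : ℝ} (hs : 0 < s) (hR : 0 < R) :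
    vol {z | x + s • z ∈ ball y R} =
      ENNReal.ofReal ((R / s) ^ Module.finrank ℝ E) * vol (ball 0 1) := by
  have : {z | x + s • z ∈ ball y R} = ball (s⁻¹ • (y - x)) (R / s) := by
    ext z
    change x + s • z ∈ ball y R ↔ _
    rw [mem_ball_iff_norm, mem_ball_iff_norm, lt_div_iff₀ hs]
    have : x + s • z - y = s • (z - s⁻¹ • (y - x)) := by
      rw [smul_sub, smul_inv_smul₀ hs.ne']
      abel
    rw [this, norm_smul, Real.norm_of_nonneg hs.le, mul_comm]
  rw [this, Measure.addHaar_ball_of_pos _ _ (by positivity)]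

/-- The image of `μ` under averaging along `rayMeasure`: it replaces `x` by `x + s • z`. -/
noncomputable def rayConv (vol : Measure E) (m : ℕ) (μ : Measure E) : Measure E :=
  ((rayMeasure vol m).prod μ).map fun q => q.2 + q.1.1 • q.1.2

theorem lintegral_rayConv (vol : Measure E) [vol.IsAddHaarMeasure] (m : ℕ) (μ : Measure E)
    [SFinite μ] {f : E → ENNReal} (hf : Measurable f) :
    ∫⁻ y, f y ∂rayConv vol m μ = ∫⁻ x, ∫⁻ q, f (x + q.1 • q.2) ∂rayMeasure vol m ∂μ := by
  have hg : Measurable fun q : (ℝ × E) × E => q.2 + q.1.1 • q.1.2 := by fun_prop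
  rw [rayConv, lintegral_map hf hg]
  exact lintegral_prod_symm _ (hf.comp hg).aemeasurable

section Slice

variable (vol : Measure E) [vol.IsAddHaarMeasure] {μ : Measure E} [SFinite μ] {M : ENNReal}

theorem lintegral_slice_le (hμ : ∀ x r, 0 < r → μ (ball x r) ≤ M * ENNReal.ofReal r) (y : E)
    (s : ℝ) {R : ℝ} (hR : 0 < R) :
    ∫⁻ z in ball (0 : E) 1, μ {x | x + s • z ∈ ball y R} ∂vol ≤
      M * ENNReal.ofReal R * vol (ball 0 1) := by
  rw [← setLIntegral_const]
  refine lintegral_mono fun z => ?_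
  have : {x | x + s • z ∈ ball y R} = ball (y - s • z) R := by
    ext x
    change x + s • z ∈ ball y R ↔ _
    rw [mem_ball_iff_norm, mem_ball_iff_norm]
    congr! 2
    abel
  rw [this]
  exact hμ _ _ hR

theorem lintegral_slice_le_of_lt (hμ : ∀ x r, 0 < r → μ (ball x r) ≤ M * ENNReal.ofReal r)
    (y : E) {s R : ℝ} (hR : 0 < R) (hs : R < s) :
    ∫⁻ z in ball (0 : E) 1, μ {x | x + s • z ∈ ball y R} ∂vol ≤
      ENNReal.ofReal ((R / s) ^ Module.finrank ℝ E) * vol (ball 0 1) *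
        (M * ENNReal.ofReal (2 * s)) := by
  have hs0 := hR.trans hs
  have hS : MeasurableSet {q : E × E | q.2 + s • q.1 ∈ ball y R} :=
    (by fun_prop : Measurable fun q : E × E => q.2 + s • q.1) measurableSet_ball
  have h1 : ∫⁻ z in ball (0 : E) 1, μ {x | x + s • z ∈ ball y R} ∂vol =
      ∫⁻ x, vol.restrict (ball 0 1) {z | x + s • z ∈ ball y R} ∂μ :=
    (Measure.prod_apply hS).symm.trans (Measure.prod_apply_symm hS)
  rw [h1]
  calc ∫⁻ x, vol.restrict (ball 0 1) {z | x + s • z ∈ ball y R} ∂μ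
      ≤ ∫⁻ x, (ball y (2 * s)).indicator (fun _ =>
          ENNReal.ofReal ((R / s) ^ Module.finrank ℝ E) * vol (ball 0 1)) x ∂μ := by
        refine lintegral_mono fun x => ?_
        by_cases hx : x ∈ ball y (2 * s)
        · rw [indicator_of_mem hx, ← measure_add_smul_preimage_ball vol x y hs0 hR]
          exact Measure.restrict_apply_le _ _
        · rw [indicator_of_notMem hx, nonpos_iff_eq_zero]
          have hSx : MeasurableSet {z | x + s • z ∈ ball y R} :=
            (by fun_prop : Measurable fun z : E => x + s • z) measurableSet_ball
          rw [Measure.restrict_apply hSx]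
          convert measure_empty (μ := vol)
          rw [eq_empty_iff_forall_notMem]
          rintro z ⟨hz, hz1⟩
          refine hx ?_
          replace hz : x + s • z ∈ ball y R := hz
          rw [mem_ball_iff_norm] at hz ⊢
          rw [mem_ball_zero_iff] at hz1
          calc ‖x - y‖ = ‖(x + s • z - y) - s • z‖ := by congr 1; abel
            _ ≤ ‖x + s • z - y‖ + ‖s • z‖ := norm_sub_le _ _
            _ < R + s * 1 := by
              rw [norm_smul, Real.norm_of_nonneg hs0.le]
              gcongr
            _ ≤ 2 * s := by linarith
    _ = ENNReal.ofReal ((R / s) ^ Module.finrank ℝ E) * vol (ball 0 1) * μ (ball y (2 * s)) :=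
        lintegral_indicator_const measurableSet_ball _
    _ ≤ _ := by
        gcongr
        exact hμ _ _ (by positivity)

end Slice

/-- Averaging raises the growth exponent of a measure from `1` to `m + 2`. -/
theorem rayConv_ball_le (vol : Measure E) [vol.IsAddHaarMeasure] {m : ℕ}
    (hd : Module.finrank ℝ E = m + 3) {μ : Measure E} [SFinite μ] {M : ENNReal}
    (hμ : ∀ x r, 0 < r → μ (ball x r) ≤ M * ENNReal.ofReal r) (y : E) {R : ℝ} (hR : 0 < R) :
    rayConv vol m μ (ball y R) ≤
      3 * vol (ball 0 1) * M * ENNReal.ofReal (R ^ (m + 2)) := by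
  have hS : MeasurableSet {q : (ℝ × E) × E | q.2 + q.1.1 • q.1.2 ∈ ball y R} :=
    (by fun_prop : Measurable fun q : (ℝ × E) × E => q.2 + q.1.1 • q.1.2) measurableSet_ball
  set S : ℝ → ENNReal := fun s => ∫⁻ z in ball (0 : E) 1, μ {x | x + s • z ∈ ball y R} ∂vol
  have h1 : rayConv vol m μ (ball y R) =
      ∫⁻ s in Ioc (0 : ℝ) 2, ENNReal.ofReal (s ^ m) * S s := by
    rw [rayConv, Measure.map_apply (by fun_prop) measurableSet_ball]
    exact (Measure.prod_apply hS).trans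
      (lintegral_rayMeasure vol m (measurable_measure_prodMk_left hS))
  set b := vol (ball (0 : E) 1)
  have hlow : ∫⁻ s in Ioc (0 : ℝ) R, ENNReal.ofReal (s ^ m) * S s ≤
      b * M * ENNReal.ofReal (R ^ (m + 2)) := by
    calc ∫⁻ s in Ioc (0 : ℝ) R, ENNReal.ofReal (s ^ m) * S s
        ≤ ∫⁻ _ in Ioc (0 : ℝ) R, ENNReal.ofReal (R ^ m) * (M * ENNReal.ofReal R * b) := by
          refine setLIntegral_mono' measurableSet_Ioc fun s hs => ?_
          have := hs.1.le
          have := hs.2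
          gcongr
          exact lintegral_slice_le vol hμ y s hR
      _ = _ := by
          rw [setLIntegral_const, Real.volume_Ioc, sub_zero, pow_add, sq,
            ENNReal.ofReal_mul (by positivity), ENNReal.ofReal_mul (by positivity)]
          ring
  have hhigh : ∫⁻ s in Ioi R, ENNReal.ofReal (s ^ m) * S s ≤
      2 * b * M * ENNReal.ofReal (R ^ (m + 2)) := by
    calc ∫⁻ s in Ioi R, ENNReal.ofReal (s ^ m) * S s
        ≤ ∫⁻ s in Ioi R, 2 * b * M * ENNReal.ofReal (R ^ (m + 3)) *
            ENNReal.ofReal (s ^ (-2 : ℝ)) := by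
          refine setLIntegral_mono' measurableSet_Ioi fun s hs => ?_
          have hs0 : 0 < s := hR.trans hs
          refine (mul_le_mul_right (lintegral_slice_le_of_lt vol hμ y hR hs) _).trans
            (le_of_eq ?_)
          have : s ^ m * ((R / s) ^ Module.finrank ℝ E * (2 * s)) =
              2 * (R ^ (m + 3) * s ^ (-2 : ℝ)) := by
            rw [hd, Real.rpow_neg hs0.le, Real.rpow_ofNat, div_pow]
            field_simp
            ring
          calc _ = b * M * (ENNReal.ofReal (s ^ m) *
                (ENNReal.ofReal ((R / s) ^ Module.finrank ℝ E) * ENNReal.ofReal (2 * s))) := by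
                ring
            _ = b * M * (2 * (ENNReal.ofReal (R ^ (m + 3)) * ENNReal.ofReal (s ^ (-2 : ℝ)))) := by
                rw [← ENNReal.ofReal_mul (by positivity), ← ENNReal.ofReal_mul (by positivity),
                  this, ENNReal.ofReal_mul zero_le_two, ENNReal.ofReal_mul (by positivity),
                  ENNReal.ofReal_ofNat]
            _ = _ := by ring
      _ = 2 * b * M * (ENNReal.ofReal (R ^ (m + 3)) * ENNReal.ofReal R⁻¹) := by
          rw [lintegral_const_mul _ (by fun_prop), lintegral_Ioi_ofReal_rpow_neg_two hR, mul_assoc]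
      _ = _ := by
          rw [← ENNReal.ofReal_mul (by positivity), pow_succ, mul_inv_cancel_right₀ hR.ne']
  calc rayConv vol m μ (ball y R)
      ≤ ∫⁻ s in Ioc 0 R ∪ Ioi R, ENNReal.ofReal (s ^ m) * S s := by
        rw [h1, Ioc_union_Ioi_eq_Ioi hR.le]
        exact lintegral_mono_set Ioc_subset_Ioi_self
    _ ≤ b * M * ENNReal.ofReal (R ^ (m + 2)) + 2 * b * M * ENNReal.ofReal (R ^ (m + 2)) :=
        (lintegral_union_le _ _ _).trans (add_le_add hlow hhigh)
    _ = _ := by ring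

/-- Pointwise bound of a smooth function by averages of its derivatives, raised to a power. -/
theorem exists_ofReal_norm_rpow_le (vol : Measure E) [vol.IsAddHaarMeasure] (m : ℕ) {p : ℝ}
    (hp : 1 ≤ p) : ∃ C : ENNReal, C ≠ ⊤ ∧ ∀ φ : E → F, ContDiff ℝ (⊤ : ℕ∞) φ → ∀ x,
      ENNReal.ofReal (‖φ x‖ ^ p) ≤ C * ∫⁻ q, ∑ j ∈ Finset.range (m + 2),
        ENNReal.ofReal (‖iteratedFDeriv ℝ j φ (x + q.1 • q.2)‖ ^ p) ∂rayMeasure vol m := by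
  obtain ⟨C, hC, hCφ⟩ := exists_enorm_le_sum_setLIntegral_ray E F m
  have hp0 : 0 ≤ p := zero_le_one.trans hp
  have hp1 : 0 ≤ p - 1 := sub_nonneg.2 hp
  have hb0 : vol (ball (0 : E) 1) ≠ 0 := (measure_ball_pos _ _ one_pos).ne'
  have hb : vol (ball (0 : E) 1) ≠ ⊤ := measure_ball_lt_top.ne
  have hκ : rayMeasure vol m univ ≠ ⊤ := (rayMeasure_univ_lt_top vol m).ne
  refine ⟨C ^ p * (rayMeasure vol m univ ^ (p - 1) * ((m + 2 : ℕ) : ENNReal) ^ (p - 1)) /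
    vol (ball 0 1) ^ p, ENNReal.div_ne_top (by finiteness) (by simp [hb0, hb]),
    fun φ hφ x => ?_⟩
  set H : ℕ → E → ENNReal := fun j y => ENNReal.ofReal ‖iteratedFDeriv ℝ j φ y‖
  have hH : ∀ j, Measurable (H j) := fun j =>
    (hφ.continuous_iteratedFDeriv (m := j)
      (by exact_mod_cast le_top)).norm.measurable.ennreal_ofReal
  have hHx : ∀ j, Measurable fun q : ℝ × E => H j (x + q.1 • q.2) := fun j =>
    (hH j).comp (by fun_prop)
  have hHp : ∀ j y, H j y ^ p = ENNReal.ofReal (‖iteratedFDeriv ℝ j φ y‖ ^ p) := fun j y =>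
    ENNReal.ofReal_rpow_of_nonneg (norm_nonneg _) hp0
  have hmain := enorm_mul_measure_ball_le vol (N := m + 2) hC hH (x := x) (c := ‖φ x‖ₑ)
    (m := m) fun z hz => by simpa only [H, ofReal_norm] using hCφ φ hφ x z hz
  rw [ENNReal.div_eq_inv_mul, mul_assoc _ _ (∫⁻ _, _ ∂_), ← ENNReal.div_eq_inv_mul,
    ENNReal.le_div_iff_mul_le (by simp [hb0, hb]) (by simp [hb, hb0])]
  calc ENNReal.ofReal (‖φ x‖ ^ p) * vol (ball 0 1) ^ p
      = (‖φ x‖ₑ * vol (ball 0 1)) ^ p := by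
        rw [ENNReal.mul_rpow_of_nonneg _ _ hp0, ← ofReal_norm,
          ENNReal.ofReal_rpow_of_nonneg (norm_nonneg _) hp0]
    _ ≤ (C * ∫⁻ q, ∑ j ∈ Finset.range (m + 2), H j (x + q.1 • q.2) ∂rayMeasure vol m) ^ p := by
        gcongr
    _ ≤ C ^ p * (rayMeasure vol m univ ^ (p - 1) *
          ∫⁻ q, (∑ j ∈ Finset.range (m + 2), H j (x + q.1 • q.2)) ^ p ∂rayMeasure vol m) := by
        rw [ENNReal.mul_rpow_of_nonneg _ _ hp0]
        gcongr
        exact lintegral_rpow_le_measure_univ_mul _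
          (Finset.measurable_fun_sum _ fun j _ => hHx j) hp
    _ ≤ C ^ p * (rayMeasure vol m univ ^ (p - 1) * ∫⁻ q, ((m + 2 : ℕ) : ENNReal) ^ (p - 1) *
          ∑ j ∈ Finset.range (m + 2), H j (x + q.1 • q.2) ^ p ∂rayMeasure vol m) := by
        gcongr with q
        simpa using ENNReal.rpow_sum_le_const_mul_sum_rpow (Finset.range (m + 2))
          (fun j => H j (x + q.1 • q.2)) hp
    _ = _ := by
        rw [lintegral_const_mul' _ _ (by finiteness)]
        simp only [hHp, mul_assoc]

theorem exists_lintegral_norm_rpow_le (vol : Measure E) [vol.IsAddHaarMeasure] {m : ℕ}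
    (hd : Module.finrank ℝ E = m + 3) {p : ℝ} (hp : 1 ≤ p) :
    ∃ C : ENNReal, C ≠ ⊤ ∧ ∀ (μ : Measure E) [SFinite μ] (M : ENNReal),
      (∀ x r, 0 < r → μ (ball x r) ≤ M * ENNReal.ofReal r) →
      ∀ φ : E → F, ContDiff ℝ (⊤ : ℕ∞) φ → HasCompactSupport φ →
        ∫⁻ x, ENNReal.ofReal (‖φ x‖ ^ p) ∂μ ≤ C * M * ∑ i ∈ Finset.range (m + 3),
          ∫⁻ x, ENNReal.ofReal (‖iteratedFDeriv ℝ i φ x‖ ^ p) ∂vol := by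
  obtain ⟨C, hC, hCφ⟩ := exists_ofReal_norm_rpow_le (F := F) vol m hp
  have hb0 : vol (ball (0 : E) 1) ≠ 0 := (measure_ball_pos _ _ one_pos).ne'
  have hb : vol (ball (0 : E) 1) ≠ ⊤ := measure_ball_lt_top.ne
  set A : ENNReal := ENNReal.ofReal p * (2 ^ (2 * (m + 2) + 6) * 6 ^ (m + 2) / vol (ball 0 1))
  have hA : A ≠ ⊤ := ENNReal.mul_ne_top ENNReal.ofReal_ne_top
    (ENNReal.div_ne_top (by finiteness) hb0)
  refine ⟨C * (A * (3 * vol (ball 0 1)) * 2), by finiteness, fun μ _ M hμ φ hφ hc => ?_⟩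
  set T : ℕ → ENNReal := fun i => ∫⁻ x, ENNReal.ofReal (‖iteratedFDeriv ℝ i φ x‖ ^ p) ∂vol
  have hmeas : ∀ j, Measurable fun y => ENNReal.ofReal (‖iteratedFDeriv ℝ j φ y‖ ^ p) := fun j =>
    ((hφ.continuous_iteratedFDeriv (m := j)
      (by exact_mod_cast le_top)).norm.measurable.pow_const p).ennreal_ofReal
  have hT : ∀ j, ∫⁻ y, ENNReal.ofReal (‖iteratedFDeriv ℝ j φ y‖ ^ p) ∂rayConv vol m μ ≤
      A * (3 * vol (ball 0 1) * M) * (T j + T (j + 1)) := fun j => by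
    have := lintegral_norm_rpow_le_of_measure_ball_le vol hd hp
      (hφ.iteratedFDeriv_right (m := 1) (i := j) (by exact_mod_cast le_top))
      (hc.iteratedFDeriv j) (fun x r hr => rayConv_ball_le vol hd hμ x hr)
    simpa only [norm_fderiv_iteratedFDeriv] using this
  calc ∫⁻ x, ENNReal.ofReal (‖φ x‖ ^ p) ∂μ
      ≤ ∫⁻ x, C * ∫⁻ q, ∑ j ∈ Finset.range (m + 2),
          ENNReal.ofReal (‖iteratedFDeriv ℝ j φ (x + q.1 • q.2)‖ ^ p) ∂rayMeasure vol m ∂μ :=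
        lintegral_mono fun x => hCφ φ hφ x
    _ = C * ∑ j ∈ Finset.range (m + 2),
          ∫⁻ y, ENNReal.ofReal (‖iteratedFDeriv ℝ j φ y‖ ^ p) ∂rayConv vol m μ := by
        rw [lintegral_const_mul' _ _ hC, ← lintegral_finsetSum _ fun j _ => hmeas j,
          lintegral_rayConv vol m μ (Finset.measurable_fun_sum _ fun j _ => hmeas j)]
    _ ≤ C * ∑ j ∈ Finset.range (m + 2), A * (3 * vol (ball 0 1) * M) * (T j + T (j + 1)) := by
        gcongr with j
        exact hT j
    _ = C * (A * (3 * vol (ball 0 1) * M) * (∑ j ∈ Finset.range (m + 2), T j +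
          ∑ j ∈ Finset.range (m + 2), T (j + 1))) := by
        rw [← Finset.mul_sum, Finset.sum_add_distrib]
    _ ≤ C * (A * (3 * vol (ball 0 1) * M) * (∑ j ∈ Finset.range (m + 3), T j +
          ∑ j ∈ Finset.range (m + 3), T j)) := by
        have h1 : ∑ j ∈ Finset.range (m + 2), T j ≤ ∑ j ∈ Finset.range (m + 3), T j := by
          rw [Finset.sum_range_succ _ (m + 2)]
          exact le_self_add
        have h2 : ∑ j ∈ Finset.range (m + 2), T (j + 1) ≤ ∑ j ∈ Finset.range (m + 3), T j := by
          rw [Finset.sum_range_succ' _ (m + 2)]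
          exact le_self_add
        exact mul_le_mul_right (mul_le_mul_right (add_le_add h1 h2) _) _
    _ = _ := by ring

theorem sFinite_of_measure_ball_le {μ : Measure E} {M : ENNReal} (hM : M ≠ ⊤)
    (hμ : ∀ x r, 0 < r → μ (ball x r) ≤ M * ENNReal.ofReal r) : SFinite μ := by
  have : IsLocallyFiniteMeasure μ := ⟨fun x => ⟨ball x 1, ball_mem_nhds x one_pos,
    (hμ x 1 one_pos).trans_lt (by finiteness)⟩⟩
  infer_instance

theorem exists_lintegral_norm_rpow_le_of_two_le_finrank (vol : Measure E)
    [vol.IsAddHaarMeasure] (hd : 2 ≤ Module.finrank ℝ E) {p : ℝ} (hp : 1 ≤ p) :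
    ∃ C : ENNReal, C ≠ ⊤ ∧ ∀ (μ : Measure E) (M : ENNReal), M ≠ ⊤ →
      (∀ x r, 0 < r → μ (ball x r) ≤ M * ENNReal.ofReal r) →
      ∀ φ : E → F, ContDiff ℝ (⊤ : ℕ∞) φ → HasCompactSupport φ →
        ∫⁻ x, ENNReal.ofReal (‖φ x‖ ^ p) ∂μ ≤ C * M * ∑ i ∈ Finset.range (Module.finrank ℝ E),
          ∫⁻ x, ENNReal.ofReal (‖iteratedFDeriv ℝ i φ x‖ ^ p) ∂vol := by
  obtain ⟨k, hk⟩ := Nat.exists_eq_add_of_le' hd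
  rcases k with _ | m
  · refine ⟨ENNReal.ofReal p * (2 ^ (2 * 1 + 6) * 6 ^ 1 / vol (ball 0 1)),
      ENNReal.mul_ne_top ENNReal.ofReal_ne_top
        (ENNReal.div_ne_top (by finiteness) (measure_ball_pos _ _ one_pos).ne'),
      fun μ M _ hμ φ hφ hc => ?_⟩
    have := lintegral_norm_rpow_le_of_measure_ball_le vol (d := 1) hk hp
      (hφ.of_le (by exact_mod_cast le_top)) hc (ν := μ) (M := M) (by simpa using hμ)
    simpa [hk, Finset.sum_range_succ, ← norm_iteratedFDeriv_one] using this
  · obtain ⟨C, hC, h⟩ := exists_lintegral_norm_rpow_le (F := F) vol (m := m) (by omega) hp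
    refine ⟨C, hC, fun μ M hM hμ φ hφ hc => ?_⟩
    have := sFinite_of_measure_ball_le hM hμ
    rw [hk]
    exact h μ M hμ φ hφ hc

theorem exists_forall_lintegral_norm_rpow_le_iSup (vol : Measure E) [vol.IsAddHaarMeasure]
    (hd : 2 ≤ Module.finrank ℝ E) {p : ℝ} (hp : 1 ≤ p) :
    ∃ C : ℝ, 0 < C ∧ ∀ (μ : Measure E) (φ : E → F), ContDiff ℝ (⊤ : ℕ∞) φ → HasCompactSupport φ →
      ∫⁻ x, ENNReal.ofReal (‖φ x‖ ^ p) ∂μ ≤ ENNReal.ofReal C *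
        (⨆ (x : E) (r : ℝ) (_ : 0 < r), (ENNReal.ofReal r)⁻¹ * μ (ball x r)) *
          ∑ i ∈ Finset.range (Module.finrank ℝ E),
            ∫⁻ x, ENNReal.ofReal (‖iteratedFDeriv ℝ i φ x‖ ^ p) ∂vol := by
  obtain ⟨C, hC, h⟩ := exists_lintegral_norm_rpow_le_of_two_le_finrank (F := F) vol hd hp
  have hC0 : 0 < C.toReal + 1 := by positivity
  refine ⟨C.toReal + 1, hC0, fun μ φ hφ hc => ?_⟩
  set M := ⨆ (x : E) (r : ℝ) (_ : 0 < r), (ENNReal.ofReal r)⁻¹ * μ (ball x r) with hMdef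
  by_cases hM : M = ⊤
  · by_cases hS : ∑ i ∈ Finset.range (Module.finrank ℝ E),
        ∫⁻ x, ENNReal.ofReal (‖iteratedFDeriv ℝ i φ x‖ ^ p) ∂vol = 0
    · have h0 := Finset.sum_eq_zero_iff.1 hS 0 (Finset.mem_range.2 (by omega))
      simp only [norm_iteratedFDeriv_zero] at h0
      rw [lintegral_eq_zero_iff (hφ.continuous.norm.measurable.pow_const p).ennreal_ofReal] at h0
      have hφ0 : φ =ᵐ[vol] 0 := h0.mono fun x hx => by
        by_contra hne
        have : 0 < ‖φ x‖ ^ p := Real.rpow_pos_of_pos (norm_pos_iff.2 hne) _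
        simp only [Pi.zero_apply, ENNReal.ofReal_eq_zero] at hx
        linarith
      have := Measure.eq_of_ae_eq hφ0 hφ.continuous continuous_const
      simp [this, Real.zero_rpow (by linarith : p ≠ 0)]
    · rw [hM, ENNReal.mul_top (by simpa using hC0), ENNReal.top_mul hS]
      exact le_top
  · have hball : ∀ x r, 0 < r → μ (ball x r) ≤ M * ENNReal.ofReal r := fun x r hr => by
      have : (ENNReal.ofReal r)⁻¹ * μ (ball x r) ≤ M :=
        le_iSup_of_le x (le_iSup_of_le r (le_iSup_of_le hr le_rfl))
      rwa [mul_comm, ← div_eq_mul_inv,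
        ENNReal.div_le_iff (by simpa using hr) ENNReal.ofReal_ne_top] at this
    refine (h μ M hM hball φ hφ hc).trans ?_
    gcongr
    rw [ENNReal.le_ofReal_iff_toReal_le hC hC0.le]
    linarith

end Haar

end MeasureTheory.SobolevTrace

theorem stmt8 (n : ℕ) (hn : 2 ≤ n) (p : ℝ) (hp : 1 ≤ p) :
    ∃ C : ℝ, 0 < C ∧
      ∀ (μ : Measure (EuclideanSpace ℝ (Fin n)))
        (φ : EuclideanSpace ℝ (Fin n) → ℝ),
        ContDiff ℝ (⊤ : ℕ∞) φ → HasCompactSupport φ →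
        ∫⁻ x, ENNReal.ofReal (|φ x| ^ p) ∂μ
          ≤ ENNReal.ofReal C
            * (⨆ (x : EuclideanSpace ℝ (Fin n)) (r : ℝ) (_ : 0 < r),
                (ENNReal.ofReal r)⁻¹ * μ (ball x r))
            * ∑ i ∈ Finset.range n,
                ∫⁻ x, ENNReal.ofReal (‖iteratedFDeriv ℝ i φ x‖ ^ p) := by
  have h := MeasureTheory.SobolevTrace.exists_forall_lintegral_norm_rpow_le_iSup
    (E := EuclideanSpace ℝ (Fin n)) (F := ℝ) volume (by simpa using hn) hp
  simpa only [finrank_euclideanSpace_fin, Real.norm_eq_abs] using h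
end

section
/- Let n ≥ 2 and p ≥ 1. There exists a constant C depending only on n and p such that for every smooth compactly supported function φ : ℝⁿ → ℝ, every point x₀ ∈ ℝⁿ, every unit vector v ∈ ℝⁿ, and every L > 0, one has (∫_0^L |φ(x₀ + t·v)|^p dt)^{1/p} ≤ C · (∑_{i=0}^{n−1} ∫_{ℝⁿ} ‖D^i φ(x)‖^p dx)^{1/p}; that is, the L^p norm of the restriction of φ to any unit-speed line segment (a Euclidean minimizing geodesic) is controlled by the W^{n−1,p} Sobolev norm of φ, with constant independent of the segment. -/
open MeasureTheory

open scoped ENNReal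

/-- Jensen's inequality for `x ↦ x ^ p` with respect to a probability measure. -/
theorem lintegral_rpow_le_lintegral_rpow {α : Type*} [MeasurableSpace α] {μ : Measure α}
    [IsProbabilityMeasure μ] {f : α → ℝ≥0∞} (hf : AEMeasurable f μ) {p : ℝ} (hp : 1 ≤ p) :
    (∫⁻ x, f x ∂μ) ^ p ≤ ∫⁻ x, f x ^ p ∂μ := by
  have h := eLpNorm'_le_eLpNorm'_of_exponent_le one_pos hp μ hf.aestronglyMeasurable
  simp only [eLpNorm'_eq_lintegral_enorm, enorm_eq_self, ENNReal.rpow_one, div_one] at h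
  calc (∫⁻ x, f x ∂μ) ^ p ≤ ((∫⁻ x, f x ^ p ∂μ) ^ (1 / p)) ^ p := by gcongr
    _ = ∫⁻ x, f x ^ p ∂μ := by
      rw [← ENNReal.rpow_mul, one_div_mul_cancel (by positivity), ENNReal.rpow_one]

/-- The one-dimensional Sobolev embedding of `W^{1,p}` into bounded functions. -/
theorem enorm_rpow_le_lintegral_deriv {F : Type*} [NormedAddCommGroup F] [NormedSpace ℝ F]
    {g : ℝ → F} (hg : ContDiff ℝ 1 g) {p : ℝ} (hp : 1 ≤ p) (a : ℝ) :
    ‖g a‖ₑ ^ p ≤ 2 ^ (p - 1) * ∫⁻ s, (‖g s‖ₑ ^ p + ‖deriv g s‖ₑ ^ p) := by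
  have hg' : Continuous (deriv g) := hg.continuous_deriv le_rfl
  set I := Set.Icc a (a + 1)
  have : IsProbabilityMeasure (volume.restrict I) := ⟨by simp [I]⟩
  have hpt (s : ℝ) (hs : s ∈ I) :
      ‖g a‖ₑ ^ p ≤ 2 ^ (p - 1) * (‖g s‖ₑ ^ p + ∫⁻ r in I, ‖deriv g r‖ₑ ^ p) := by
    have hle : ‖g a‖ₑ ≤ ‖g s‖ₑ + ∫⁻ r in I, ‖deriv g r‖ₑ :=
      calc ‖g a‖ₑ = ‖g s - (g s - g a)‖ₑ := by rw [sub_sub_cancel]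
        _ ≤ ‖g s‖ₑ + ‖g s - g a‖ₑ := enorm_sub_le
        _ ≤ ‖g s‖ₑ + ∫⁻ r in Set.Icc a s, ‖deriv g r‖ₑ := by
          gcongr
          exact enorm_sub_le_lintegral_deriv_of_contDiffOn_Icc hg.contDiffOn hs.1
        _ ≤ ‖g s‖ₑ + ∫⁻ r in I, ‖deriv g r‖ₑ := by
          gcongr
          exact Set.Icc_subset_Icc_right hs.2
    calc ‖g a‖ₑ ^ p ≤ (‖g s‖ₑ + ∫⁻ r in I, ‖deriv g r‖ₑ) ^ p := by gcongr
      _ ≤ 2 ^ (p - 1) * (‖g s‖ₑ ^ p + (∫⁻ r in I, ‖deriv g r‖ₑ) ^ p) :=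
        ENNReal.rpow_add_le_mul_rpow_add_rpow _ _ hp
      _ ≤ _ := by
        gcongr
        exact lintegral_rpow_le_lintegral_rpow hg'.enorm.aemeasurable hp
  have hmeas : Measurable fun s => ‖g s‖ₑ ^ p := hg.continuous.enorm.measurable.pow_const p
  calc ‖g a‖ₑ ^ p = ∫⁻ _ in I, ‖g a‖ₑ ^ p := by simp
    _ ≤ ∫⁻ s in I, 2 ^ (p - 1) * (‖g s‖ₑ ^ p + ∫⁻ r in I, ‖deriv g r‖ₑ ^ p) :=
      setLIntegral_mono' measurableSet_Icc hpt
    _ = 2 ^ (p - 1) * ∫⁻ s in I, (‖g s‖ₑ ^ p + ‖deriv g s‖ₑ ^ p) := by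
      rw [lintegral_const_mul _ (hmeas.add_const _), lintegral_add_left hmeas,
        lintegral_add_left hmeas]
      simp
    _ ≤ _ := by
      gcongr
      exact Measure.restrict_le_self

theorem enorm_iteratedFDeriv_rpow_le_lintegral {E F : Type*} [NormedAddCommGroup E]
    [NormedSpace ℝ E] [NormedAddCommGroup F] [NormedSpace ℝ F] {φ : E → F}
    (hφ : ContDiff ℝ (⊤ : ℕ∞) φ) {p : ℝ} (hp : 1 ≤ p) (j : ℕ) (z e : E) (he : ‖e‖ ≤ 1) (a : ℝ) :
    ‖iteratedFDeriv ℝ j φ z‖ₑ ^ p ≤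
      2 ^ (p - 1) * ∫⁻ s : ℝ, (‖iteratedFDeriv ℝ j φ (z + (s - a) • e)‖ₑ ^ p +
        ‖iteratedFDeriv ℝ (j + 1) φ (z + (s - a) • e)‖ₑ ^ p) := by
  have hD : ContDiff ℝ 1 (iteratedFDeriv ℝ j φ) :=
    hφ.iteratedFDeriv_right (by exact_mod_cast le_top)
  have hline (s : ℝ) : HasDerivAt (fun s : ℝ => z + (s - a) • e) e s := by
    simpa using (((hasDerivAt_id s).sub_const a).smul_const e).const_add z
  have hg : ContDiff ℝ 1 fun s : ℝ => iteratedFDeriv ℝ j φ (z + (s - a) • e) :=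
    hD.comp (by fun_prop)
  refine (le_of_eq (by simp)).trans ((enorm_rpow_le_lintegral_deriv hg hp a).trans ?_)
  gcongr with s
  have hderiv : HasDerivAt (fun s : ℝ => iteratedFDeriv ℝ j φ (z + (s - a) • e))
      (fderiv ℝ (iteratedFDeriv ℝ j φ) (z + (s - a) • e) e) s :=
    (hD.differentiable one_ne_zero _).hasFDerivAt.comp_hasDerivAt s (hline s)
  rw [hderiv.deriv, enorm_le_iff_norm_le, ← norm_fderiv_iteratedFDeriv]
  exact ContinuousLinearMap.le_of_opNorm_le_of_le _ le_rfl he |>.trans_eq (mul_one _)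

theorem le_lmarginal_of_le_lintegral_update {ι : Type*} [DecidableEq ι]
    {u : ℕ → (ι → ℝ) → ℝ≥0∞} (hu : ∀ k, Measurable (u k)) {K : ℝ≥0∞}
    (h : ∀ k x i, u k x ≤ K * ∫⁻ s, u (k + 1) (Function.update x i s)) (s : Finset ι)
    (k : ℕ) (x : ι → ℝ) :
    u k x ≤ K ^ s.card * (∫⋯∫⁻_s, u (k + s.card) ∂fun _ => volume) x := by
  induction s using Finset.induction_on generalizing k x with
  | empty => simp
  | insert i s hi ih =>
    rw [lmarginal_insert _ (hu _) hi, Finset.card_insert_of_notMem hi, pow_succ', mul_assoc,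
      ← lintegral_const_mul _ (((hu _).lmarginal _).fun_comp (measurable_update x)), add_comm s.card,
      ← add_assoc]
    refine (h k x i).trans ?_
    gcongr with t
    exact ih _ _

theorem exists_orthonormalBasis_apply_eq {n : ℕ} (i : Fin n) {v : EuclideanSpace ℝ (Fin n)}
    (hv : ‖v‖ = 1) : ∃ b : OrthonormalBasis (Fin n) ℝ (EuclideanSpace ℝ (Fin n)), b i = v := by
  have hon : Orthonormal ℝ (({i} : Set (Fin n)).domRestrict fun _ => v) :=
    ⟨fun _ => hv, fun a b hab => (hab (Subsingleton.elim a b)).elim⟩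
  obtain ⟨b, hb⟩ := hon.exists_orthonormalBasis_extension_of_card_eq (by simp)
  exact ⟨b, hb i rfl⟩

/-- The trace inequality on lines, for Lebesgue integrals with values in `[0, ∞]`. -/
theorem lintegral_line_rpow_le {n : ℕ} (hn : 0 < n) {p : ℝ} (hp : 1 ≤ p)
    {φ : EuclideanSpace ℝ (Fin n) → ℝ} (hφ : ContDiff ℝ (⊤ : ℕ∞) φ)
    (x₀ : EuclideanSpace ℝ (Fin n)) {v : EuclideanSpace ℝ (Fin n)} (hv : ‖v‖ = 1) :
    ∫⁻ t : ℝ, ‖φ (x₀ + t • v)‖ₑ ^ p ≤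
      (2 * 2 ^ (p - 1)) ^ (n - 1) *
        ∑ i ∈ Finset.range n, ∫⁻ x, ‖iteratedFDeriv ℝ i φ x‖ₑ ^ p := by
  let i₀ : Fin n := ⟨0, hn⟩
  obtain ⟨b, hb⟩ := exists_orthonormalBasis_apply_eq i₀ hv
  let T : (Fin n → ℝ) → EuclideanSpace ℝ (Fin n) := fun y => x₀ + b.repr.symm (WithLp.toLp 2 y)
  have hT : MeasurePreserving T :=
    (measurePreserving_add_left volume x₀).comp
      (b.measurePreserving_repr_symm.comp (PiLp.volume_preserving_toLp (Fin n)))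
  have hTupdate (y : Fin n → ℝ) (i : Fin n) (s : ℝ) :
      T (Function.update y i s) = T y + (s - y i) • b i := by
    have : Function.update y i s = y + (s - y i) • Pi.single i 1 := by
      ext j
      rcases eq_or_ne j i with rfl | hj <;> simp [*]
    simp only [T]
    rw [this, WithLp.toLp_add, WithLp.toLp_smul, map_add, map_smul, add_assoc,
      ← b.repr_symm_single i]
    rfl
  have hD (j : ℕ) : Measurable fun x => ‖iteratedFDeriv ℝ j φ x‖ₑ ^ p :=
    (hφ.continuous_iteratedFDeriv (by exact_mod_cast le_top)).enorm.measurable.pow_const p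
  let w : ℕ → EuclideanSpace ℝ (Fin n) → ℝ≥0∞ := fun k x =>
    ∑ j ∈ Finset.range (k + 1), ‖iteratedFDeriv ℝ j φ x‖ₑ ^ p
  have hw (k : ℕ) : Measurable (w k) := Finset.measurable_fun_sum _ fun j _ => hD j
  have hstep (k : ℕ) (y : Fin n → ℝ) (i : Fin n) :
      w k (T y) ≤ (2 * 2 ^ (p - 1)) * ∫⁻ s, w (k + 1) (T (Function.update y i s)) := by
    have hTm : Measurable fun s => T (Function.update y i s) :=
      hT.measurable.comp (measurable_update y)
    calc w k (T y)
        ≤ ∑ j ∈ Finset.range (k + 1), 2 ^ (p - 1) *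
            ∫⁻ s, (‖iteratedFDeriv ℝ j φ (T (Function.update y i s))‖ₑ ^ p +
              ‖iteratedFDeriv ℝ (j + 1) φ (T (Function.update y i s))‖ₑ ^ p) := by
          refine Finset.sum_le_sum fun j _ => ?_
          simp only [hTupdate]
          exact enorm_iteratedFDeriv_rpow_le_lintegral hφ hp j _ _ (b.norm_eq_one i).le _
      _ = 2 ^ (p - 1) * ∫⁻ s, ∑ j ∈ Finset.range (k + 1),
            (‖iteratedFDeriv ℝ j φ (T (Function.update y i s))‖ₑ ^ p +
              ‖iteratedFDeriv ℝ (j + 1) φ (T (Function.update y i s))‖ₑ ^ p) := by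
          rw [← Finset.mul_sum, lintegral_finsetSum]
          exact fun j _ => ((hD j).comp hTm).add ((hD (j + 1)).comp hTm)
      _ ≤ 2 ^ (p - 1) * ∫⁻ s, 2 * w (k + 1) (T (Function.update y i s)) := by
          gcongr with s
          rw [Finset.sum_add_distrib, two_mul]
          gcongr
          · exact Finset.sum_le_sum_of_subset (Finset.range_mono (by lia))
          · simp only [w]
            rw [Finset.sum_range_succ' _ (k + 1)]
            exact le_self_add
      _ = _ := by
          rw [lintegral_const_mul _ ((hw _).fun_comp hTm), ← mul_assoc, mul_comm (2 ^ (p - 1))]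
  let y₀ : Fin n → ℝ := 0
  have hcard : (Finset.univ.erase i₀).card = n - 1 := by simp
  have hu (k : ℕ) : Measurable fun y => w k (T y) := (hw k).comp hT.measurable
  calc ∫⁻ t : ℝ, ‖φ (x₀ + t • v)‖ₑ ^ p
      = ∫⁻ t, w 0 (T (Function.update y₀ i₀ t)) := by
        refine lintegral_congr fun t => ?_
        have h0 : T y₀ = x₀ := by simp [T, y₀]
        rw [hTupdate, h0, hb]
        simp [w, y₀, ← ofReal_norm]
    _ ≤ ∫⁻ t, (2 * 2 ^ (p - 1)) ^ (n - 1) *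
          (∫⋯∫⁻_Finset.univ.erase i₀, (fun y => w (n - 1) (T y)) ∂fun _ => volume)
            (Function.update y₀ i₀ t) := by
        gcongr with t
        have := le_lmarginal_of_le_lintegral_update hu hstep (Finset.univ.erase i₀) 0
          (Function.update y₀ i₀ t)
        rwa [hcard, zero_add] at this
    _ = (2 * 2 ^ (p - 1)) ^ (n - 1) * ∫⁻ y, w (n - 1) (T y) := by
        rw [lintegral_const_mul _ (((hu _).lmarginal _).fun_comp (measurable_update y₀)),
          volume_pi, lintegral_eq_lmarginal_univ y₀,
          lmarginal_erase _ (hu _) (Finset.mem_univ i₀)]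
    _ = _ := by
        rw [hT.lintegral_comp (hw _)]
        simp only [w]
        rw [Nat.sub_add_cancel hn, lintegral_finsetSum _ fun j _ => hD j]

theorem stmt9 (n : ℕ) (hn : 2 ≤ n) (p : ℝ) (hp : 1 ≤ p) :
    ∃ C : ℝ, 0 < C ∧
      ∀ (φ : EuclideanSpace ℝ (Fin n) → ℝ),
        ContDiff ℝ (⊤ : ℕ∞) φ → HasCompactSupport φ →
        ∀ (x₀ v : EuclideanSpace ℝ (Fin n)), ‖v‖ = 1 →
        ∀ L : ℝ, 0 < L →
          (∫ t in (0 : ℝ)..L, |φ (x₀ + t • v)| ^ p) ^ (1 / p)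
            ≤ C * (∑ i ∈ Finset.range n,
                ∫ x, ‖iteratedFDeriv ℝ i φ x‖ ^ p) ^ (1 / p) := by
  have hp0 : 0 < p := by positivity
  refine ⟨((2 * 2 ^ (p - 1)) ^ (n - 1)) ^ (1 / p), by positivity, ?_⟩
  intro φ hφ hφc x₀ v hv L hL
  have hDc (i : ℕ) : Continuous fun x => ‖iteratedFDeriv ℝ i φ x‖ ^ p :=
    (hφ.continuous_iteratedFDeriv (by exact_mod_cast le_top)).norm.rpow_const
      fun _ => Or.inr hp0.le
  have hintegrable (i : ℕ) : Integrable fun x => ‖iteratedFDeriv ℝ i φ x‖ ^ p :=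
    (hDc i).integrable_of_hasCompactSupport
      ((hφc.iteratedFDeriv i).comp_left (g := fun y => ‖y‖ ^ p)
        (by simp [Real.zero_rpow hp0.ne']))
  have hrhs (i : ℕ) : ∫⁻ x, ‖iteratedFDeriv ℝ i φ x‖ₑ ^ p =
      ENNReal.ofReal (∫ x, ‖iteratedFDeriv ℝ i φ x‖ ^ p) := by
    rw [ofReal_integral_eq_lintegral_ofReal (hintegrable i) (ae_of_all _ fun x => by positivity)]
    simp only [← ofReal_norm, ENNReal.ofReal_rpow_of_nonneg (norm_nonneg _) hp0.le]
  have hnonneg (i : ℕ) : 0 ≤ ∫ x, ‖iteratedFDeriv ℝ i φ x‖ ^ p :=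
    integral_nonneg fun x => by positivity
  have hsum : 0 ≤ ∑ i ∈ Finset.range n, ∫ x, ‖iteratedFDeriv ℝ i φ x‖ ^ p :=
    Finset.sum_nonneg fun i _ => hnonneg i
  have hline : Continuous fun t : ℝ => |φ (x₀ + t • v)| ^ p :=
    (hφ.continuous.comp (by fun_prop)).abs.rpow_const fun _ => Or.inr hp0.le
  have hconst : (2 * 2 ^ (p - 1) : ℝ≥0∞) = ENNReal.ofReal (2 * 2 ^ (p - 1)) := by
    rw [ENNReal.ofReal_mul zero_le_two, ← ENNReal.ofReal_rpow_of_nonneg zero_le_two (by linarith)]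
    simp
  have hmain : ∫ t in (0 : ℝ)..L, |φ (x₀ + t • v)| ^ p ≤
      (2 * 2 ^ (p - 1)) ^ (n - 1) *
        ∑ i ∈ Finset.range n, ∫ x, ‖iteratedFDeriv ℝ i φ x‖ ^ p := by
    rw [← ENNReal.ofReal_le_ofReal_iff (by positivity), ENNReal.ofReal_mul (by positivity),
      ENNReal.ofReal_sum_of_nonneg fun i _ => hnonneg i, ENNReal.ofReal_pow (by positivity),
      ← hconst]
    simp only [← hrhs]
    refine le_trans ?_ (lintegral_line_rpow_le (by lia) hp hφ x₀ hv)
    rw [intervalIntegral.integral_of_le hL.le, ofReal_integral_eq_lintegral_ofReal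
      hline.integrableOn_Ioc (ae_of_all _ fun t => by positivity)]
    refine (setLIntegral_le_lintegral _ _).trans_eq (lintegral_congr fun t => ?_)
    rw [← ofReal_norm, ENNReal.ofReal_rpow_of_nonneg (norm_nonneg _) hp0.le, Real.norm_eq_abs]
  rw [← Real.mul_rpow (by positivity) hsum]
  exact Real.rpow_le_rpow
    (intervalIntegral.integral_nonneg hL.le fun t _ => by positivity) hmain (by positivity)
end

section
/- Let n ≥ 2. There exists a constant c > 0 depending only on n with the following property: for every open set Ω ⊆ ℝⁿ, every d > 0 and every x ∈ Ω, either (a) vol(B(x,d) ∩ Ω) ≥ vol(B(x,d))/2, or (b) there exists r ∈ (0,d) such that H^{n−1}(∂Ω ∩ B(x,r)) ≥ c·r^{n−1}, where ∂Ω denotes the topological frontier of Ω, vol is Lebesgue measure, B(x,r) is the open Euclidean ball of radius r centered at x, and H^{n−1} is the (n−1)-dimensional Hausdorff measure on ℝⁿ. -/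
open MeasureTheory Metric

section Sweep

variable {E : Type*} [NormedAddCommGroup E] [NormedSpace ℝ E]

/-- The set of starting points `a` such that the segment from `a` to `a + u` meets `T`. -/
def sweep (u : E) (T : Set E) : Set E := {a | ∃ t ∈ Set.Icc (0 : ℝ) 1, a + t • u ∈ T}

theorem sweep_mono (u : E) {S T : Set E} (h : S ⊆ T) : sweep u S ⊆ sweep u T :=
  fun _ ⟨t, ht, hx⟩ => ⟨t, ht, h hx⟩

variable [MeasurableSpace E] [BorelSpace E] [FiniteDimensional ℝ E]

theorem measure_sweep_closedBall_le (μ : Measure E) [μ.IsAddHaarMeasure] {m : ℕ}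
    (hm : Module.finrank ℝ E = m + 1) (z u : E) {δ : ℝ} (hδ : 0 < δ) :
    μ (sweep u (closedBall z δ)) ≤
      ENNReal.ofReal (2 ^ (m + 1) * δ ^ m * (‖u‖ + 3 * δ)) * μ (ball 0 1) := by
  set N : ℕ := ⌈‖u‖ / δ⌉₊ + 1 with hN
  have hNpos : (0 : ℝ) < N := by positivity
  have hceil : ‖u‖ / δ ≤ N := by
    rw [hN]; push_cast; linarith [Nat.le_ceil (‖u‖ / δ)]
  have hNle : (N : ℝ) ≤ ‖u‖ / δ + 2 := by
    rw [hN]; push_cast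
    linarith [Nat.ceil_lt_add_one (a := ‖u‖ / δ) (by positivity)]
  have hcover : sweep u (closedBall z δ) ⊆
      ⋃ k ∈ Finset.range (N + 1), closedBall (z - ((k : ℝ) / N) • u) (2 * δ) := by
    rintro a ⟨t, ⟨ht0, ht1⟩, hat⟩
    have hfl : (⌊t * N⌋₊ : ℝ) ≤ t * N := Nat.floor_le (by positivity)
    have hfl' : t * N < ⌊t * N⌋₊ + 1 := Nat.lt_floor_add_one _
    simp only [Set.mem_iUnion, Finset.mem_range]
    refine ⟨⌊t * N⌋₊, ?_, ?_⟩
    · have : (⌊t * N⌋₊ : ℝ) ≤ N := hfl.trans (by nlinarith)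
      have : ⌊t * N⌋₊ ≤ N := by exact_mod_cast this
      omega
    · rw [mem_closedBall, dist_eq_norm] at hat ⊢
      have h1 : |(⌊t * N⌋₊ : ℝ) / N - t| ≤ 1 / N := by
        rw [abs_le]; constructor
        · rw [le_sub_iff_add_le, le_div_iff₀ hNpos, add_mul, neg_mul, one_div_mul_cancel hNpos.ne']
          linarith
        · rw [sub_le_iff_le_add, div_le_iff₀ hNpos, add_mul, one_div_mul_cancel hNpos.ne']
          linarith
      have h2 : ‖((⌊t * N⌋₊ : ℝ) / N - t) • u‖ ≤ δ := by
        rw [norm_smul, Real.norm_eq_abs]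
        calc _ ≤ 1 / N * ‖u‖ := by gcongr
          _ ≤ δ := by
            rw [div_mul_eq_mul_div, one_mul, div_le_iff₀ hNpos]
            rwa [div_le_iff₀ hδ, mul_comm] at hceil
      calc ‖a - (z - ((⌊t * N⌋₊ : ℝ) / N) • u)‖
          = ‖(a + t • u - z) + ((⌊t * N⌋₊ : ℝ) / N - t) • u‖ := by
            congr 1; rw [sub_smul]; abel
        _ ≤ δ + δ := (norm_add_le _ _).trans (add_le_add hat h2)
        _ = 2 * δ := by ring
  calc μ (sweep u (closedBall z δ))
      ≤ ∑ k ∈ Finset.range (N + 1), μ (closedBall (z - ((k : ℝ) / N) • u) (2 * δ)) :=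
        (measure_mono hcover).trans (measure_biUnion_finset_le _ _)
    _ = ENNReal.ofReal ((N + 1) * (2 * δ) ^ (m + 1)) * μ (ball 0 1) := by
        simp only [Measure.addHaar_closedBall μ _ (by positivity : 0 ≤ 2 * δ), hm]
        rw [Finset.sum_const, Finset.card_range, nsmul_eq_mul, ← mul_assoc,
          ENNReal.ofReal_mul (by positivity)]
        congr 2
        rw [← Nat.cast_succ, ENNReal.ofReal_natCast]
    _ ≤ _ := by
        refine mul_le_mul_left (ENNReal.ofReal_le_ofReal ?_) _
        calc ((N : ℝ) + 1) * (2 * δ) ^ (m + 1) ≤ (‖u‖ / δ + 3) * (2 * δ) ^ (m + 1) := by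
              exact mul_le_mul_of_nonneg_right (by linarith) (by positivity)
          _ = _ := by field_simp; ring

theorem measure_sweep_le (μ : Measure E) [μ.IsAddHaarMeasure] {m : ℕ}
    (hm : Module.finrank ℝ E = m + 1) (u : E) {T : Set E} (hT : ediam T ≠ ⊤) :
    μ (sweep u T) ≤
      ENNReal.ofReal (2 ^ (m + 1) * diam T ^ m * (‖u‖ + 3 * diam T)) * μ (ball 0 1) := by
  rcases T.eq_empty_or_nonempty with rfl | ⟨z, hz⟩
  · simp [sweep]
  have hcont : Filter.Tendsto (fun δ : ℝ =>
      ENNReal.ofReal (2 ^ (m + 1) * δ ^ m * (‖u‖ + 3 * δ)) * μ (ball 0 1))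
      (nhdsWithin (diam T) (Set.Ioi (diam T)))
      (nhds (ENNReal.ofReal (2 ^ (m + 1) * diam T ^ m * (‖u‖ + 3 * diam T)) * μ (ball 0 1))) := by
    refine ENNReal.Tendsto.mul_const (ENNReal.tendsto_ofReal ?_) (Or.inr measure_ball_lt_top.ne)
    refine Filter.Tendsto.mono_left (Continuous.tendsto ?_ _) nhdsWithin_le_nhds
    fun_prop
  refine ge_of_tendsto hcont ?_
  filter_upwards [self_mem_nhdsWithin] with δ hδ
  have hδ' : diam T < δ := hδ
  refine (measure_mono (sweep_mono u fun y hy => ?_)).trans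
    (measure_sweep_closedBall_le μ hm z u (diam_nonneg.trans_lt hδ'))
  exact (dist_le_diam_of_mem' hT hy hz).trans hδ'.le

theorem measure_sweep_le_hausdorffMeasure (μ : Measure E) [μ.IsAddHaarMeasure] {m : ℕ}
    (hm : Module.finrank ℝ E = m + 1) {u : E} {L : ℝ} (hL : 0 < L) (hu : ‖u‖ ≤ L) (S : Set E) :
    μ (sweep u S) ≤
      ENNReal.ofReal (2 ^ (m + 1) * (4 * L)) * μ (ball 0 1) * μH[(m : ℝ)] S := by
  set K := ENNReal.ofReal (2 ^ (m + 1) * (4 * L)) * μ (ball 0 1) with hK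
  have hKtop : K ≠ ⊤ := ENNReal.mul_ne_top ENNReal.ofReal_ne_top measure_ball_lt_top.ne
  rw [mul_comm]
  refine (ENNReal.div_le_iff_le_mul (Or.inl ?_) (Or.inl hKtop)).1 ?_
  · refine mul_ne_zero ?_ (measure_ball_pos μ 0 one_pos).ne'
    rw [Ne, ENNReal.ofReal_eq_zero, not_le]; positivity
  rw [Measure.hausdorffMeasure_apply]
  refine le_iSup₂_of_le (ENNReal.ofReal L) (by simpa using hL) ?_
  refine le_iInf fun t => le_iInf fun hSt => le_iInf fun hdiam => ?_
  refine ENNReal.div_le_of_le_mul ?_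
  rw [← ENNReal.tsum_mul_right]
  have hsub : sweep u S ⊆ ⋃ i, sweep u (t i) := by
    rintro a ⟨s, hs, ha⟩
    obtain ⟨i, hi⟩ := Set.mem_iUnion.1 (hSt ha)
    exact Set.mem_iUnion.2 ⟨i, s, hs, hi⟩
  refine (measure_mono hsub).trans ((measure_iUnion_le _).trans (ENNReal.tsum_le_tsum fun i => ?_))
  rcases (t i).eq_empty_or_nonempty with h | h
  · simp [h, sweep]
  have htop : ediam (t i) ≠ ⊤ := ne_top_of_le_ne_top ENNReal.ofReal_ne_top (hdiam i)
  have hD : diam (t i) ≤ L := ENNReal.toReal_le_of_le_ofReal hL.le (hdiam i)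
  rw [ciSup_pos h, ENNReal.rpow_natCast, ← ENNReal.ofReal_toReal htop, ← ENNReal.ofReal_pow
    ENNReal.toReal_nonneg, hK, ← mul_assoc, ← ENNReal.ofReal_mul (by positivity)]
  refine (measure_sweep_le μ hm u htop).trans ?_
  refine mul_le_mul_left (ENNReal.ofReal_le_ofReal ?_) _
  change _ ≤ diam (t i) ^ m * _
  have : (0 : ℝ) ≤ diam (t i) ^ m := pow_nonneg diam_nonneg _
  calc 2 ^ (m + 1) * diam (t i) ^ m * (‖u‖ + 3 * diam (t i))
      ≤ 2 ^ (m + 1) * diam (t i) ^ m * (4 * L) := by gcongr; linarith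
    _ = _ := by ring

theorem lintegral_measure_inter_add_preimage (μ : Measure E) [μ.IsAddHaarMeasure] {A B : Set E}
    (hA : MeasurableSet A) (hB : MeasurableSet B) :
    ∫⁻ u, μ {a | a ∈ A ∧ a + u ∈ B} ∂μ = μ A * μ B := by
  have h1 : ∀ u, μ {a | a ∈ A ∧ a + u ∈ B} =
      ∫⁻ a, A.indicator 1 a * B.indicator 1 (a + u) ∂μ := by
    intro u
    have hu : MeasurableSet {a | a ∈ A ∧ a + u ∈ B} := hA.inter ((measurable_add_const u) hB)
    rw [← lintegral_indicator_one hu]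
    congr with a
    by_cases ha : a ∈ A <;> by_cases hb : a + u ∈ B <;> simp [Set.indicator, ha, hb]
  have hmA : Measurable (A.indicator (1 : E → ENNReal)) := measurable_one.indicator hA
  have hmB : Measurable (B.indicator (1 : E → ENNReal)) := measurable_one.indicator hB
  simp_rw [h1]
  rw [lintegral_lintegral_swap]
  · have h2 : ∀ a, ∫⁻ u, A.indicator 1 a * B.indicator 1 (a + u) ∂μ = A.indicator 1 a * μ B := by
      intro a
      rw [lintegral_const_mul _ (by fun_prop : Measurable fun u => B.indicator 1 (a + u)),
        lintegral_add_left_eq_self (fun u => B.indicator 1 u) a, lintegral_indicator_one hB]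
    simp_rw [h2]
    rw [lintegral_mul_const _ hmA, lintegral_indicator_one hA]
  · exact ((hmA.comp measurable_snd).mul
      (hmB.comp (measurable_snd.add measurable_fst))).aemeasurable

/-- A relative isoperimetric inequality in balls, for the topological frontier. -/
theorem measure_mul_measure_le_hausdorffMeasure_frontier (μ : Measure E) [μ.IsAddHaarMeasure]
    {m : ℕ} (hm : Module.finrank ℝ E = m + 1) {Ω : Set E} (hΩ : IsOpen Ω) (x : E) {r : ℝ}
    (hr : 0 < r) :
    μ (ball x r ∩ Ω) * μ (ball x r \ Ω) ≤
      ENNReal.ofReal (2 ^ (m + 1) * (4 * (2 * r))) * μ (ball 0 1) *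
        μH[(m : ℝ)] (frontier Ω ∩ ball x r) * μ (ball 0 (2 * r)) := by
  rw [← lintegral_measure_inter_add_preimage μ (measurableSet_ball.inter hΩ.measurableSet)
    (measurableSet_ball.diff hΩ.measurableSet), ← lintegral_indicator_const measurableSet_ball]
  refine lintegral_mono fun u => ?_
  by_cases hu : u ∈ ball (0 : E) (2 * r)
  · rw [Set.indicator_of_mem hu]
    refine le_trans (measure_mono ?_) (measure_sweep_le_hausdorffMeasure μ hm (by positivity)
      (mem_ball_zero_iff.1 hu).le _)
    rintro a ⟨⟨ha, haΩ⟩, hb, hbΩ⟩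
    by_contra hcon
    have hseg : segment ℝ a (a + u) ⊆ ball x r := (convex_ball x r).segment_subset ha hb
    have havoid : ∀ y ∈ segment ℝ a (a + u), y ∉ frontier Ω := by
      intro y hy hyΩ
      refine hcon ?_
      obtain ⟨t, ht, rfl⟩ := (segment_eq_image' ℝ a (a + u)).subset hy
      refine ⟨t, ht, ?_⟩
      simp only [add_sub_cancel_left] at hyΩ hseg hy
      exact ⟨hyΩ, hseg hy⟩
    have hcl : ∀ y ∈ segment ℝ a (a + u), y ∉ Ω → y ∉ closure Ω := fun y hy h1 h2 =>
      havoid y hy (by rw [hΩ.frontier_eq]; exact ⟨h2, h1⟩)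
    obtain ⟨y, -, hy1, hy2⟩ := (convex_segment (𝕜 := ℝ) a (a + u)).isPreconnected Ω (closure Ω)ᶜ
      hΩ isClosed_closure.isOpen_compl
      (fun y hy => by by_cases h : y ∈ Ω <;> [exact Or.inl h; exact Or.inr (hcl y hy h)])
      ⟨a, left_mem_segment ℝ _ _, haΩ⟩
      ⟨a + u, right_mem_segment ℝ _ _, hcl _ (right_mem_segment ℝ _ _) hbΩ⟩
    exact hy2 (subset_closure hy1)
  · rw [Set.indicator_of_notMem hu, nonpos_iff_eq_zero]
    refine measure_mono_null (t := ∅) ?_ measure_empty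
    rintro a ⟨⟨ha, -⟩, hb, -⟩
    refine hu (mem_ball_zero_iff.2 ?_)
    have := dist_triangle_right (a + u) a x
    rw [dist_eq_norm, add_sub_cancel_left] at this
    rw [mem_ball] at ha hb
    linarith

theorem exists_measure_ball_inter_eq_half (μ : Measure E) [μ.IsAddHaarMeasure] [Nontrivial E]
    {Ω : Set E} (hΩ : IsOpen Ω) {x : E} (hx : x ∈ Ω) {d : ℝ} (hd : 0 < d)
    (h : μ (ball x d ∩ Ω) < μ (ball x d) / 2) :
    ∃ r, 0 < r ∧ r < d ∧ μ.real (ball x r ∩ Ω) = μ.real (ball x r) / 2 := by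
  set n := Module.finrank ℝ E
  set w := μ.real (ball (0 : E) 1)
  have hw : 0 < w := ENNReal.toReal_pos (measure_ball_pos μ 0 one_pos).ne' measure_ball_lt_top.ne
  have hball : ∀ r, 0 ≤ r → μ.real (ball x r) = r ^ n * w := fun r hr => by
    rw [measureReal_def, Measure.addHaar_ball μ x hr, ENNReal.toReal_mul,
      ENNReal.toReal_ofReal (by positivity), ← measureReal_def]
  obtain ⟨ε, hε, hεΩ⟩ := Metric.isOpen_iff.1 hΩ x hx
  set s := min ε (d / 2)
  have hs : 0 < s := lt_min hε (by positivity)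
  have hsd : s < d := (min_le_right _ _).trans_lt (by linarith)
  have hmono : ∀ a b, 0 ≤ a → a ≤ b →
      |μ.real (ball x b ∩ Ω) - μ.real (ball x a ∩ Ω)| ≤ |b ^ n * w - a ^ n * w| := by
    intro a b ha hab
    have hfin : ∀ {t : Set E} {r : ℝ}, t ⊆ ball x r → μ t ≠ ⊤ := fun h =>
      ne_top_of_le_ne_top measure_ball_lt_top.ne (measure_mono h)
    have h1 : μ.real (ball x a ∩ Ω) ≤ μ.real (ball x b ∩ Ω) :=
      measureReal_mono (Set.inter_subset_inter_left _ (ball_subset_ball hab))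
        (hfin Set.inter_subset_left)
    have h2 : μ.real (ball x b ∩ Ω) ≤ μ.real (ball x a ∩ Ω) + μ.real (ball x b \ ball x a) := by
      refine (measureReal_mono ?_ ?_).trans (measureReal_union_le _ _)
      · intro y hy
        by_cases hya : y ∈ ball x a
        · exact Or.inl ⟨hya, hy.2⟩
        · exact Or.inr ⟨hy.1, hya⟩
      · exact hfin (r := b) (Set.union_subset
          (Set.inter_subset_left.trans (ball_subset_ball hab)) Set.sdiff_subset)
    have h3 : μ.real (ball x b \ ball x a) = b ^ n * w - a ^ n * w := by
      rw [measureReal_sdiff (ball_subset_ball hab) measurableSet_ball measure_ball_lt_top.ne,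
        hball a ha, hball b (ha.trans hab)]
    rw [abs_of_nonneg (by linarith)]
    exact le_trans (by linarith) (le_abs_self _)
  have hcontV : ContinuousOn (fun r => μ.real (ball x r ∩ Ω)) (Set.Icc s d) := by
    intro a ha
    have ha0 : 0 ≤ a := hs.le.trans ha.1
    refine tendsto_iff_dist_tendsto_zero.2 ?_
    refine squeeze_zero' (g := fun r => |r ^ n * w - a ^ n * w|) (.of_forall fun _ => dist_nonneg)
      ?_ ?_
    · filter_upwards [self_mem_nhdsWithin] with b hb
      rw [Real.dist_eq]
      rcases le_total a b with hab | hab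
      · exact hmono a b ha0 hab
      · rw [abs_sub_comm, abs_sub_comm (b ^ n * w)]
        exact hmono b a (hs.le.trans hb.1) hab
    · have : Continuous fun r : ℝ => |r ^ n * w - a ^ n * w| := by fun_prop
      simpa using (this.tendsto a).mono_left nhdsWithin_le_nhds
  have hcont : ContinuousOn (fun r => μ.real (ball x r ∩ Ω) - r ^ n * w / 2) (Set.Icc s d) :=
    hcontV.sub (by fun_prop)
  have hds : μ.real (ball x d ∩ Ω) - d ^ n * w / 2 < 0 := by
    rw [← hball d hd.le, sub_neg]
    have := (ENNReal.toReal_lt_toReal h.ne_top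
      (ENNReal.div_ne_top measure_ball_lt_top.ne two_ne_zero)).2 h
    rwa [ENNReal.toReal_div] at this
  have hss : 0 < μ.real (ball x s ∩ Ω) - s ^ n * w / 2 := by
    rw [Set.inter_eq_left.2 ((ball_subset_ball (min_le_left _ _)).trans hεΩ), hball s hs.le]
    have : 0 < s ^ n * w := by positivity
    linarith
  obtain ⟨r, hr, hr0⟩ := intermediate_value_Icc' hsd.le hcont ⟨hds.le, hss.le⟩
  have hr0 : μ.real (ball x r ∩ Ω) - r ^ n * w / 2 = 0 := hr0
  have hrpos : 0 < r := hs.trans_le hr.1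
  refine ⟨r, hrpos, lt_of_le_of_ne hr.2 ?_, ?_⟩
  · rintro rfl
    exact hds.ne hr0
  · rw [hball r hrpos.le]; linarith

end Sweep

theorem stmt12 (n : ℕ) (hn : 2 ≤ n) :
    ∃ c : ℝ, 0 < c ∧
      ∀ (Ω : Set (EuclideanSpace ℝ (Fin n))), IsOpen Ω →
      ∀ d : ℝ, 0 < d → ∀ x ∈ Ω,
        volume (ball x d) / 2 ≤ volume (ball x d ∩ Ω) ∨
        ∃ r : ℝ, 0 < r ∧ r < d ∧
          ENNReal.ofReal (c * r ^ ((n : ℝ) - 1))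
            ≤ μH[(n : ℝ) - 1] (frontier Ω ∩ ball x r) := by
  obtain ⟨m, rfl⟩ : ∃ m, n = m + 1 := ⟨n - 1, by omega⟩
  have hm : Module.finrank ℝ (EuclideanSpace ℝ (Fin (m + 1))) = m + 1 := by simp
  refine ⟨1 / (32 * 4 ^ (m + 1)), by positivity, fun Ω hΩ d hd x hx => ?_⟩
  refine or_iff_not_imp_left.2 fun hlt => ?_
  obtain ⟨r, hr, hrd, hhalf⟩ := exists_measure_ball_inter_eq_half volume hΩ hx hd (not_le.1 hlt)
  refine ⟨r, hr, hrd, ?_⟩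
  have key := measure_mul_measure_le_hausdorffMeasure_frontier volume hm hΩ x hr
  rw [Nat.cast_succ, add_sub_cancel_right, Real.rpow_natCast]
  rcases eq_or_ne (μH[(m : ℝ)] (frontier Ω ∩ ball x r)) ⊤ with hH | hH
  · rw [hH]; exact le_top
  refine ENNReal.ofReal_le_of_le_toReal ?_
  set H := (μH[(m : ℝ)] (frontier Ω ∩ ball x r)).toReal
  set w := volume.real (ball (0 : EuclideanSpace ℝ (Fin (m + 1))) 1)
  have hw : 0 < w :=
    ENNReal.toReal_pos (measure_ball_pos volume 0 one_pos).ne' measure_ball_lt_top.ne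
  have hball : ∀ (y : EuclideanSpace ℝ (Fin (m + 1))) (r : ℝ), 0 ≤ r →
      volume.real (ball y r) = r ^ (m + 1) * w := fun y r hr => by
    rw [measureReal_def, Measure.addHaar_ball volume y hr, ENNReal.toReal_mul,
      ENNReal.toReal_ofReal (by positivity), ← measureReal_def, hm]
  have hdiff : volume.real (ball x r \ Ω) = volume.real (ball x r) / 2 := by
    have := measureReal_inter_add_sdiff (μ := volume) (s := ball x r) hΩ.measurableSet
      measure_ball_lt_top.ne
    linarith
  have key' := ENNReal.toReal_mono (by
    refine ENNReal.mul_ne_top (ENNReal.mul_ne_top (ENNReal.mul_ne_top ENNReal.ofReal_ne_top ?_) hH) ?_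
    all_goals exact measure_ball_lt_top.ne) key
  simp only [ENNReal.toReal_mul, ← measureReal_def] at key'
  rw [ENNReal.toReal_ofReal (by positivity), hhalf, hdiff, hball x r hr.le,
    hball 0 (2 * r) (by positivity)] at key'
  change _ ≤ _ * w * H * _ at key'
  have hfac : 0 < r ^ (m + 2) * w ^ 2 * (8 * 4 ^ (m + 1)) := by positivity
  refine le_of_mul_le_mul_left ?_ hfac
  calc r ^ (m + 2) * w ^ 2 * (8 * 4 ^ (m + 1)) * (1 / (32 * 4 ^ (m + 1)) * r ^ m)
      = r ^ (m + 1) * w / 2 * (r ^ (m + 1) * w / 2) := by field_simp; ring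
    _ ≤ _ := key'
    _ = _ := by
      rw [mul_pow, show (4 : ℝ) = 2 * 2 by norm_num, mul_pow]; ring
end

section
/- Let α ∈ (0,1]. For each integer j ≥ 1 set h_j = 2^{j(1−α)} and δ_j = 2^{−j}·(h_j + √2 + 1). Then there exists λ ≥ 1, depending only on α, such that for every integer j ≥ 1 and every s ∈ [0,2], min((2 + h_j)·s, 2·s + δ_j) ≤ λ·s^α. -/
/-- For `r ≥ 1`, the minimum of the two linear bounds with height `r ^ (1 - α)` is at most
`8 * s ^ α` on `[0, 2]`; the two cases are separated at the scale `s = r⁻¹`. -/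
theorem min_linear_le_rpow {α r s : ℝ} (hα₀ : 0 ≤ α) (hα₁ : α ≤ 1) (hr : 1 ≤ r)
    (hs₀ : 0 ≤ s) (hs₂ : s ≤ 2) :
    min ((2 + r ^ (1 - α)) * s) (2 * s + r⁻¹ * (r ^ (1 - α) + √2 + 1)) ≤ 8 * s ^ α := by
  have hr₀ : 0 < r := by linarith
  have hβ : 0 ≤ 1 - α := by linarith
  have hsα : 0 ≤ s ^ α := Real.rpow_nonneg hs₀ α
  have split_s : s ^ (1 - α) * s ^ α = s := by
    rw [← Real.rpow_add_of_nonneg hs₀ hβ hα₀, sub_add_cancel, Real.rpow_one]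
  have hs : s ≤ 2 * s ^ α := by
    have h : s ^ (1 - α) ≤ 2 := calc
      s ^ (1 - α) ≤ (2 : ℝ) ^ (1 - α) := Real.rpow_le_rpow hs₀ hs₂ hβ
      _ ≤ (2 : ℝ) ^ (1 : ℝ) := Real.rpow_le_rpow_of_exponent_le (by norm_num) (by linarith)
      _ = 2 := Real.rpow_one 2
    calc s = s ^ (1 - α) * s ^ α := split_s.symm
      _ ≤ 2 * s ^ α := by gcongr
  rcases le_total (r * s) 1 with hrs | hrs
  · refine (min_le_left _ _).trans ?_
    have h : r ^ (1 - α) * s ≤ s ^ α := calc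
      r ^ (1 - α) * s = (r * s) ^ (1 - α) * s ^ α := by
        rw [Real.mul_rpow hr₀.le hs₀, mul_assoc, split_s]
      _ ≤ s ^ α :=
        mul_le_of_le_one_left hsα (Real.rpow_le_one (by positivity) hrs hβ)
    linarith
  · refine (min_le_right _ _).trans ?_
    have hrinv : r⁻¹ ≤ s := (inv_le_iff_one_le_mul₀' hr₀).2 hrs
    have hpow : r⁻¹ ^ α ≤ s ^ α := Real.rpow_le_rpow (by positivity) hrinv hα₀
    have height : r⁻¹ * r ^ (1 - α) = r⁻¹ ^ α := by
      rw [Real.inv_rpow hr₀.le, Real.rpow_sub hr₀, Real.rpow_one]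
      field_simp
    have scale : r⁻¹ ≤ r⁻¹ ^ α :=
      Real.self_le_rpow_of_le_one (by positivity) (inv_le_one_of_one_le₀ hr) hα₁
    have hsqrt : √2 ≤ 2 := Real.sqrt_le_iff.2 (by norm_num)
    have defect : r⁻¹ * (√2 + 1) ≤ s ^ α * 3 :=
      mul_le_mul (scale.trans hpow) (by linarith) (by positivity) hsα
    linarith

theorem stmt13 (α : ℝ) (hα : α ∈ Set.Ioc (0 : ℝ) 1) :
    ∃ lam : ℝ, 1 ≤ lam ∧
      ∀ j : ℕ, 1 ≤ j → ∀ s ∈ Set.Icc (0 : ℝ) 2,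
        min ((2 + (2 : ℝ) ^ ((j : ℝ) * (1 - α))) * s)
            (2 * s + (2 : ℝ) ^ (-(j : ℝ)) * ((2 : ℝ) ^ ((j : ℝ) * (1 - α)) + Real.sqrt 2 + 1))
          ≤ lam * s ^ α := by
  refine ⟨8, by norm_num, fun j _ s hs => ?_⟩
  rw [Real.rpow_mul zero_le_two, Real.rpow_neg zero_le_two]
  exact min_linear_le_rpow hα.1.le hα.2
    (Real.one_le_rpow one_le_two (Nat.cast_nonneg j)) hs.1 hs.2
end
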